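/- Let (R,m) be a Noetherian local ring and let M be a finitely generated unmixed R-module of dimension s ≥ 2. Then M is a generalized Cohen-Macaulay R-module if and only if the set Λ(M) = { e_1(Q,M) : Q a parameter ideal for M } is finite. In this case, −Σ_{i=1}^{s−1} C(s−2,i−1)·λ(H^i_m(M)) ≤ e_1(Q,M) ≤ 0 for every parameter ideal Q for M. -/

import Mathlib

universe u

open Finset IsLocalRing CategoryTheory

/-- The length of an `R`-module `M`: the Krull dimension of its lattice of submodules,
i.e. the supremum of the lengths of chains of submodules of `M`. -/
noncomputable def moduleLength (R M : Type*) [CommRing R] [AddCommGroup M] [Module R M] :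
    WithBot ℕ∞ :=
  Order.krullDim (Submodule R M)

/-- `e 0, …, e s` are the Hilbert coefficients of a module `M` relative to an ideal `Q`
(`s` the dimension of `M`): for all large `n`,
`λ(M ⧸ Q^(n+1) M) = ∑_{i=0}^{s} (-1)^i (e i) C(n+s-i, s-i)`. -/
def HasHilbertCoeffsMod {R : Type*} (M : Type*) [CommRing R] [AddCommGroup M] [Module R M]
    (Q : Ideal R) (s : ℕ) (e : ℕ → ℤ) : Prop :=
  ∃ N : ℕ, ∀ n ≥ N, ∃ l : ℕ,
    moduleLength R (M ⧸ (Q ^ (n + 1) • ⊤ : Submodule R M)) = (l : WithBot ℕ∞) ∧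
    (l : ℤ) = ∑ i ∈ Finset.range (s + 1), (-1 : ℤ) ^ i * e i * ((n + s - i).choose (s - i))

/-- A parameter ideal for a module `M` of dimension `s`: an ideal generated by `s` elements
of the maximal ideal with `λ(M/QM) < ∞`. -/
def IsParameterIdealFor {R : Type*} [CommRing R] [IsLocalRing R]
    (M : Type*) [AddCommGroup M] [Module R M] (s : ℕ) (Q : Ideal R) : Prop :=
  (∃ x : Fin s → R, (∀ i, x i ∈ maximalIdeal R) ∧ Q = Ideal.span (Set.range x)) ∧
    ∃ l : ℕ, moduleLength R (M ⧸ (Q • ⊤ : Submodule R M)) = (l : WithBot ℕ∞)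

/-- A finitely generated module `M` of dimension `s` is unmixed if `dim(R̂/p) = s = dim M̂`
for every associated prime `p` of the `m`-adic completion `M̂` of `M` over `R̂`. -/
def IsUnmixedModule (R M : Type*) [CommRing R] [IsLocalRing R] [AddCommGroup M] [Module R M]
    (s : ℕ) : Prop :=
  ∀ p ∈ associatedPrimes (AdicCompletion (maximalIdeal R) R)
      (AdicCompletion (maximalIdeal R) M),
    ringKrullDim (AdicCompletion (maximalIdeal R) R ⧸ p) = (s : WithBot ℕ∞)

/-- A module `M` of dimension `s` is Cohen-Macaulay if its depth equals its dimension,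
equivalently, if there is an `M`-regular sequence of length `s` in the maximal ideal. -/
def IsCohenMacaulayModule (R M : Type*) [CommRing R] [IsLocalRing R] [AddCommGroup M]
    [Module R M] (s : ℕ) : Prop :=
  ∃ rs : List R, (∀ x ∈ rs, x ∈ maximalIdeal R) ∧
    RingTheory.Sequence.IsRegular M rs ∧ rs.length = s

/-- The length of the `i`-th local cohomology module `Hⁱ_m(M)`. -/
noncomputable def localCohomologyLength (R M : Type u) [CommRing R] [IsLocalRing R]
    [AddCommGroup M] [Module R M] (i : ℕ) : WithBot ℕ∞ :=
  moduleLength R ((localCohomology (maximalIdeal R) i).obj (ModuleCat.of R M))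

/-- A finitely generated module `M` of dimension `s` is generalized Cohen-Macaulay if `M_p`
is Cohen-Macaulay for every non-maximal prime in the support; equivalently, the local
cohomology modules `Hⁱ_m(M)` have finite length for all `i < s`. -/
def IsGeneralizedCMModule (R M : Type u) [CommRing R] [IsLocalRing R] [AddCommGroup M]
    [Module R M] (s : ℕ) : Prop :=
  ∀ i, i < s → ∃ l : ℕ, localCohomologyLength R M i = (l : WithBot ℕ∞)

set_option linter.unusedSectionVars false

namespace LocCoh

open scoped Pointwise

section OldExt
open Abelian HomologicalComplex
variable {R : Type u} [CommRing R] {X Y : ModuleCat.{u} R} (P : ProjectiveResolution X) (n : ℕ)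

lemma extMk_smul (r : R) (f : P.complex.X n ⟶ Y) (hf : P.complex.d (n+1) n ≫ f = 0) :
    P.extMk (r • f) (n+1) rfl (by simp [hf]) = r • P.extMk f (n+1) rfl hf := by
  have h := P.extMk_comp_mk₀ f (n+1) rfl hf (r • 𝟙 Y)
  rw [Abelian.Ext.mk₀_smul, Abelian.Ext.comp_smul, Abelian.Ext.comp_mk₀_id] at h
  rw [h]
  congr 1

/-- Cocycles map linearly to `Ext`. -/
noncomputable def cocycleToExt :
    LinearMap.ker ((P.complex.linearYonedaObj R Y).d n (n+1)).hom →ₗ[R] Abelian.Ext X Y n where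
  toFun := fun c => P.extMk (c.1 : P.complex.X n ⟶ Y) (n+1) rfl c.2
  map_add' := fun a b => (P.add_extMk (a.1 : P.complex.X n ⟶ Y) b.1 (n+1) rfl a.2 b.2).symm
  map_smul' := fun r a => extMk_smul P n r (a.1 : P.complex.X n ⟶ Y) a.2

lemma iCycles_cocycle (c : (P.complex.linearYonedaObj R Y).cycles n) :
    P.complex.d (n+1) n ≫ ((P.complex.linearYonedaObj R Y).iCycles n c : P.complex.X n ⟶ Y) = 0 :=
  congrArg (fun f => f.hom c) ((P.complex.linearYonedaObj R Y).iCycles_d n (n+1))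

noncomputable def cyclesToExt :
    (P.complex.linearYonedaObj R Y).cycles n ⟶ ModuleCat.of R (Abelian.Ext X Y n) :=
  ModuleCat.ofHom ((cocycleToExt P n).comp
    (((P.complex.linearYonedaObj R Y).iCycles n).hom.codRestrict _ (iCycles_cocycle P n)))

lemma extMk_zero_deg (f : P.complex.X 0 ⟶ Y) (hf : P.complex.d 1 0 ≫ f = 0)
   (h : P.extMk f 1 rfl hf = 0) : f = 0 := by
  simp only [← P.extEquivCohomologyClass.apply_eq_iff_eq, ProjectiveResolution.extEquivCohomologyClass_extMk, ProjectiveResolution.extEquivCohomologyClass_zero,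
    CochainComplex.HomComplex.CohomologyClass.mk_eq_zero_iff] at h
  rw [CochainComplex.HomComplex.Cocycle.toSingleMk_mem_coboundaries_iff _ _ _ _ _ 1 (by simp)] at h
  obtain ⟨g, hg⟩ := h
  have h0 : Limits.IsZero (P.cochainComplex.X 1) :=
     CochainComplex.isZero_of_isStrictlyLE P.cochainComplex 0 1 (by simp)
  rw [h0.eq_of_src g 0, Limits.comp_zero] at hg
  rw [← cancel_epi (P.cochainComplexXIso (-(0:ℕ)) 0 rfl).hom]
  rw [← hg]; simp

lemma toCycles_cyclesToExt (i : ℕ) :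
    (P.complex.linearYonedaObj R Y).toCycles i n ≫ cyclesToExt P n = 0 := by
  by_cases hi : i + 1 = n
  · subst hi
    ext (g : P.complex.X i ⟶ Y)
    have h := congrArg (fun f => f.hom g)
            ((P.complex.linearYonedaObj R Y).toCycles_i i (i+1))
    exact (P.extMk_eq_zero_iff (Y := Y) _ (i+1+1) rfl (iCycles_cocycle P (i+1) _) i rfl).2 ⟨g, h.symm⟩
  · rw [toCycles_eq_zero, Limits.zero_comp]
    simpa using hi

noncomputable def homologyToExt :
    (P.complex.linearYonedaObj R Y).homology n ⟶ ModuleCat.of R (Abelian.Ext X Y n) :=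
  ((P.complex.linearYonedaObj R Y).homologyIsCokernel _ n rfl).desc
    (Limits.CokernelCofork.ofπ (cyclesToExt P n) (toCycles_cyclesToExt P n _))

lemma π_homologyToExt :
    (P.complex.linearYonedaObj R Y).homologyπ n ≫ homologyToExt P n = cyclesToExt P n :=
  ((P.complex.linearYonedaObj R Y).homologyIsCokernel _ n rfl).fac _
    Limits.WalkingParallelPair.one

lemma exists_cycle {K : CochainComplex (ModuleCat.{u} R) ℕ} (z : K.X n) (hz : K.d n (n+1) z = 0) :
    ∃ c : K.cycles n, K.iCycles n c = z := by
  refine ⟨(K.liftCycles (ModuleCat.ofHom (LinearMap.toSpanSingleton R (K.X n) z)) (n+1)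
    (by simp) ?_) (1 : R), ?_⟩
  · ext
    simpa using hz
  · have := congrArg (fun f => f.hom (1:R)) (K.liftCycles_i (ModuleCat.ofHom (LinearMap.toSpanSingleton R (K.X n) z)) (n+1)
      (by simp) (by ext; simpa using hz))
    refine this.trans ?_
    simp

lemma homologyToExt_surjective : Function.Surjective (homologyToExt (Y := Y) P n).hom := by
  intro ξ
  obtain ⟨f, hf, rfl⟩ := P.extMk_surjective ξ (n+1) rfl
  obtain ⟨c, hc⟩ := exists_cycle n (K := P.complex.linearYonedaObj R Y) f hf
  refine ⟨(P.complex.linearYonedaObj R Y).homologyπ n c, ?_⟩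
  refine (congrArg (fun f => f.hom c) (π_homologyToExt P n)).trans ?_
  subst hc
  rfl

lemma homologyToExt_injective : Function.Injective (homologyToExt (Y := Y) P n).hom := by
  rw [injective_iff_map_eq_zero]
  intro a ha
  obtain ⟨c, rfl⟩ := (ModuleCat.epi_iff_surjective _).1
    (inferInstance : Epi ((P.complex.linearYonedaObj R Y).homologyπ n)) a
  have h1 : (cyclesToExt P n).hom c = 0 :=
    ((congrArg (fun f => f.hom c) (π_homologyToExt P n)).symm).trans ha
  set f : P.complex.X n ⟶ Y := (P.complex.linearYonedaObj R Y).iCycles n c with hf0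
  have hf : P.complex.d (n+1) n ≫ f = 0 :=
    congrArg (fun f => f.hom c) ((P.complex.linearYonedaObj R Y).iCycles_d n (n+1))
  have h2 : P.extMk f (n+1) rfl hf = 0 := h1
  have hinj : Function.Injective ((P.complex.linearYonedaObj R Y).iCycles n).hom :=
    (ModuleCat.mono_iff_injective _).1 inferInstance
  rcases n with - | i
  · have := extMk_zero_deg P f hf h2
    have : c = 0 := hinj (by rw [map_zero]; exact this)
    rw [this]; exact map_zero _
  · rw [P.extMk_eq_zero_iff _ _ _ _ i rfl] at h2
    obtain ⟨g, hg⟩ := h2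
    have h := congrArg (fun f => f.hom g)
            ((P.complex.linearYonedaObj R Y).toCycles_i i (i+1))
    have : (P.complex.linearYonedaObj R Y).toCycles i (i+1) g = c := by
      apply hinj
      exact h.trans hg
    rw [← this]
    exact congrArg (fun f => f.hom g) ((P.complex.linearYonedaObj R Y).toCycles_comp_homologyπ i (i+1))

/-- The comparison of cohomology with `Ext` is natural in the resolved object. -/
lemma homologyToExt_naturality {X' : ModuleCat.{u} R} (P' : ProjectiveResolution X') (g : X' ⟶ X)
    (φ : ProjectiveResolution.Hom P' P g) (y) :
    homologyToExt (Y := Y) P' n (HomologicalComplex.homologyMap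
      ((HomologicalComplex.unopFunctor _ _).map ((((linearYoneda R (ModuleCat R)).obj Y).rightOp.mapHomologicalComplex _).map φ.hom).op) n y)
      = (Abelian.Ext.mk₀ g).comp (homologyToExt (Y := Y) P n y) (zero_add _) := by
  obtain ⟨c, rfl⟩ := (ModuleCat.epi_iff_surjective _).1
    (inferInstance : Epi ((P.complex.linearYonedaObj R Y).homologyπ n)) y
  set ψ : P.complex.linearYonedaObj R Y ⟶ P'.complex.linearYonedaObj R Y := (HomologicalComplex.unopFunctor _ _).map ((((linearYoneda R (ModuleCat R)).obj Y).rightOp.mapHomologicalComplex _).map φ.hom).op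
  have h1 := congrArg (fun f => f.hom c) (homologyπ_naturality ψ n)
  change (homologyToExt P' n).hom ((homologyMap ψ n).hom (homologyπ (P.complex.linearYonedaObj R Y) n c)) = _
  refine (congrArg (homologyToExt P' n).hom h1).trans ?_
  refine (congrArg (fun f => f.hom (cyclesMap ψ n c)) (π_homologyToExt P' n)).trans ?_
  have h2 := (congrArg (fun f => f.hom c) (π_homologyToExt (Y := Y) P n))
  refine Eq.trans ?_ (congrArg (fun t => (Abelian.Ext.mk₀ g).comp t (zero_add _)) h2.symm)
  have h3 := congrArg (fun f => f.hom c) (cyclesMap_i ψ n)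
  refine Eq.trans ?_ (ProjectiveResolution.mk₀_comp_extMk _ (n+1) rfl (iCycles_cocycle P n c) φ).symm
  have : ∀ (a b : P'.complex.X n ⟶ Y) (ha hb) (h : a = b), P'.extMk a (n+1) rfl ha = P'.extMk b (n+1) rfl hb := by
     rintro a b ha hb rfl; rfl
  exact this _ _ (iCycles_cocycle P' n _) _ h3

noncomputable def oldExtIso :
    ((Ext R (ModuleCat.{u} R) n).obj (Opposite.op X)).obj Y ≅ ModuleCat.of R (Abelian.Ext X Y n) :=
  (projectiveResolution X).isoExt n Y ≪≫
    (LinearEquiv.ofBijective (homologyToExt (Y := Y) (projectiveResolution X) n).hom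
      ⟨homologyToExt_injective _ n, homologyToExt_surjective _ n⟩).toModuleIso

lemma iso_inv_square {C : Type*} [Category* C] {a b a' b' : C} (e : a ≅ b) (e' : a' ≅ b')
    (f : a ⟶ a') (g : b ⟶ b') (h : f ≫ e'.hom = e.hom ≫ g) : e.inv ≫ f = g ≫ e'.inv := by
  rw [Iso.inv_comp_eq, ← Category.assoc, ← h, Category.assoc, Iso.hom_inv_id, Category.comp_id]

lemma paste_squares {C : Type*} [Category* C] {a b c a' b' c' : C} (p : a ⟶ b) (q : b ⟶ c)
    (t : c ⟶ c') (m : b ⟶ b') (q' : b' ⟶ c') (l : a ⟶ a') (p' : a' ⟶ b')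
    (h1 : l ≫ p' = p ≫ m) (h2 : m ≫ q' = q ≫ t) : (p ≫ q) ≫ t = l ≫ p' ≫ q' := by
  rw [Category.assoc, ← h2, ← Category.assoc, ← h1, Category.assoc]

lemma isoExt_naturality {X' : ModuleCat.{u} R} {P' : ProjectiveResolution X'} (g : X' ⟶ X)
    (φ : ProjectiveResolution.Hom P' P g)  :
    (P.isoExt n Y).hom ≫ HomologicalComplex.homologyMap
      ((HomologicalComplex.unopFunctor _ _).map ((((linearYoneda R (ModuleCat R)).obj Y).rightOp.mapHomologicalComplex _).map φ.hom).op) n =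
     ((Ext R (ModuleCat.{u} R) n).map g.op).app Y ≫ (P'.isoExt n Y).hom := by
  set ψ : P.complex.linearYonedaObj R Y ⟶ P'.complex.linearYonedaObj R Y := (HomologicalComplex.unopFunctor _ _).map ((((linearYoneda R (ModuleCat R)).obj Y).rightOp.mapHomologicalComplex _).map φ.hom).op with hψ
  have h1 := ProjectiveResolution.isoLeftDerivedObj_inv_naturality g P' P φ.hom φ.hom_f_zero_comp_π_f_zero
    ((linearYoneda R (ModuleCat R)).obj Y).rightOp n
  have h2 := homologyOp_hom_naturality ψ n
  have h2' := iso_inv_square ((P'.complex.linearYonedaObj R Y).homologyOp n)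
    ((P.complex.linearYonedaObj R Y).homologyOp n) _ _ h2
  exact paste_squares _ _ _ _ _ _ _ (congrArg Quiver.Hom.unop h1) (congrArg Quiver.Hom.unop h2')

lemma oldExtIso_naturality {X' : ModuleCat.{u} R} (g : X' ⟶ X) (x) :
    (oldExtIso (Y := Y) n).hom.hom (((Ext R (ModuleCat.{u} R) n).map g.op).app Y x) =
      (Abelian.Ext.mk₀ g).comp ((oldExtIso (X := X) (Y := Y) n).hom.hom x) (zero_add _) := by
  let φ : ProjectiveResolution.Hom (projectiveResolution X') (projectiveResolution X) g :=
    { hom := ProjectiveResolution.lift g _ _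
      hom_f_zero_comp_π_f_zero :=
        congrArg (fun f => f.f 0) (ProjectiveResolution.lift_commutes g (projectiveResolution X') (projectiveResolution X)) }
  refine Eq.trans ?_ (homologyToExt_naturality (Y := Y) (projectiveResolution X) n (projectiveResolution X') g φ
     (((projectiveResolution X).isoExt n Y).hom x))
  have := congrArg (fun f => f.hom x) (isoExt_naturality (Y := Y) (projectiveResolution X) n g φ)
  exact congrArg (homologyToExt (Y := Y) (projectiveResolution X') n).hom this.symm

end OldExt

section Model
variable {R : Type u} [CommRing R]

noncomputable def extPre {X X' : ModuleCat.{u} R} (f : X' ⟶ X) (Y : ModuleCat.{u} R) (n : ℕ) :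
    Abelian.Ext X Y n →ₗ[R] Abelian.Ext X' Y n where
  toFun ξ := (Abelian.Ext.mk₀ f).comp ξ (zero_add n)
  map_add' a b := by rw [Abelian.Ext.comp_add]
  map_smul' r a := by rw [Abelian.Ext.comp_smul, RingHom.id_apply]

noncomputable def extPost (X : ModuleCat.{u} R) {Y Y' : ModuleCat.{u} R} {m n p : ℕ}
    (g : Abelian.Ext Y Y' m) (h : n + m = p) :
    Abelian.Ext X Y n →ₗ[R] Abelian.Ext X Y' p where
  toFun ξ := ξ.comp g h
  map_add' a b := by rw [Abelian.Ext.add_comp]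
  map_smul' r a := by rw [Abelian.Ext.smul_comp, RingHom.id_apply]

variable (I : Ideal R)

def powMap {k l : ℕ} (h : k ≤ l) : ModuleCat.of R (R ⧸ I ^ l) ⟶ ModuleCat.of R (R ⧸ I ^ k) :=
  ModuleCat.ofHom (Submodule.mapQ _ _ LinearMap.id (Ideal.pow_le_pow_right h))

lemma powMap_refl (k : ℕ) : powMap I (le_refl k) = 𝟙 _ := by
  ext
  rfl

lemma powMap_comp {k l m : ℕ} (h : k ≤ l) (h' : l ≤ m) :
    powMap I h' ≫ powMap I h = powMap I (h.trans h') := by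
  ext
  rfl

noncomputable def extTr (n : ℕ) (N : Type u) [AddCommGroup N] [Module R N] (k l : ℕ) (h : k ≤ l) :
    Abelian.Ext (ModuleCat.of R (R ⧸ I ^ k)) (ModuleCat.of R N) n →ₗ[R]
      Abelian.Ext (ModuleCat.of R (R ⧸ I ^ l)) (ModuleCat.of R N) n :=
  extPre (powMap I h) _ _

instance (n : ℕ) (N : Type u) [AddCommGroup N] [Module R N] :
    DirectedSystem (fun k : ℕ => Abelian.Ext (ModuleCat.of R (R ⧸ I ^ k)) (ModuleCat.of R N) n)
      (extTr I n N · · ·) where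
  map_self k x := by
    change (Abelian.Ext.mk₀ _).comp x (zero_add n) = x
    rw [powMap_refl, Abelian.Ext.mk₀_id_comp]
  map_map i j k hij hjk x := by
    change (Abelian.Ext.mk₀ _).comp ((Abelian.Ext.mk₀ _).comp x (zero_add n)) (zero_add n) =
      (Abelian.Ext.mk₀ _).comp x (zero_add n)
    rw [Abelian.Ext.mk₀_comp_mk₀_assoc, powMap_comp]

/-- Local cohomology as a direct limit of `Ext` modules. -/
def H (n : ℕ) (N : Type u) [AddCommGroup N] [Module R N] : Type u :=
  Module.DirectLimit (fun k : ℕ => Abelian.Ext (ModuleCat.of R (R ⧸ I ^ k)) (ModuleCat.of R N) n)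
      (extTr I n N)

variable (n : ℕ) (N : Type u) [AddCommGroup N] [Module R N]

noncomputable instance : AddCommGroup (H I n N) :=
  inferInstanceAs (AddCommGroup (Module.DirectLimit (fun k : ℕ => Abelian.Ext (ModuleCat.of R (R ⧸ I ^ k)) (ModuleCat.of R N) n)
      (extTr I n N)))

noncomputable instance : Module R (H I n N) :=
  inferInstanceAs (Module R (Module.DirectLimit (fun k : ℕ => Abelian.Ext (ModuleCat.of R (R ⧸ I ^ k)) (ModuleCat.of R N) n)
      (extTr I n N)))

noncomputable def H.of (k : ℕ) :
    Abelian.Ext (ModuleCat.of R (R ⧸ I ^ k)) (ModuleCat.of R N) n →ₗ[R] H I n N :=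
  Module.DirectLimit.of R ℕ _ (extTr I n N) k

variable {n N}

lemma H.of_tr {k l : ℕ} (h : k ≤ l) (x) : H.of I n N l (extTr I n N k l h x) = H.of I n N k x :=
  Module.DirectLimit.of_f

lemma H.exists_of (x : H I n N) : ∃ k y, H.of I n N k y = x :=
  Module.DirectLimit.exists_of x

lemma H.of_eq_zero {k : ℕ} {x} (h : H.of I n N k x = 0) : ∃ l, ∃ h : k ≤ l, extTr I n N k l h x = 0 :=
  Module.DirectLimit.of.zero_exact h

lemma H.hom_ext {P : Type*} [AddCommGroup P] [Module R P] {f g : H I n N →ₗ[R] P}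
    (h : ∀ k x, f (H.of I n N k x) = g (H.of I n N k x)) : f = g := by
  ext x
  obtain ⟨k, y, rfl⟩ := H.exists_of I x
  exact h k y

noncomputable def H.desc {P : Type*} [AddCommGroup P] [Module R P]
   (f : ∀ k, Abelian.Ext (ModuleCat.of R (R ⧸ I ^ k)) (ModuleCat.of R N) n →ₗ[R] P)
   (hf : ∀ k l h x, f l (extTr I n N k l h x) = f k x) : H I n N →ₗ[R] P :=
  Module.DirectLimit.lift R ℕ _ _ f hf

@[simp] lemma H.desc_of {P : Type*} [AddCommGroup P] [Module R P]
   (f : ∀ k, Abelian.Ext (ModuleCat.of R (R ⧸ I ^ k)) (ModuleCat.of R N) n →ₗ[R] P)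
   (hf : ∀ k l h x, f l (extTr I n N k l h x) = f k x) (k x) :
    H.desc I f hf (H.of I n N k x) = f k x :=
  Module.DirectLimit.lift_of f hf x

variable {N' : Type u} [AddCommGroup N'] [Module R N'] {N'' : Type u} [AddCommGroup N''] [Module R N'']

/-- Map induced by postcomposition with an `Ext` class. -/
noncomputable def H.post {m p : ℕ} (g : Abelian.Ext (ModuleCat.of R N) (ModuleCat.of R N') m)
   (h : n + m = p) : H I n N →ₗ[R] H I p N' :=
  H.desc I (fun k => (H.of I p N' k).comp (extPost _ g h)) (by
    intro k l h' x
    rw [LinearMap.comp_apply, LinearMap.comp_apply, ← H.of_tr I h']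
    congr 1
    change ((Abelian.Ext.mk₀ _).comp x (zero_add n)).comp g h =
      (Abelian.Ext.mk₀ _).comp (x.comp g h) (zero_add p)
    exact Abelian.Ext.comp_assoc _ _ _ _ _ (by lia))

lemma H.post_of {m p : ℕ} (g : Abelian.Ext (ModuleCat.of R N) (ModuleCat.of R N') m)
   (h : n + m = p) (k x) : H.post I g h (H.of I n N k x) = H.of I p N' k (x.comp g h) :=
  H.desc_of I _ _ _ _

variable (n) in
noncomputable def H.map (f : N →ₗ[R] N') : H I n N →ₗ[R] H I n N' :=
  H.post I (Abelian.Ext.mk₀ (ModuleCat.ofHom f)) (add_zero n)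

lemma H.map_of (f : N →ₗ[R] N') (k x) : H.map I n f (H.of I n N k x) =
    H.of I n N' k (x.comp (Abelian.Ext.mk₀ (ModuleCat.ofHom f)) (add_zero n)) :=
  H.post_of I _ _ _ _

lemma H.map_id : H.map I n (LinearMap.id : N →ₗ[R] N) = LinearMap.id := by
  apply H.hom_ext; intro k x
  rw [H.map_of]
  change H.of I n N k (x.comp (Abelian.Ext.mk₀ (𝟙 (ModuleCat.of R N))) (add_zero n)) = _
  rw [Abelian.Ext.comp_mk₀_id]; rfl

lemma H.map_comp (g : N' →ₗ[R] N'') (f : N →ₗ[R] N') :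
    H.map I n (g ∘ₗ f) = H.map I n g ∘ₗ H.map I n f := by
  apply H.hom_ext; intro k x
  rw [LinearMap.comp_apply, H.map_of, H.map_of, H.map_of, ModuleCat.ofHom_comp,
   ← Abelian.Ext.mk₀_comp_mk₀, Abelian.Ext.comp_assoc]
  all_goals simp

lemma H.map_add (f g : N →ₗ[R] N') :
    H.map I n (f + g) = H.map I n f + H.map I n g := by
  apply H.hom_ext; intro k x
  rw [LinearMap.add_apply, H.map_of, H.map_of, H.map_of, ModuleCat.ofHom_add, Abelian.Ext.mk₀_add,
    Abelian.Ext.comp_add, _root_.map_add]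

lemma H.map_smul (r : R) (f : N →ₗ[R] N') :
    H.map I n (r • f) = r • H.map I n f := by
  apply H.hom_ext; intro k x
  have h : ModuleCat.ofHom (r • f) = r • ModuleCat.ofHom f := rfl
  rw [LinearMap.smul_apply, H.map_of, H.map_of, h, Abelian.Ext.mk₀_smul,
    Abelian.Ext.comp_smul, _root_.map_smul]

lemma H.map_zero : H.map I n (0 : N →ₗ[R] N') = 0 := by
  have := H.map_smul I (n := n) (0 : R) (0 : N →ₗ[R] N')
  rwa [zero_smul, zero_smul] at this

section les
variable {f : N →ₗ[R] N'} {g : N' →ₗ[R] N''} (hf : Function.Injective f) (hg : Function.Surjective g)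
  (hfg : Function.Exact f g)

/-- The short complex attached to a short exact sequence. -/
def sc (hfg : Function.Exact f g) : ShortComplex (ModuleCat.{u} R) where
  f := ModuleCat.ofHom f
  g := ModuleCat.ofHom g
  zero := by ext x; exact hfg.apply_apply_eq_zero x

lemma sc_shortExact (hf : Function.Injective f) (hg : Function.Surjective g)
    (hfg : Function.Exact f g) : (sc hfg).ShortExact where
  exact := (ShortComplex.ShortExact.moduleCat_exact_iff_function_exact _).2 hfg
  mono_f := (ModuleCat.mono_iff_injective _).2 hf
  epi_g := (ModuleCat.epi_iff_surjective _).2 hg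

/-- The class of a short exact sequence in `Ext¹`. -/
noncomputable def sesClass : Abelian.Ext (ModuleCat.of R N'') (ModuleCat.of R N) 1 :=
  (sc_shortExact hf hg hfg).extClass

lemma mk₀_comp_sesClass :
    (Abelian.Ext.mk₀ (ModuleCat.ofHom g)).comp (sesClass hf hg hfg) (zero_add 1) = 0 :=
  (sc_shortExact hf hg hfg).comp_extClass

lemma sesClass_comp_mk₀ :
    (sesClass hf hg hfg).comp (Abelian.Ext.mk₀ (ModuleCat.ofHom f)) (add_zero 1) = 0 :=
  (sc_shortExact hf hg hfg).extClass_comp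

lemma ext_exact₂ (hf : Function.Injective f) (hg : Function.Surjective g)
    (hfg : Function.Exact f g)
    (X : ModuleCat.{u} R) (y : Abelian.Ext X (ModuleCat.of R N') n)
    (h : y.comp (Abelian.Ext.mk₀ (ModuleCat.ofHom g)) (add_zero n) = 0) :
    ∃ z : Abelian.Ext X (ModuleCat.of R N) n,
      z.comp (Abelian.Ext.mk₀ (ModuleCat.ofHom f)) (add_zero n) = y :=
  Abelian.Ext.covariant_sequence_exact₂ _ (sc_shortExact hf hg hfg) y h

lemma ext_exact₃ (X : ModuleCat.{u} R) (y : Abelian.Ext X (ModuleCat.of R N'') n)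
    (h : y.comp (sesClass hf hg hfg) rfl = 0) :
    ∃ z : Abelian.Ext X (ModuleCat.of R N') n,
      z.comp (Abelian.Ext.mk₀ (ModuleCat.ofHom g)) (add_zero n) = y :=
  Abelian.Ext.covariant_sequence_exact₃ _ (sc_shortExact hf hg hfg) y rfl h

lemma ext_exact₁ (X : ModuleCat.{u} R) (y : Abelian.Ext X (ModuleCat.of R N) (n + 1))
    (h : y.comp (Abelian.Ext.mk₀ (ModuleCat.ofHom f)) (add_zero (n + 1)) = 0) :
    ∃ z : Abelian.Ext X (ModuleCat.of R N'') n,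
      z.comp (sesClass hf hg hfg) rfl = y :=
  Abelian.Ext.covariant_sequence_exact₁ _ (sc_shortExact hf hg hfg) y h rfl

variable (n) in
/-- The connecting homomorphism. -/
noncomputable def H.δ : H I n N'' →ₗ[R] H I (n+1) N :=
  H.post I (sesClass hf hg hfg) rfl

lemma extTr_comp {m p k l : ℕ} (hl : k ≤ l)
    (y : Abelian.Ext (ModuleCat.of R (R ⧸ I ^ k)) (ModuleCat.of R N) n)
    (z : Abelian.Ext (ModuleCat.of R N) (ModuleCat.of R N') m) (h : n + m = p) :
    (extTr I n N k l hl y).comp z h = extTr I p N' k l hl (y.comp z h) :=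
  Abelian.Ext.comp_assoc _ _ _ (zero_add n) h (by lia)

lemma H.exact_mid (hf : Function.Injective f) (hg : Function.Surjective g)
    (hfg : Function.Exact f g) :
    Function.Exact (H.map I n f) (H.map I n g) := by
  intro x
  constructor
  · intro hx
    obtain ⟨k, y, rfl⟩ := H.exists_of I x
    rw [H.map_of] at hx
    obtain ⟨l, hl, h⟩ := H.of_eq_zero I hx
    rw [← extTr_comp] at h
    obtain ⟨z, hz⟩ := ext_exact₂ hf hg hfg _ _ h
    exact ⟨H.of I n N l z, by rw [H.map_of, hz, H.of_tr]⟩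
  · rintro ⟨y, rfl⟩
    have h : g ∘ₗ f = 0 := by
      ext z; exact hfg.apply_apply_eq_zero z
    rw [← LinearMap.comp_apply, ← H.map_comp, h, H.map_zero, LinearMap.zero_apply]

lemma H.exact_right : Function.Exact (H.map I n g) (H.δ I n hf hg hfg) := by
  intro x
  constructor
  · intro hx
    obtain ⟨k, y, rfl⟩ := H.exists_of I x
    rw [H.δ, H.post_of] at hx
    obtain ⟨l, hl, h⟩ := H.of_eq_zero I hx
    rw [← extTr_comp] at h
    obtain ⟨z, hz⟩ := ext_exact₃ hf hg hfg _ _ h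
    exact ⟨H.of I n N' l z, by rw [H.map_of, hz, H.of_tr]⟩
  · rintro ⟨y, rfl⟩
    obtain ⟨k, y, rfl⟩ := H.exists_of I y
    rw [H.map_of, H.δ, H.post_of,
      Abelian.Ext.comp_assoc (a₂₃ := 1) _ _ _ (add_zero n) (zero_add 1) (by simp),
      mk₀_comp_sesClass, Abelian.Ext.comp_zero, _root_.map_zero]

lemma H.exact_left : Function.Exact (H.δ I n hf hg hfg) (H.map I (n+1) f) := by
  intro x
  constructor
  · intro hx
    obtain ⟨k, y, rfl⟩ := H.exists_of I x
    rw [H.map_of] at hx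
    obtain ⟨l, hl, h⟩ := H.of_eq_zero I hx
    rw [← extTr_comp] at h
    obtain ⟨z, hz⟩ := ext_exact₁ hf hg hfg _ _ h
    exact ⟨H.of I n N'' l z, by rw [H.δ, H.post_of, hz, H.of_tr]⟩
  · rintro ⟨y, rfl⟩
    obtain ⟨k, y, rfl⟩ := H.exists_of I y
    rw [H.δ, H.post_of, H.map_of,
      Abelian.Ext.comp_assoc (a₂₃ := 1) _ _ _ rfl (add_zero 1) (by simp),
      sesClass_comp_mk₀, Abelian.Ext.comp_zero, _root_.map_zero]

end les

lemma H.torsion (x : H I n N) : ∃ k : ℕ, ∀ r ∈ I ^ k, r • x = 0 := by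
  obtain ⟨k, y, rfl⟩ := H.exists_of I x
  refine ⟨k, fun r hr => ?_⟩
  rw [← _root_.map_smul]
  have : r • y = 0 := by
    have h : r • 𝟙 (ModuleCat.of R (R ⧸ I ^ k)) = 0 := by
      ext
      change r • (Ideal.Quotient.mk (I^k) 1) = 0
      rw [← Ideal.Quotient.mk_eq_mk, ← Submodule.Quotient.mk_smul, Submodule.Quotient.mk_eq_zero]
      simpa using hr
    rw [← Abelian.Ext.mk₀_id_comp (r • y), Abelian.Ext.comp_smul, ← Abelian.Ext.smul_comp, ← Abelian.Ext.mk₀_smul, h,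
      Abelian.Ext.mk₀_zero, Abelian.Ext.zero_comp]
  rw [this, _root_.map_zero]

end Model

section Comparison
open Limits Opposite
variable {R : Type u} [CommRing R] (I : Ideal R) (n : ℕ) (N : Type u) [AddCommGroup N] [Module R N]

/-- The direct system of `Ext` modules underlying `localCohomology`. -/
noncomputable abbrev lcDiagram : ℕᵒᵖᵒᵖ ⥤ ModuleCat.{u} R :=
  localCohomology.diagram (localCohomology.idealPowersDiagram I) n ⋙
    (evaluation _ _).obj (ModuleCat.of R N)

/-- The colimit cocone computing `localCohomology`. -/
noncomputable def lcCocone : Cocone (lcDiagram I n N) :=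
  ((evaluation _ _).obj (ModuleCat.of R N)).mapCocone
    (colimit.cocone (localCohomology.diagram (localCohomology.idealPowersDiagram I) n))

noncomputable def lcIsColimit : IsColimit (lcCocone I n N) :=
  isColimitOfPreserves ((evaluation _ _).obj (ModuleCat.of R N))
    (colimit.isColimit (localCohomology.diagram (localCohomology.idealPowersDiagram I) n))

noncomputable def lcIso (k : ℕ) : (lcDiagram I n N).obj (op (op k)) ≅
    ModuleCat.of R (Abelian.Ext (ModuleCat.of R (R ⧸ I ^ k)) (ModuleCat.of R N) n) :=
  oldExtIso (X := ModuleCat.of R (R ⧸ I ^ k)) (Y := ModuleCat.of R N) n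

lemma lcIso_naturality {k l : ℕ} (h : k ≤ l) :
    (lcDiagram I n N).map (homOfLE h).op.op ≫ (lcIso I n N l).hom =
      (lcIso I n N k).hom ≫ ModuleCat.ofHom (extTr I n N k l h) := by
  ext x
  exact oldExtIso_naturality (X := ModuleCat.of R (R ⧸ I ^ k)) (Y := ModuleCat.of R N) n
    (powMap I h) x

/-- The model `H` as a cocone. -/
noncomputable def modelCocone : Cocone (lcDiagram I n N) where
  pt := ModuleCat.of R (H I n N)
  ι :=
    { app := fun j => (lcIso I n N j.unop.unop).hom ≫ ModuleCat.ofHom (H.of I n N j.unop.unop)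
      naturality := by
        intro j j' f
        have h : j.unop.unop ≤ j'.unop.unop := leOfHom f.unop.unop
        have := lcIso_naturality I n N h
        have hf : (homOfLE h).op.op = f := rfl
        rw [hf] at this
        erw [reassoc_of% this, Category.comp_id]
        congr 1
        ext x
        exact H.of_tr I h x }

noncomputable def toModel : (lcCocone I n N).pt ⟶ ModuleCat.of R (H I n N) :=
  (lcIsColimit I n N).desc (modelCocone I n N)

lemma ι_toModel (k : ℕ) : (lcCocone I n N).ι.app (op (op k)) ≫ toModel I n N =
    (lcIso I n N k).hom ≫ ModuleCat.ofHom (H.of I n N k) :=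
  (lcIsColimit I n N).fac (modelCocone I n N) (op (op k))

noncomputable def fromModel : H I n N →ₗ[R] (lcCocone I n N).pt :=
  H.desc I (fun k => ((lcIso I n N k).inv ≫ (lcCocone I n N).ι.app (op (op k))).hom) (by
    intro k l h x
    have h1 := iso_inv_square _ _ _ _ (lcIso_naturality I n N h)
    have h2 := (lcCocone I n N).w (homOfLE h).op.op
    have : ModuleCat.ofHom (extTr I n N k l h) ≫ (lcIso I n N l).inv ≫
        (lcCocone I n N).ι.app (op (op l)) =
        (lcIso I n N k).inv ≫ (lcCocone I n N).ι.app (op (op k)) := by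
      rw [← Category.assoc, ← h1, Category.assoc, h2]
    exact congrArg (fun f => f.hom x) this)

lemma of_fromModel (k : ℕ) : ModuleCat.ofHom (H.of I n N k) ≫ ModuleCat.ofHom (fromModel I n N) =
    (lcIso I n N k).inv ≫ (lcCocone I n N).ι.app (op (op k)) := by
  ext x
  change (fromModel I n N) (H.of I n N k x) = _
  rw [fromModel, H.desc_of]

lemma toModel_fromModel : toModel I n N ≫ ModuleCat.ofHom (fromModel I n N) = 𝟙 _ := by
  refine (lcIsColimit I n N).hom_ext fun j => ?_
  change (lcCocone I n N).ι.app (op (op j.unop.unop)) ≫ _ = _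
  rw [← Category.assoc, ι_toModel, Category.assoc, of_fromModel, Iso.hom_inv_id_assoc]
  exact (Category.comp_id _).symm

lemma fromModel_toModel (x : H I n N) : (toModel I n N).hom (fromModel I n N x) = x := by
  obtain ⟨k, y, rfl⟩ := H.exists_of I x
  have : ModuleCat.ofHom (H.of I n N k) ≫ ModuleCat.ofHom (fromModel I n N) ≫ toModel I n N =
      ModuleCat.ofHom (H.of I n N k) := by
    rw [← Category.assoc, of_fromModel, Category.assoc, ι_toModel, Iso.inv_hom_id_assoc]
  exact congrArg (fun f => f.hom y) this

/-- Mathlib's local cohomology agrees with the direct limit model. -/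
noncomputable def localCohomologyEquiv :
    (localCohomology I n).obj (ModuleCat.of R N) ≃ₗ[R] H I n N :=
  LinearEquiv.ofLinearMap (M := (lcCocone I n N).pt) (toModel I n N).hom (fromModel I n N)
    (by ext x; exact fromModel_toModel I n N x)
    (by ext x; exact congrArg (fun f => f.hom x) (toModel_fromModel I n N))

end Comparison

section Zero
variable {R : Type u} [CommRing R] (I : Ideal R) {N : Type u} [AddCommGroup N] [Module R N]
 {N' : Type u} [AddCommGroup N'] [Module R N']

/-- Evaluation at `1` of a degree zero `Ext` class. -/
noncomputable def extEval (k : ℕ) :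
    Abelian.Ext (ModuleCat.of R (R ⧸ I ^ k)) (ModuleCat.of R N) 0 →ₗ[R] N where
  toFun x := (Abelian.Ext.linearEquiv₀ (R := R) x).hom (Ideal.Quotient.mk _ 1)
  map_add' x y := by rw [_root_.map_add]; rfl
  map_smul' r x := by rw [_root_.map_smul]; rfl

lemma extEval_mk₀ (k : ℕ) (f : ModuleCat.of R (R ⧸ I ^ k) ⟶ ModuleCat.of R N) :
    extEval I k (Abelian.Ext.mk₀ f) = f.hom (Ideal.Quotient.mk _ 1) := by
  have : Abelian.Ext.linearEquiv₀ (R := R) (Abelian.Ext.mk₀ f) = f :=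
    Abelian.Ext.homEquiv₀.right_inv f
  change (Abelian.Ext.linearEquiv₀ (R := R) (Abelian.Ext.mk₀ f)).hom _ = _
  rw [this]

lemma exists_mk₀ {X Y : ModuleCat.{u} R} (x : Abelian.Ext X Y 0) :
    ∃ f : X ⟶ Y, Abelian.Ext.mk₀ f = x := ⟨_, Abelian.Ext.mk₀_homEquiv₀_apply x⟩

lemma extEval_injective (k : ℕ) : Function.Injective (extEval I k (N := N)) := by
  rw [injective_iff_map_eq_zero]
  intro x hx
  obtain ⟨f, rfl⟩ := exists_mk₀ x
  rw [extEval_mk₀] at hx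
  have : f = 0 := by
    ext
    exact hx
  rw [this, Abelian.Ext.mk₀_zero]

lemma extEval_tr (k l : ℕ) (h : k ≤ l) (x) :
    extEval I l (extTr I 0 N k l h x) = extEval I k x := by
  obtain ⟨f, rfl⟩ := exists_mk₀ x
  change extEval I l ((Abelian.Ext.mk₀ _).comp (Abelian.Ext.mk₀ f) (zero_add 0)) = _
  rw [Abelian.Ext.mk₀_comp_mk₀, extEval_mk₀, extEval_mk₀]
  rfl

variable (N) in
/-- The identification of the zeroth local cohomology with a submodule of `N`. -/
noncomputable def H.ev : H I 0 N →ₗ[R] N :=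
  H.desc I (extEval I) (extEval_tr I)

lemma H.ev_of (k) (x) : H.ev I N (H.of I 0 N k x) = extEval I k x := H.desc_of I _ _ k x

lemma H.ev_injective : Function.Injective (H.ev I N) := by
  rw [injective_iff_map_eq_zero]
  intro x hx
  obtain ⟨k, y, rfl⟩ := H.exists_of I x
  rw [H.ev_of] at hx
  rw [(injective_iff_map_eq_zero _).1 (extEval_injective I k) y hx, _root_.map_zero]

lemma H.ev_map (f : N →ₗ[R] N') (x) : H.ev I N' (H.map I 0 f x) = f (H.ev I N x) := by
  obtain ⟨k, y, rfl⟩ := H.exists_of I x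
  rw [H.map_of, H.ev_of, H.ev_of]
  obtain ⟨g, rfl⟩ := exists_mk₀ y
  rw [Abelian.Ext.mk₀_comp_mk₀, extEval_mk₀, extEval_mk₀]
  rfl

lemma H.mem_range_ev (x : N) (k : ℕ) (h : ∀ r ∈ I ^ k, r • x = 0) : ∃ y, H.ev I N y = x := by
  let f : R ⧸ I ^ k →ₗ[R] N := Submodule.liftQ (I ^ k) (LinearMap.toSpanSingleton R N x) (by
    intro r hr
    simpa using h r hr)
  refine ⟨H.of I 0 N k (Abelian.Ext.mk₀ (ModuleCat.ofHom f)), ?_⟩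
  rw [H.ev_of, extEval_mk₀]
  change (1 : R) • x = x
  rw [one_smul]

lemma H.ev_torsion (y : H I 0 N) : ∃ k : ℕ, ∀ r ∈ I ^ k, r • H.ev I N y = 0 := by
  obtain ⟨k, h⟩ := H.torsion I y
  exact ⟨k, fun r hr => by rw [← _root_.map_smul, h r hr, _root_.map_zero]⟩

end Zero

section Vanish
variable {R : Type u} [CommRing R] (I : Ideal R)

/-- Every element is killed by a power of `I`. -/
def IsPowTorsion (N : Type*) [AddCommGroup N] [Module R N] : Prop :=
  ∀ x : N, ∃ k : ℕ, ∀ r ∈ I ^ k, r • x = 0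

lemma H.subsingleton_of_injective (n : ℕ) (J : Type u) [AddCommGroup J] [Module R J]
    [Injective (ModuleCat.of R J)] : Subsingleton (H I (n + 1) J) := by
  refine ⟨fun a b => ?_⟩
  obtain ⟨k, y, rfl⟩ := H.exists_of I a
  obtain ⟨k', y', rfl⟩ := H.exists_of I b
  rw [Abelian.Ext.eq_zero_of_injective y, Abelian.Ext.eq_zero_of_injective y', _root_.map_zero,
    _root_.map_zero]

/-- The submodule of `I`-power torsion elements. -/
def powTors (N : Type*) [AddCommGroup N] [Module R N] : Submodule R N where
  carrier := {x | ∃ k : ℕ, ∀ r ∈ I ^ k, r • x = 0}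
  add_mem' := by
    rintro a b ⟨k, hk⟩ ⟨l, hl⟩
    refine ⟨k + l, fun r hr => ?_⟩
    rw [smul_add, hk r (Ideal.pow_le_pow_right (by lia) hr),
      hl r (Ideal.pow_le_pow_right (by lia) hr), add_zero]
  zero_mem' := ⟨0, fun r _ => smul_zero r⟩
  smul_mem' := by
    rintro c x ⟨k, hk⟩
    exact ⟨k, fun r hr => by rw [smul_comm, hk r hr, smul_zero]⟩

lemma mem_powTors {N : Type*} [AddCommGroup N] [Module R N] {x : N} :
    x ∈ powTors I N ↔ ∃ k : ℕ, ∀ r ∈ I ^ k, r • x = 0 := Iff.rfl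

lemma isPowTorsion_powTors (N : Type*) [AddCommGroup N] [Module R N] :
    IsPowTorsion I (powTors I N) := by
  rintro ⟨x, k, hk⟩
  exact ⟨k, fun r hr => Subtype.ext (hk r hr)⟩

lemma IsPowTorsion.of_surjective {N N' : Type*} [AddCommGroup N] [Module R N] [AddCommGroup N']
    [Module R N'] (h : IsPowTorsion I N) (f : N →ₗ[R] N') (hf : Function.Surjective f) :
    IsPowTorsion I N' := by
  intro x
  obtain ⟨y, rfl⟩ := hf x
  obtain ⟨k, hk⟩ := h y
  exact ⟨k, fun r hr => by rw [← _root_.map_smul, hk r hr, _root_.map_zero]⟩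

lemma IsPowTorsion.of_injective {N N' : Type*} [AddCommGroup N] [Module R N] [AddCommGroup N']
    [Module R N'] (h : IsPowTorsion I N') (f : N →ₗ[R] N') (hf : Function.Injective f) :
    IsPowTorsion I N := by
  intro x
  obtain ⟨k, hk⟩ := h (f x)
  exact ⟨k, fun r hr => hf (by rw [_root_.map_smul, hk r hr, _root_.map_zero])⟩

/-- A finitely generated power torsion module is killed by a power of the ideal. -/
lemma IsPowTorsion.exists_pow_smul {N : Type*} [AddCommGroup N] [Module R N] [Module.Finite R N]
    (h : IsPowTorsion I N) : ∃ k : ℕ, ∀ r ∈ I ^ k, ∀ x : N, r • x = 0 := by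
  obtain ⟨S, hS⟩ := (Module.finite_def.1 ‹Module.Finite R N›)
  choose k hk using h
  refine ⟨S.sup k, fun r hr x => ?_⟩
  have hx : x ∈ Submodule.span R (S : Set N) := hS ▸ Submodule.mem_top
  induction hx using Submodule.span_induction with
  | mem x hx => exact hk x r (Ideal.pow_le_pow_right (Finset.le_sup hx) hr)
  | zero => simp
  | add x y _ _ hx hy => rw [smul_add, hx, hy, add_zero]
  | smul a x _ hx => rw [smul_comm, hx, smul_zero]

lemma injective_powTors [IsNoetherianRing R] (J : Type u) [AddCommGroup J] [Module R J]
    (hJ : Module.Baer R J) : Module.Baer R (powTors I J) := by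
  intro A g
  -- the image is killed by a power of `I`
  have htor : IsPowTorsion I (LinearMap.range g) :=
    (isPowTorsion_powTors I J).of_injective I (LinearMap.range g).subtype
      (Submodule.injective_subtype _)
  obtain ⟨k, hk⟩ := htor.exists_pow_smul
  have hgk : ∀ a : A, (a : R) ∈ I ^ k • (A : Submodule R R) → g a = 0 := by
    intro a ha
    have key : ∀ r ∈ I ^ k • (A : Submodule R R), ∃ h : r ∈ A, g ⟨r, h⟩ = 0 := by
      intro r hr
      induction hr using Submodule.smul_induction_on' with
      | smul r hr b hb =>
        refine ⟨A.mul_mem_left _ hb, ?_⟩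
        have h1 := hk r hr ⟨g ⟨b, hb⟩, ⟨_, rfl⟩⟩
        have h2 : g (r • ⟨b, hb⟩) = 0 := by
          rw [_root_.map_smul]
          exact congrArg Subtype.val h1
        exact h2
      | add x hx y hy h1 h2 =>
        obtain ⟨h1, e1⟩ := h1
        obtain ⟨h2, e2⟩ := h2
        refine ⟨A.add_mem h1 h2, ?_⟩
        have : g (⟨x, h1⟩ + ⟨y, h2⟩) = 0 := by rw [_root_.map_add, e1, e2, add_zero]
        exact this
    obtain ⟨_, h⟩ := key _ ha
    exact h
  obtain ⟨c, hc⟩ := Ideal.exists_pow_inf_eq_pow_smul I (A : Submodule R R)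
  -- extend to a map on `A + I^(k+c)` that vanishes on `I^(k+c)`
  let q : R →ₗ[R] R ⧸ I ^ (k + c) := Submodule.mkQ _
  let B : Submodule R (R ⧸ I ^ (k + c)) := Submodule.map q A
  let q' : A →ₗ[R] B := q.restrict (fun x hx => Submodule.mem_map_of_mem hx)
  have hq' : Function.Surjective q' := by
    rintro ⟨_, x, hx, rfl⟩
    exact ⟨⟨x, hx⟩, rfl⟩
  have hker : LinearMap.ker q' ≤ LinearMap.ker g := by
    intro a ha
    have h1 : (a : R) ∈ I ^ (k + c) := by
      have := congrArg Subtype.val (LinearMap.mem_ker.1 ha)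
      exact (Submodule.Quotient.mk_eq_zero _).1 this
    apply hgk
    have h2 := hc (k + c) (by lia)
    rw [Nat.add_sub_cancel] at h2
    have h3 : (a : R) ∈ (I ^ (k + c) • ⊤ ⊓ A : Submodule R R) := by
      refine ⟨?_, a.2⟩
      simpa using h1
    rw [h2] at h3
    exact Submodule.smul_mono le_rfl inf_le_right h3
  obtain ⟨g', hg'⟩ : ∃ g' : B →ₗ[R] J, ∀ a, g' (q' a) = g a := by
    let e := q'.quotKerEquivOfSurjective hq'
    refine ⟨(powTors I J).subtype ∘ₗ (LinearMap.ker q').liftQ g hker ∘ₗ e.symm.toLinearMap,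
      fun a => ?_⟩
    have : e.symm (q' a) = Submodule.Quotient.mk a := by
      rw [LinearEquiv.symm_apply_eq]; rfl
    simp [this]
  obtain ⟨f, hf⟩ := hJ.extension_property B.subtype (Submodule.injective_subtype _) g'
  have hf' : ∀ r : R, f (q r) ∈ powTors I J := by
    intro r
    refine ⟨k + c, fun t ht => ?_⟩
    rw [← _root_.map_smul, ← _root_.map_smul]
    have : q (t • r) = 0 := (Submodule.Quotient.mk_eq_zero _).2 (Ideal.mul_mem_right _ _ ht)
    rw [this, _root_.map_zero]
  refine ⟨(f ∘ₗ q).codRestrict _ hf', fun x hx => ?_⟩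
  apply Subtype.ext
  change f (q x) = _
  rw [← hg' ⟨x, hx⟩, ← hf]
  rfl

/-- A power torsion module embeds in an injective power torsion module. -/
lemma exists_injective_isPowTorsion [IsNoetherianRing R] (N : Type u) [AddCommGroup N] [Module R N]
    (h : IsPowTorsion I N) : ∃ (E : Type u) (_ : AddCommGroup E) (_ : Module R E),
      Injective (ModuleCat.of R E) ∧ IsPowTorsion I E ∧ ∃ f : N →ₗ[R] E, Function.Injective f := by
  let J := Injective.under (ModuleCat.of R N)
  let i : N →ₗ[R] J := (Injective.ι (ModuleCat.of R N)).hom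
  have hi : Function.Injective i := (ModuleCat.mono_iff_injective _).1 inferInstance
  have hJ' : Injective (ModuleCat.of R J) :=
    inferInstanceAs (Injective (Injective.under (ModuleCat.of R N)))
  have hJ : Module.Injective R J := Module.injective_module_of_injective_object R J
  have hE := (injective_powTors I J (Module.Baer.of_injective hJ)).injective
  refine ⟨powTors I J, inferInstance, inferInstance, Module.injective_object_of_injective_module R _,
    isPowTorsion_powTors I J, i.codRestrict _ fun x => ?_, fun a b hab => hi ?_⟩
  · obtain ⟨k, hk⟩ := h x
    exact ⟨k, fun r hr => by rw [← _root_.map_smul, hk r hr, _root_.map_zero]⟩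
  · exact congrArg Subtype.val hab

/-- Higher local cohomology of a power torsion module vanishes. -/
lemma H.subsingleton_of_isPowTorsion [IsNoetherianRing R] (n : ℕ) :
    ∀ (N : Type u) [AddCommGroup N] [Module R N], IsPowTorsion I N →
      Subsingleton (H I (n + 1) N) := by
  induction n with
  | zero =>
    intro N _ _ h
    obtain ⟨E, _, _, hE, htE, f, hf⟩ := exists_injective_isPowTorsion I N h
    have hg := Submodule.mkQ_surjective (LinearMap.range f)
    have hfg : Function.Exact f (LinearMap.range f).mkQ := LinearMap.exact_map_mkQ_range f
    have hE' := H.subsingleton_of_injective I 0 E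
    refine subsingleton_of_forall_eq 0 fun x => ?_
    obtain ⟨y, rfl⟩ := (H.exact_left (n := 0) I hf hg hfg x).1 (Subsingleton.elim _ _)
    obtain ⟨e, he⟩ := hg (H.ev I _ y)
    obtain ⟨k, hk⟩ := htE e
    obtain ⟨z, hz⟩ := H.mem_range_ev I e k hk
    have : H.map I 0 (LinearMap.range f).mkQ z = y := by
      apply H.ev_injective
      rw [H.ev_map, hz, he]
    rw [← this]
    exact (H.exact_right I hf hg hfg).apply_apply_eq_zero z
  | succ n ih =>
    intro N _ _ h
    obtain ⟨E, _, _, hE, htE, f, hf⟩ := exists_injective_isPowTorsion I N h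
    have hg := Submodule.mkQ_surjective (LinearMap.range f)
    have hfg : Function.Exact f (LinearMap.range f).mkQ := LinearMap.exact_map_mkQ_range f
    have hE' := H.subsingleton_of_injective I (n + 1) E
    have := ih _ (htE.of_surjective I _ hg)
    refine subsingleton_of_forall_eq 0 fun x => ?_
    obtain ⟨y, rfl⟩ := (H.exact_left (n := n + 1) I hf hg hfg x).1 (Subsingleton.elim _ _)
    rw [Subsingleton.elim y 0, _root_.map_zero]

end Vanish

section Length
variable {R : Type*} [CommRing R]

lemma length_eq_ker_add_range {M N : Type*} [AddCommGroup M] [Module R M] [AddCommGroup N]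
    [Module R N] (f : M →ₗ[R] N) :
    Module.length R M = Module.length R (LinearMap.ker f) + Module.length R (LinearMap.range f) :=
  Module.length_eq_add_of_exact (LinearMap.ker f).subtype f.rangeRestrict
    (Submodule.subtype_injective _) f.surjective_rangeRestrict
    (by rw [LinearMap.exact_iff, LinearMap.ker_rangeRestrict, Submodule.range_subtype])

lemma length_eq_sub_add_quot {M : Type*} [AddCommGroup M] [Module R M] (N : Submodule R M) :
    Module.length R M = Module.length R N + Module.length R (M ⧸ N) :=
  Module.length_eq_add_of_exact N.subtype N.mkQ (Submodule.subtype_injective _)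
    N.mkQ_surjective (LinearMap.exact_subtype_mkQ N)

lemma length_le_add_of_exact {A B C : Type*} [AddCommGroup A] [Module R A] [AddCommGroup B]
    [Module R B] [AddCommGroup C] [Module R C] (f : A →ₗ[R] B) (g : B →ₗ[R] C)
    (h : Function.Exact f g) : Module.length R B ≤ Module.length R A + Module.length R C := by
  rw [length_eq_ker_add_range g]
  gcongr
  · rw [h.linearMap_ker_eq]
    exact Module.length_le_of_surjective _ f.surjective_rangeRestrict
  · exact Module.length_le_of_injective (LinearMap.range g).subtype (Submodule.subtype_injective _)

/-- An endomorphism of a finite length module has kernel and cokernel of equal length. -/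
lemma length_ker_eq_length_coker {M : Type*} [AddCommGroup M] [Module R M] (f : M →ₗ[R] M)
    (h : Module.length R M ≠ ⊤) :
    Module.length R (LinearMap.ker f) = Module.length R (M ⧸ LinearMap.range f) := by
  have h1 := length_eq_ker_add_range f
  have h2 := length_eq_sub_add_quot (LinearMap.range f)
  have h3 : Module.length R (LinearMap.range f) ≠ ⊤ := fun h4 => h (by rw [h2, h4, top_add])
  rw [h2, add_comm] at h1
  exact (WithTop.add_right_cancel h3 h1).symm

lemma length_ne_top_of_injective {M N : Type*} [AddCommGroup M] [Module R M] [AddCommGroup N]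
    [Module R N] (f : M →ₗ[R] N) (hf : Function.Injective f) (h : Module.length R N ≠ ⊤) :
    Module.length R M ≠ ⊤ :=
  ne_top_of_le_ne_top h (Module.length_le_of_injective f hf)

lemma length_ne_top_of_surjective {M N : Type*} [AddCommGroup M] [Module R M] [AddCommGroup N]
    [Module R N] (f : M →ₗ[R] N) (hf : Function.Surjective f) (h : Module.length R M ≠ ⊤) :
    Module.length R N ≠ ⊤ :=
  ne_top_of_le_ne_top h (Module.length_le_of_surjective f hf)

/-- A finitely generated module killed by powers of a maximal ideal has finite length. -/
lemma IsPowTorsion.length_ne_top [IsNoetherianRing R] (J : Ideal R) [hJ : J.IsMaximal]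
    {M : Type*} [AddCommGroup M] [Module R M] [hM : Module.Finite R M] (h : IsPowTorsion J M) :
    Module.length R M ≠ ⊤ := by
  induction hM using IsNoetherianRing.induction_on_isQuotientEquivQuotientPrime R with
  | subsingleton N => simp [Module.length_eq_zero]
  | quotient N p e =>
    have hp : J ≤ p.1 := by
      obtain ⟨k, hk⟩ := h (e.symm 1)
      have : J ^ k ≤ p.1 := fun r hr => by
        have h1 := hk r hr
        rw [← _root_.map_smul, LinearEquiv.map_eq_zero_iff, Algebra.smul_def, mul_one] at h1
        exact Ideal.Quotient.eq_zero_iff_mem.1 h1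
      exact p.2.le_of_pow_le this
    have hJp := hJ.eq_of_le p.2.ne_top hp
    have : IsSimpleModule R (R ⧸ p.1) := by
      rw [← hJp, isSimpleModule_iff_isCoatom]
      exact hJ.out
    rw [e.length_eq, Module.length_eq_one]
    simp
  | exact N₁ N₂ N₃ f g hf hg hfg h1 h3 =>
    rw [Module.length_eq_add_of_exact f g hf hg hfg]
    exact WithTop.add_ne_top.2 ⟨h1 (h.of_injective J f hf), h3 (h.of_surjective J g hg)⟩

/-- Over a local ring a module of finite length is killed by a power of the maximal ideal. -/
lemma isPowTorsion_of_length_ne_top [IsLocalRing R]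
    {M : Type*} [AddCommGroup M] [Module R M] (h : Module.length R M ≠ ⊤) :
    IsPowTorsion (IsLocalRing.maximalIdeal R) M := by
  rw [Module.length_ne_top_iff] at h
  induction h with
  | of_subsingleton => exact fun x => ⟨0, fun r _ => Subsingleton.elim _ _⟩
  | of_simple_quotient h ih =>
    rename_i M _ _ N hN
    have : IsNoetherian R N := (isFiniteLength_iff_isNoetherian_isArtinian.1 h).1
    obtain ⟨k, hk⟩ := ih.exists_pow_smul
    intro x
    have h1 : ∀ r ∈ IsLocalRing.maximalIdeal R, r • x ∈ N := by
      intro r hr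
      rw [← Submodule.Quotient.mk_eq_zero, Submodule.Quotient.mk_smul]
      have : Module.annihilator R (M ⧸ N) = IsLocalRing.maximalIdeal R :=
        IsLocalRing.eq_maximalIdeal IsSimpleModule.annihilator_isMaximal
      rw [← this] at hr
      exact Module.mem_annihilator.1 hr _
    refine ⟨k + 1, fun r hr => ?_⟩
    rw [pow_succ] at hr
    induction hr using Submodule.mul_induction_on' with
    | mem_mul_mem a ha b hb =>
      rw [mul_smul]
      exact congrArg Subtype.val (hk a ha ⟨b • x, h1 b hb⟩)
    | add a _ b _ ha hb => rw [add_smul, ha, hb, add_zero]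

end Length

section Symbol
variable {B : Type u} [CommRing B]

/-- The multiplicity symbol of a list of ring elements on a module: the alternating sum of the
lengths obtained by iterating `W ↦ W / y W` and `W ↦ (0 :_W y)`. -/
noncomputable def symb : List B → ∀ (W : Type v) [AddCommGroup W] [Module B W], ℤ
  | [], W, _, _ => ((Module.length B W).toNat : ℤ)
  | y :: ys, W, _, _ => symb ys (QuotSMulTop y W) - symb ys (Submodule.torsionBy B W y)

/-- The finiteness condition under which the multiplicity symbol is additive. -/
def SymbFin (J : Ideal B) (ys : List B) (W : Type v) [AddCommGroup W] [Module B W] : Prop :=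
  Module.Finite B W ∧ J ≤ (Module.annihilator B W ⊔ Ideal.span {y | y ∈ ys}).radical

variable {J : Ideal B} {ys : List B}

section
variable {W W' : Type*} [AddCommGroup W] [Module B W] [AddCommGroup W'] [Module B W']

lemma SymbFin.of_injective [IsNoetherianRing B] (h : SymbFin J ys W') (f : W →ₗ[B] W')
    (hf : Function.Injective f) : SymbFin J ys W := by
  have := h.1
  exact ⟨Module.Finite.of_injective f hf, h.2.trans (Ideal.radical_mono
    (sup_le_sup_right (f.annihilator_le_of_injective hf) _))⟩

lemma SymbFin.of_surjective (h : SymbFin J ys W) (f : W →ₗ[B] W')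
    (hf : Function.Surjective f) : SymbFin J ys W' := by
  have := h.1
  exact ⟨Module.Finite.of_surjective f hf, h.2.trans (Ideal.radical_mono
    (sup_le_sup_right (f.annihilator_le_of_surjective hf) _))⟩

lemma SymbFin.tail {y : B} (h : SymbFin J (y :: ys) W) (hy : ∀ w : W, y • w = 0) :
    SymbFin J ys W := by
  refine ⟨h.1, h.2.trans (Ideal.radical_mono (sup_le le_sup_left (Ideal.span_le.2 ?_)))⟩
  intro z hz
  rcases List.mem_cons.1 hz with rfl | hz
  · exact Ideal.mem_sup_left (Module.mem_annihilator.2 hy)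
  · exact Ideal.mem_sup_right (Ideal.subset_span hz)

lemma SymbFin.quot {y : B} (h : SymbFin J (y :: ys) W) : SymbFin J ys (QuotSMulTop y W) :=
  (h.of_surjective _ (Submodule.mkQ_surjective _)).tail
    (Module.mem_annihilator.1 (QuotSMulTop.mem_annihilator _ y))

lemma SymbFin.torsionBy [IsNoetherianRing B] {y : B} (h : SymbFin J (y :: ys) W) :
    SymbFin J ys (Submodule.torsionBy B W y) :=
  (h.of_injective _ (Submodule.subtype_injective _)).tail
    (fun w => Submodule.smul_torsionBy y w)

lemma SymbFin.length_ne_top [IsNoetherianRing B] [J.IsMaximal] (h : SymbFin J [] W) :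
    Module.length B W ≠ ⊤ := by
  have := h.1
  refine IsPowTorsion.length_ne_top J fun x => ?_
  have h2 := h.2
  simp only [List.not_mem_nil, Set.ofPred_false, Ideal.span_empty, sup_bot_eq] at h2
  obtain ⟨k, hk⟩ := Ideal.exists_pow_le_of_le_radical_of_fg h2 (IsNoetherian.noetherian J)
  exact ⟨k, fun r hr => Module.mem_annihilator.1 (hk hr) x⟩

lemma symb_eq_zero_of_subsingleton (ys : List B) (W : Type v) [AddCommGroup W] [Module B W]
    [Subsingleton W] : symb ys W = 0 := by
  induction ys generalizing W with
  | nil => simp [symb, Module.length_eq_zero]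
  | cons y ys ih => simp [symb, ih]
end

/-- The long exact kernel-cokernel sequence of multiplication by `y`. -/
lemma exists_snake {W W' W'' : Type v} [AddCommGroup W] [Module B W] [AddCommGroup W']
    [Module B W'] [AddCommGroup W''] [Module B W''] (f : W' →ₗ[B] W) (g : W →ₗ[B] W'')
    (hf : Function.Injective f) (hg : Function.Surjective g) (hfg : Function.Exact f g) (y : B) :
    ∃ (a : Submodule.torsionBy B W' y →ₗ[B] Submodule.torsionBy B W y)
      (b : Submodule.torsionBy B W y →ₗ[B] Submodule.torsionBy B W'' y)
      (d : Submodule.torsionBy B W'' y →ₗ[B] QuotSMulTop y W'),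
      Function.Injective a ∧ Function.Exact a b ∧ Function.Exact b d ∧
      Function.Exact d (QuotSMulTop.map y f) := by
  let a : Submodule.torsionBy B W' y →ₗ[B] Submodule.torsionBy B W y :=
    f.restrict fun x hx => by
      rw [Submodule.mem_torsionBy_iff] at hx ⊢
      rw [← map_smul, hx, map_zero]
  let b : Submodule.torsionBy B W y →ₗ[B] Submodule.torsionBy B W'' y :=
    g.restrict fun x hx => by
      rw [Submodule.mem_torsionBy_iff] at hx ⊢
      rw [← map_smul, hx, map_zero]
  have hK (V : Type v) [AddCommGroup V] [Module B V] :
      Function.Exact (Submodule.torsionBy B V y).subtype (LinearMap.lsmul B V y) := by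
    intro x
    simp
  have hC (V : Type v) [AddCommGroup V] [Module B V] :
      Function.Exact (LinearMap.lsmul B V y) (y • (⊤ : Submodule B V)).mkQ := by
    intro x
    simp [Submodule.mem_smul_pointwise_iff_exists]
  let d := SnakeLemma.δ' (LinearMap.lsmul B W' y) (LinearMap.lsmul B W y) (LinearMap.lsmul B W'' y)
    f g hfg f g hfg (by ext; simp) (by ext; simp) (Submodule.torsionBy B W'' y).subtype (hK W'')
    (y • (⊤ : Submodule B W')).mkQ (hC W') hg hf
  refine ⟨a, b, d, fun x x' hx => Subtype.ext (hf (congrArg Subtype.val hx)), ?_, ?_, ?_⟩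
  · intro x
    constructor
    · intro hx
      obtain ⟨z, hz⟩ := (hfg x).1 (congrArg Subtype.val hx)
      refine ⟨⟨z, ?_⟩, Subtype.ext hz⟩
      rw [Submodule.mem_torsionBy_iff]
      apply hf
      rw [map_smul, hz, map_zero]
      exact x.2
    · rintro ⟨z, rfl⟩
      exact Subtype.ext ((hfg _).2 ⟨_, rfl⟩)
  · exact SnakeLemma.exact_δ'_right _ _ _ _ _ _ _ _ _ _ _ _ (hK W) _ _ _ _ _ _ _ rfl
      (Submodule.subtype_injective _)
  · exact SnakeLemma.exact_δ'_left _ _ _ _ _ _ _ _ _ _ _ _ _ _ _ _ (hC W) _ _ _ rfl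
      (Submodule.mkQ_surjective _)

variable [IsNoetherianRing B] [J.IsMaximal]

/-- Additivity of the multiplicity symbol on short exact sequences. -/
lemma symb_eq_add_of_exact {W W' W'' : Type v} [AddCommGroup W] [Module B W] [AddCommGroup W']
    [Module B W'] [AddCommGroup W''] [Module B W''] (f : W' →ₗ[B] W) (g : W →ₗ[B] W'')
    (hf : Function.Injective f) (hg : Function.Surjective g) (hfg : Function.Exact f g)
    (h : SymbFin J ys W) : symb ys W = symb ys W' + symb ys W'' := by
  induction ys generalizing W W' W'' with
  | nil =>
    have h1 := (h.of_injective f hf).length_ne_top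
    have h2 := (h.of_surjective g hg).length_ne_top
    simp only [symb]
    rw [Module.length_eq_add_of_exact f g hf hg hfg, ENat.toNat_add h1 h2, Nat.cast_add]
  | cons y ys ih =>
    obtain ⟨a, b, d, ha, hab, hbd, hd⟩ := exists_snake f g hf hg hfg y
    have key : ∀ {V V' : Type v} [AddCommGroup V] [Module B V] [AddCommGroup V'] [Module B V']
        (φ : V →ₗ[B] V'), SymbFin J ys V →
        symb ys V = symb ys (LinearMap.ker φ) + symb ys (LinearMap.range φ) := fun φ hV =>
      ih (LinearMap.ker φ).subtype φ.rangeRestrict (Submodule.subtype_injective _)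
        φ.surjective_rangeRestrict
        (by rw [LinearMap.exact_iff, LinearMap.ker_rangeRestrict, Submodule.range_subtype]) hV
    have h1 := ih a b.rangeRestrict ha b.surjective_rangeRestrict
      (by rw [LinearMap.exact_iff, LinearMap.ker_rangeRestrict, hab.linearMap_ker_eq]) h.torsionBy
    have h2 := key d (h.of_surjective g hg).torsionBy
    have h3 := key (QuotSMulTop.map y f) (h.of_injective f hf).quot
    have h4 := ih (LinearMap.range (QuotSMulTop.map y f)).subtype (QuotSMulTop.map y g)
      (Submodule.subtype_injective _) (QuotSMulTop.map_surjective y hg)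
      (by rw [LinearMap.exact_iff, Submodule.range_subtype,
            (QuotSMulTop.map_exact y hfg hg).linearMap_ker_eq]) h.quot
    rw [hbd.linearMap_ker_eq] at h2
    rw [hd.linearMap_ker_eq] at h3
    simp only [symb]
    lia

lemma symb_eq_zero_of_length_ne_top {y : B} {W : Type v} [AddCommGroup W] [Module B W]
    (h : SymbFin J ys W) : symb (y :: ys) W = 0 := by
  have h1 := symb_eq_add_of_exact (J := J) (ys := ys) (Submodule.torsionBy B W y).subtype
    (LinearMap.lsmul B W y).rangeRestrict (Submodule.subtype_injective _)
    (LinearMap.surjective_rangeRestrict _) (by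
      rw [LinearMap.exact_iff, LinearMap.ker_rangeRestrict, Submodule.range_subtype]; rfl) h
  have h2 := symb_eq_add_of_exact (J := J) (ys := ys) (LinearMap.range (LinearMap.lsmul B W y)).subtype
    (y • (⊤ : Submodule B W)).mkQ (Submodule.subtype_injective _) (Submodule.mkQ_surjective _)
    (by
      rw [LinearMap.exact_iff, Submodule.range_subtype, Submodule.ker_mkQ]
      ext x
      simp [Submodule.mem_smul_pointwise_iff_exists]) h
  simp only [symb]
  lia

end Symbol

section LES
variable {R : Type u} [CommRing R] [IsNoetherianRing R] (I : Ideal R)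
  {P P'' : Type u} [AddCommGroup P] [Module R P] [AddCommGroup P''] [Module R P'']

/-- A surjection with torsion kernel is an isomorphism on local cohomology in positive degrees. -/
lemma H.map_bijective_of_ker {A : Type u} [AddCommGroup A] [Module R A] (ρ : P →ₗ[R] A)
    (hρ : Function.Surjective ρ) (hk : IsPowTorsion I (LinearMap.ker ρ)) (n : ℕ) :
    Function.Bijective (H.map I (n + 1) ρ) ∧ Function.Surjective (H.map I n ρ) := by
  have hi : Function.Injective (LinearMap.ker ρ).subtype := Submodule.subtype_injective _
  have he : Function.Exact (LinearMap.ker ρ).subtype ρ := LinearMap.exact_subtype_ker_map ρ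
  have h0 (n) := H.subsingleton_of_isPowTorsion I n _ hk
  have hs (n) : Function.Surjective (H.map I n ρ) := fun x =>
    (H.exact_right I hi hρ he x).1 ((h0 n).elim _ _)
  refine ⟨⟨?_, hs _⟩, hs _⟩
  rw [injective_iff_map_eq_zero]
  intro x hx
  obtain ⟨y, rfl⟩ := (H.exact_mid I hi hρ he x).1 hx
  rw [(h0 n).elim y 0, _root_.map_zero]

/-- The long exact sequence of local cohomology attached to an endomorphism with torsion kernel. -/
lemma H.exists_les (φ : P →ₗ[R] P) (π : P →ₗ[R] P'') (hφ : IsPowTorsion I (LinearMap.ker φ))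
    (hπ : Function.Surjective π) (h : Function.Exact φ π) (n : ℕ) :
    ∃ δ : H I n P'' →ₗ[R] H I (n + 1) P,
      Function.Exact (H.map I n φ) (H.map I n π) ∧ Function.Exact (H.map I n π) δ ∧
      Function.Exact δ (H.map I (n + 1) φ) := by
  set A := LinearMap.range φ
  set ρ : P →ₗ[R] A := φ.rangeRestrict
  have hρ : Function.Surjective ρ := φ.surjective_rangeRestrict
  have hker : IsPowTorsion I (LinearMap.ker ρ) := by
    rwa [LinearMap.ker_rangeRestrict]
  have hφρ : A.subtype ∘ₗ ρ = φ := LinearMap.subtype_comp_codRestrict _ _ _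
  obtain ⟨hb, hs⟩ := H.map_bijective_of_ker I ρ hρ hker n
  have hi : Function.Injective A.subtype := Submodule.subtype_injective _
  have he : Function.Exact A.subtype π := by
    rw [LinearMap.exact_iff, Submodule.range_subtype, h.linearMap_ker_eq]
  let e := LinearEquiv.ofBijective _ hb
  have he1 : ∀ x, H.map I (n + 1) ρ (e.symm x) = x := fun x =>
    e.apply_symm_apply x
  have he2 : ∀ x, H.map I (n + 1) φ (e.symm x) = H.map I (n + 1) A.subtype x := fun x => by
    rw [← hφρ, H.map_comp, LinearMap.comp_apply, he1]
  refine ⟨e.symm.toLinearMap ∘ₗ H.δ I n hi hπ he, ?_, ?_, ?_⟩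
  · intro x
    rw [H.exact_mid I hi hπ he x, ← hφρ, H.map_comp]
    constructor
    · rintro ⟨y, rfl⟩
      obtain ⟨z, rfl⟩ := hs y
      exact ⟨z, rfl⟩
    · rintro ⟨z, rfl⟩
      exact ⟨_, rfl⟩
  · intro x
    rw [← H.exact_right I hi hπ he x]
    simp
  · intro x
    obtain ⟨y, rfl⟩ := e.symm.surjective x
    rw [he2, H.exact_left I hi hπ he y]
    simp

end LES

section Bound
variable {R : Type u} [CommRing R] [IsNoetherianRing R] (I : Ideal R)

/-- The length of the cokernel of an endomorphism on local cohomology. -/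
noncomputable def cokerLength (n : ℕ) {P : Type u} [AddCommGroup P] [Module R P]
    (φ : P →ₗ[R] P) : ℕ∞ :=
  Module.length R (H I n P ⧸ LinearMap.range (H.map I n φ))

lemma cokerLength_le (n : ℕ) {P : Type u} [AddCommGroup P] [Module R P]
    (φ : P →ₗ[R] P) : cokerLength I n φ ≤ Module.length R (H I n P) :=
  Module.length_le_of_surjective _ (Submodule.mkQ_surjective _)

variable {P P'' : Type u} [AddCommGroup P] [Module R P] [AddCommGroup P''] [Module R P'']

lemma length_range_of_exact {A A' A'' : Type*} [AddCommGroup A] [Module R A] [AddCommGroup A']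
    [Module R A'] [AddCommGroup A''] [Module R A''] {f : A →ₗ[R] A'} {g : A' →ₗ[R] A''}
    (h : Function.Exact f g) :
    Module.length R (LinearMap.range g) = Module.length R (A' ⧸ LinearMap.range f) := by
  rw [← h.linearMap_ker_eq]
  exact g.quotKerEquivRange.length_eq.symm

lemma length_H_le_of_exact {φ : P →ₗ[R] P} {π : P →ₗ[R] P''}
    (hφ : IsPowTorsion I (LinearMap.ker φ)) (hπ : Function.Surjective π)
    (h : Function.Exact φ π) (n : ℕ) (hn : Module.length R (H I (n + 1) P) ≠ ⊤) :
    Module.length R (H I n P'') ≤ cokerLength I n φ + cokerLength I (n + 1) φ := by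
  obtain ⟨δ, h1, h2, h3⟩ := H.exists_les I φ π hφ hπ h n
  rw [length_eq_ker_add_range δ, h2.linearMap_ker_eq, length_range_of_exact h1,
    ← h3.linearMap_ker_eq, length_ker_eq_length_coker _ hn]
  exact le_rfl

/-- The refined bound for the action of a second, commuting endomorphism. -/
lemma cokerLength_le_of_exact {φ ψ : P →ₗ[R] P} {ψ'' : P'' →ₗ[R] P''} {π : P →ₗ[R] P''}
    (hφ : IsPowTorsion I (LinearMap.ker φ)) (hπ : Function.Surjective π)
    (h : Function.Exact φ π) (hc' : π ∘ₗ ψ = ψ'' ∘ₗ π)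
    (n : ℕ) (hn : Module.length R (H I (n + 1) P) ≠ ⊤) :
    cokerLength I n ψ'' ≤
      Module.length R (H I n P ⧸ (LinearMap.range (H.map I n φ) ⊔ LinearMap.range (H.map I n ψ))) +
        cokerLength I (n + 1) φ := by
  obtain ⟨δ, h1, h2, h3⟩ := H.exists_les I φ π hφ hπ h n
  let K := LinearMap.range (H.map I n φ) ⊔ LinearMap.range (H.map I n ψ)
  let C := LinearMap.range (H.map I n ψ'')
  have hK : K ≤ LinearMap.ker (C.mkQ ∘ₗ H.map I n π) := by
    refine sup_le ?_ ?_
    · rintro _ ⟨x, rfl⟩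
      have : H.map I n π (H.map I n φ x) = 0 := (h1 _).2 ⟨x, rfl⟩
      simp [this]
    · rintro _ ⟨x, rfl⟩
      have : H.map I n π (H.map I n ψ x) = H.map I n ψ'' (H.map I n π x) := by
        rw [← LinearMap.comp_apply, ← H.map_comp, hc', H.map_comp, LinearMap.comp_apply]
      simp [this, C]
  let f := K.liftQ _ hK
  -- the map `δ` followed by the projection to the cokernel
  let D := C.map δ
  let g : (H I n P'' ⧸ C) →ₗ[R] (H I (n + 1) P ⧸ D) := C.mapQ D δ (Submodule.le_comap_map δ C)
  have hfg : Function.Exact f g := by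
    intro x
    obtain ⟨x, rfl⟩ := C.mkQ_surjective x
    have hg : g (C.mkQ x) = D.mkQ (δ x) := rfl
    rw [hg, Submodule.mkQ_apply, Submodule.Quotient.mk_eq_zero]
    constructor
    · rintro ⟨c, hc, hcx⟩
      have : δ (x - c) = 0 := by simp [hcx]
      obtain ⟨z, hz⟩ := (h2 _).1 this
      refine ⟨K.mkQ z, ?_⟩
      change C.mkQ (H.map I n π z) = _
      rw [hz, map_sub, sub_eq_self]
      exact (Submodule.Quotient.mk_eq_zero _).2 hc
    · rintro ⟨z, hz⟩
      obtain ⟨z, rfl⟩ := K.mkQ_surjective z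
      have hz : C.mkQ (H.map I n π z) = C.mkQ x := hz
      refine ⟨x - H.map I n π z, ?_, ?_⟩
      · rw [SetLike.mem_coe, ← Submodule.Quotient.mk_eq_zero, ← Submodule.mkQ_apply, map_sub, hz, sub_self]
      · have : δ (H.map I n π z) = 0 := (h2 _).2 ⟨z, rfl⟩
        simp [this]
  change Module.length R (H I n P'' ⧸ C) ≤ _
  rw [length_eq_ker_add_range g, hfg.linearMap_ker_eq]
  gcongr
  · exact Module.length_le_of_surjective _ f.surjective_rangeRestrict
  · have : LinearMap.range g ≤ (LinearMap.ker (H.map I (n + 1) φ)).map D.mkQ := by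
      rintro _ ⟨x, rfl⟩
      obtain ⟨x, rfl⟩ := C.mkQ_surjective x
      exact ⟨δ x, (h3 _).2 ⟨x, rfl⟩, rfl⟩
    calc _ ≤ Module.length R ((LinearMap.ker (H.map I (n + 1) φ)).map D.mkQ) :=
          Module.length_le_of_injective (Submodule.inclusion this) (Submodule.inclusion_injective _)
      _ ≤ Module.length R (LinearMap.ker (H.map I (n + 1) φ)) :=
          Module.length_le_of_surjective (D.mkQ.submoduleMap _)
            (LinearMap.submoduleMap_surjective _ _)
      _ = _ := length_ker_eq_length_coker _ hn

lemma length_le_cokerLength_zero {φ : P →ₗ[R] P} (hφ : IsPowTorsion I (LinearMap.ker φ))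
    (h0 : Module.length R (H I 0 P) ≠ ⊤) :
    Module.length R (LinearMap.ker φ) ≤ cokerLength I 0 φ := by
  have h1 : Module.length R (LinearMap.ker (H.map I 0 φ)) = cokerLength I 0 φ :=
    length_ker_eq_length_coker _ h0
  rw [← h1]
  have h2 : ∀ x ∈ LinearMap.ker (H.map I 0 φ), H.ev I P x ∈ LinearMap.ker φ := by
    intro x hx
    rw [LinearMap.mem_ker] at hx ⊢
    rw [← H.ev_map, hx, _root_.map_zero]
  refine Module.length_le_of_surjective ((H.ev I P).restrict h2) ?_
  rintro ⟨x, hx⟩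
  obtain ⟨k, hk⟩ := hφ ⟨x, hx⟩
  obtain ⟨y, rfl⟩ := H.mem_range_ev I x k fun r hr => congrArg Subtype.val (hk r hr)
  refine ⟨⟨y, ?_⟩, rfl⟩
  rw [LinearMap.mem_ker] at hx ⊢
  apply H.ev_injective I
  rw [H.ev_map, hx, _root_.map_zero]

variable {B : Type u} [CommRing B] [Algebra R B]

/-- Multiplication by an element of an `R`-algebra as an `R`-linear endomorphism. -/
def act (R : Type*) [CommRing R] {B : Type*} [CommRing B] [Algebra R B] (y : B) (P : Type*)
    [AddCommGroup P] [Module R P] [Module B P] [IsScalarTower R B P] : P →ₗ[R] P :=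
  Algebra.lsmul R R P y

/-- All successive kernels `(0 :_{P/(y_1, …, y_j)P} y_{j+1})` are `I`-power torsion. -/
def AllTors : List B → ∀ (P : Type u) [AddCommGroup P] [Module R P] [Module B P]
    [IsScalarTower R B P], Prop
  | [], _, _, _, _, _ => True
  | y :: ys, P, _, _, _, _ =>
    IsPowTorsion I (Submodule.torsionBy B P y) ∧ AllTors ys (QuotSMulTop y P)

/-- The length of the last kernel `(0 :_{P/(y_1, …, y_{k-1})P} y_k)`. -/
noncomputable def lastKer : List B → ∀ (P : Type u) [AddCommGroup P] [Module B P], ℕ∞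
  | [], _, _, _ => 0
  | [y], P, _, _ => Module.length B (Submodule.torsionBy B P y)
  | y :: y' :: ys, P, _, _ => lastKer (y' :: ys) (QuotSMulTop y P)

/-- Iterated sums of neighbours. -/
def binomSum {α : Type*} [Add α] : ℕ → (ℕ → α) → α
  | 0, f => f 0
  | k + 1, f => binomSum k fun i => f i + f (i + 1)

lemma binomSum_eq {α : Type*} [CommSemiring α] (k : ℕ) (f : ℕ → α) :
    binomSum k f = ∑ i ∈ Finset.range (k + 1), (k.choose i : α) * f i := by
  induction k generalizing f with
  | zero => simp [binomSum]
  | succ k ih =>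
    rw [binomSum, ih]
    simp only [mul_add, Finset.sum_add_distrib]
    rw [Finset.sum_range_succ' _ (k + 1)]
    simp only [Nat.choose_succ_succ, Nat.cast_add, add_mul, Finset.sum_add_distrib]
    rw [Finset.sum_range_succ' (fun i => (k.choose i : α) * f i),
      Finset.sum_range_succ (fun i => (k.choose (i + 1) : α) * f (i + 1)) k]
    simp only [Nat.choose_succ_self, Nat.choose_zero_right]
    push_cast
    ring

variable {P : Type u} [AddCommGroup P] [Module R P] [Module B P] [IsScalarTower R B P]

/-- The quotient map to `P / yP` as an `R`-linear map. -/
def quotMk (R : Type*) [CommRing R] {B : Type*} [CommRing B] [Algebra R B] (y : B) (P : Type*)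
    [AddCommGroup P] [Module R P] [Module B P] [IsScalarTower R B P] : P →ₗ[R] QuotSMulTop y P :=
  (y • (⊤ : Submodule B P)).mkQ.restrictScalars R

lemma quotMk_surjective (y : B) : Function.Surjective (quotMk R y P) := fun x => by
  obtain ⟨x, rfl⟩ := (y • (⊤ : Submodule B P)).mkQ_surjective x
  exact ⟨x, rfl⟩

lemma exact_act_quotMk (y : B) : Function.Exact (act R y P) (quotMk R y P) := by
  intro x
  simp [Submodule.mem_smul_pointwise_iff_exists, quotMk, act]

lemma isPowTorsion_ker_act {y : B} (h : IsPowTorsion I (Submodule.torsionBy B P y)) :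
    IsPowTorsion I (LinearMap.ker (act R y P)) := fun x => by
  obtain ⟨k, hk⟩ := h ⟨x.1, x.2⟩
  exact ⟨k, fun r hr => Subtype.ext (congrArg Subtype.val (hk r hr))⟩

lemma length_H_quot_le {y : B} (h : IsPowTorsion I (Submodule.torsionBy B P y)) (n : ℕ)
    (hn : Module.length R (H I (n + 1) P) ≠ ⊤) :
    Module.length R (H I n (QuotSMulTop y P)) ≤
      cokerLength I n (act R y P) + cokerLength I (n + 1) (act R y P) :=
  length_H_le_of_exact I (φ := act R y P)
    (isPowTorsion_ker_act I h) (quotMk_surjective y)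
    (exact_act_quotMk y) n hn

lemma length_H_quot_ne_top {y : B} (h : IsPowTorsion I (Submodule.torsionBy B P y)) {n : ℕ}
    (hn : Module.length R (H I n P) ≠ ⊤) (hn' : Module.length R (H I (n + 1) P) ≠ ⊤) :
    Module.length R (H I n (QuotSMulTop y P)) ≠ ⊤ :=
  ne_top_of_le_ne_top (WithTop.add_ne_top.2
    ⟨ne_top_of_le_ne_top hn (cokerLength_le I _ _), ne_top_of_le_ne_top hn' (cokerLength_le I _ _)⟩)
    (length_H_quot_le I h n hn')

lemma lastKer_le (y : B) (ys : List B) (hT : AllTors I (y :: ys) P)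
    (hP : ∀ i ≤ ys.length, Module.length R (H I i P) ≠ ⊤) (a : ℕ → ℕ∞)
    (ha : ∀ i ≤ ys.length, cokerLength I i (act R y P) ≤ a i) :
    lastKer (y :: ys) P ≤ binomSum ys.length a := by
  induction ys generalizing P y a with
  | nil =>
    refine le_trans ?_ (ha 0 le_rfl)
    refine le_trans ?_ (length_le_cokerLength_zero I (isPowTorsion_ker_act I hT.1) (hP 0 le_rfl))
    exact Submodule.length_le_length_restrictScalars R (Submodule.torsionBy B P y)
  | cons y' ys ih =>
    refine ih y' hT.2 (fun i hi => length_H_quot_ne_top I hT.1 (hP _ ?_) (hP _ ?_)) _ fun i hi => ?_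
    · simp; omega
    · simpa using hi
    · refine (cokerLength_le I i _).trans ((length_H_quot_le I hT.1 i (hP _ ?_)).trans
        (add_le_add (ha _ ?_) (ha _ ?_)))
      · simpa using hi
      · simp; omega
      · simpa using hi

end Bound

section Primes
variable {R : Type*} [CommRing R] [IsNoetherianRing R]

lemma mem_associatedPrimes_iff {N : Type*} [AddCommGroup N] [Module R N] {p : Ideal R} :
    p ∈ associatedPrimes R N ↔ p.IsPrime ∧ ∃ x : N, ∀ r, r ∈ p ↔ r • x = 0 := by
  rw [AssociatedPrimes.mem_iff, isAssociatedPrime_iff]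
  simp [SetLike.ext_iff]

/-- Prime avoidance for a finite set of primes not containing an ideal. -/
lemma exists_mem_forall_notMem {I : Ideal R} {S : Set (Ideal R)} (hS : S.Finite)
    (hp : ∀ p ∈ S, p.IsPrime) (hI : ∀ p ∈ S, ¬ I ≤ p) : ∃ z ∈ I, ∀ p ∈ S, z ∉ p := by
  by_contra! h
  obtain ⟨p, hp, hIp⟩ := (Ideal.subset_union_prime_finite (I := I) hS (f := id) ⊥ ⊥
    fun p hpS _ _ => hp p hpS).1 fun z hz => by
      obtain ⟨p, hpS, hzp⟩ := h z hz
      exact Set.mem_biUnion hpS hzp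
  exact hI p hp hIp

lemma isPowTorsion_of_associatedPrimes (J : Ideal R) {N : Type*} [AddCommGroup N] [Module R N]
    [Module.Finite R N] (h : ∀ p ∈ associatedPrimes R N, J ≤ p) : IsPowTorsion J N := by
  have : J ≤ (Module.annihilator R N).radical := by
    rw [← Ideal.sInf_minimalPrimes]
    exact le_sInf fun p hp => h p (Module.associatedPrimes.minimalPrimes_annihilator_subset_associatedPrimes R N hp)
  obtain ⟨k, hk⟩ := Ideal.exists_pow_le_of_le_radical_of_fg this (IsNoetherian.noetherian J)
  exact fun x => ⟨k, fun r hr => Module.mem_annihilator.1 (hk hr) x⟩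

lemma ringKrullDim_quotient_add_one_le {p q : Ideal R} [p.IsPrime] (h : p < q) :
    ringKrullDim (R ⧸ q) + 1 ≤ ringKrullDim (R ⧸ p) := by
  obtain ⟨r, hrq, hrp⟩ := SetLike.exists_of_lt h
  have hr : Ideal.Quotient.mk p r ∈ nonZeroDivisors (R ⧸ p) := mem_nonZeroDivisors_of_ne_zero
    (by rwa [Ne, Ideal.Quotient.eq_zero_iff_mem])
  refine le_trans ?_ (ringKrullDim_quotient_succ_le_of_nonZeroDivisor hr)
  gcongr
  refine ringKrullDim_le_of_surjective (Ideal.Quotient.lift (Ideal.span {Ideal.Quotient.mk p r})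
    (Ideal.Quotient.factor h.le) ?_) ?_
  · intro a ha
    obtain ⟨b, rfl⟩ := Ideal.mem_span_singleton'.1 ha
    rw [_root_.map_mul, Ideal.Quotient.factor_mk, Ideal.Quotient.eq_zero_iff_mem.2 hrq, mul_zero]
  · exact Ideal.Quotient.lift_surjective_of_surjective _ _ (Ideal.Quotient.factor_surjective h.le)

lemma ringKrullDim_le_of_le_radical [IsLocalRing R] (p : Ideal R) [p.IsPrime] (l : List R)
    (hl : ∀ x ∈ l, x ∈ maximalIdeal R)
    (h : maximalIdeal R ≤ (p ⊔ Ideal.span {x | x ∈ l}).radical) :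
    ringKrullDim (R ⧸ p) ≤ l.length := by
  classical
  set A := R ⧸ p
  let s : Finset A := (l.map (Ideal.Quotient.mk p)).toFinset
  have hs : Ideal.span (s : Set A) = (Ideal.span {x | x ∈ l}).map (Ideal.Quotient.mk p) := by
    rw [Ideal.map_span]
    congr 1
    ext x
    simp [s]
  have hloc : IsLocalRing A := IsLocalRing.of_surjective' _ Ideal.Quotient.mk_surjective
  have hmax : maximalIdeal A = (maximalIdeal R).map (Ideal.Quotient.mk p) := by
    rw [IsLocalRing.map_maximalIdeal_of_surjective]
    exact Ideal.Quotient.mk_surjective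
  have h1 : maximalIdeal A ∈ (Ideal.span (s : Set A)).minimalPrimes := by
    refine ⟨⟨inferInstance, ?_⟩, ?_⟩
    · rw [hs, hmax]
      exact Ideal.map_mono (Ideal.span_le.2 hl)
    · rintro q ⟨hq, hsq⟩ -
      rw [hmax, Ideal.map_le_iff_le_comap]
      refine h.trans (Ideal.IsPrime.radical_le_iff (Ideal.comap_isPrime _ q) |>.2 (sup_le ?_ ?_))
      · rw [← Ideal.map_le_iff_le_comap, Ideal.map_quotient_self]
        exact bot_le
      · rw [← Ideal.map_le_iff_le_comap, ← hs]
        exact hsq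
  rw [← IsLocalRing.maximalIdeal_height_eq_ringKrullDim]
  have h2 : (maximalIdeal A).height ≤ s.card := by
    refine (Ideal.height_le_spanRank_toENat_of_mem_minimalPrimes _ _ h1).trans ?_
    rw [Submodule.spanRank_toENat_eq_iInf_finset_card]
    exact iInf_le (fun t : {t : Finset A // Submodule.span A (t : Set A) = Ideal.span (s : Set A)} =>
      (t.1.card : ℕ∞)) ⟨s, rfl⟩
  have h4 : s.card ≤ l.length := (List.toFinset_card_le _).trans (by simp)
  exact_mod_cast h2.trans (Nat.cast_le.2 h4)

end Primes

section Ass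
variable {R : Type u} [CommRing R] [IsNoetherianRing R] [IsLocalRing R]

/-- A filter-regularity criterion: the kernel of an element avoiding the nonmaximal associated
primes is torsion. -/
lemma isPowTorsion_torsionBy {N : Type*} [AddCommGroup N] [Module R N] [Module.Finite R N] {z : R}
    (hz : ∀ p ∈ associatedPrimes R N, p ≠ maximalIdeal R → z ∉ p) :
    IsPowTorsion (maximalIdeal R) (Submodule.torsionBy R N z) := by
  refine isPowTorsion_of_associatedPrimes _ fun p hp => ?_
  by_contra h
  refine hz p (associatedPrimes.subset_of_injective (Submodule.subtype_injective _) hp)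
    (fun h' => h h'.ge) ?_
  obtain ⟨-, x, hx⟩ := mem_associatedPrimes_iff.1 hp
  exact (hx z).2 (Submodule.smul_torsionBy z x)

lemma not_maximalIdeal_le {p : Ideal R} (hp : p.IsPrime) (h : p ≠ maximalIdeal R) :
    ¬ maximalIdeal R ≤ p := fun h' => h (le_antisymm (le_maximalIdeal hp.ne_top) h')

lemma length_le_length_H_zero {N : Type u} [AddCommGroup N] [Module R N] (I : Ideal R)
    (V : Submodule R N) (hV : IsPowTorsion I V) :
    Module.length R V ≤ Module.length R (H I 0 N) := by
  have h : V ≤ LinearMap.range (H.ev I N) := fun x hx => by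
    obtain ⟨k, hk⟩ := hV ⟨x, hx⟩
    exact H.mem_range_ev I x k fun r hr => congrArg Subtype.val (hk r hr)
  exact (Module.length_le_of_injective (Submodule.inclusion h)
    (Submodule.inclusion_injective h)).trans
    (Module.length_le_of_surjective _ (H.ev I N).surjective_rangeRestrict)

lemma natCast_le_length_quotient_pow {A : Type*} [CommRing A] [IsDomain A] [Module R A]
    [IsScalarTower R A A] {z : A} (hz : z ≠ 0) (hz' : ¬ IsUnit z) (j : ℕ) :
    (j : ℕ∞) ≤ Module.length R (A ⧸ Ideal.span {z ^ j}) := by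
  induction j with
  | zero => simp
  | succ j ih =>
    have hle : Ideal.span {z ^ (j + 1)} ≤ Ideal.span {z ^ j} :=
      Ideal.span_singleton_le_span_singleton.2 (pow_dvd_pow z j.le_succ)
    let f : (A ⧸ Ideal.span {z ^ (j + 1)}) →ₗ[R] (A ⧸ Ideal.span {z ^ j}) :=
      (Submodule.factor hle).restrictScalars R
    have hf : Function.Surjective f := Submodule.factor_surjective hle
    have hk : 1 ≤ Module.length R (LinearMap.ker f) := by
      rw [Order.one_le_iff_ne_zero, Ne, Module.length_eq_zero_iff, Submodule.subsingleton_iff_eq_bot]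
      intro hb
      have hm : (Submodule.Quotient.mk (z ^ j) : A ⧸ Ideal.span {z ^ (j + 1)}) ∈
          LinearMap.ker f := by
        change (Submodule.Quotient.mk (z ^ j) : A ⧸ Ideal.span {z ^ j}) = 0
        rw [Submodule.Quotient.mk_eq_zero]
        exact Ideal.mem_span_singleton_self _
      rw [hb, Submodule.mem_bot, Submodule.Quotient.mk_eq_zero, Ideal.mem_span_singleton'] at hm
      obtain ⟨a, ha⟩ := hm
      refine hz' (IsUnit.of_mul_eq_one a (mul_left_cancel₀ (pow_ne_zero j hz) ?_))
      linear_combination ha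
    rw [length_eq_ker_add_range f, LinearMap.range_eq_top.2 hf, Module.length_top, Nat.cast_succ,
      add_comm]
    gcongr

/-- If the local cohomology of `N` has finite length below degree `d`, the nonmaximal associated
primes of `N` have dimension at least `d`. -/
lemma le_ringKrullDim_of_mem_associatedPrimes (d : ℕ) {N : Type u} [AddCommGroup N] [Module R N]
    [Module.Finite R N] (hN : ∀ i < d, Module.length R (H (maximalIdeal R) i N) ≠ ⊤)
    {p : Ideal R} (hp : p ∈ associatedPrimes R N) (hpm : p ≠ maximalIdeal R) :
    (d : WithBot ℕ∞) ≤ ringKrullDim (R ⧸ p) := by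
  have hp' := hp
  have hpp : p.IsPrime := hp.1
  induction d generalizing N p with
  | zero => exact_mod_cast ringKrullDim_nonneg_of_nontrivial
  | succ d ih =>
    rcases Nat.eq_zero_or_pos d with rfl | hd
    · have h1 := ringKrullDim_quotient_add_one_le (lt_of_le_of_ne (le_maximalIdeal hpp.ne_top) hpm)
      refine le_trans ?_ h1
      have : (0 : WithBot ℕ∞) ≤ ringKrullDim (R ⧸ maximalIdeal R) :=
        ringKrullDim_nonneg_of_nontrivial
      simpa using add_le_add_left this 1
    obtain ⟨z, hzm, hz⟩ := exists_mem_forall_notMem (I := maximalIdeal R)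
      (S := associatedPrimes R N \ {maximalIdeal R}) ((associatedPrimes.finite R N).sdiff)
      (fun p hp => hp.1.1) (fun p hp => not_maximalIdeal_le hp.1.1 hp.2)
    have hzk (k : ℕ) : IsPowTorsion (maximalIdeal R) (Submodule.torsionBy R N (z ^ k)) :=
      isPowTorsion_torsionBy fun q hq hqm hzq => hz q ⟨hq, hqm⟩ (hq.1.mem_of_pow_mem k hzq)
    have hzp : z ∉ p := hz p ⟨hp, hpm⟩
    obtain ⟨-, f, hf⟩ := (isAssociatedPrime_iff_exists_injective_linearMap p N).1 hp
    let g (k : ℕ) : R ⧸ p →ₗ[R] QuotSMulTop (z ^ k) N := (Submodule.mkQ _) ∘ₗ f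
    by_cases hk : ∃ k, ¬ IsPowTorsion (maximalIdeal R) (LinearMap.range (g k))
    · obtain ⟨k, hk⟩ := hk
      obtain ⟨q, hq, hqm⟩ : ∃ q ∈ associatedPrimes R (LinearMap.range (g k)),
          ¬ maximalIdeal R ≤ q := by
        by_contra! h
        exact hk (isPowTorsion_of_associatedPrimes _ h)
      have hqp : q.IsPrime := hq.1
      obtain ⟨-, ⟨x, y, hy⟩, hx⟩ := mem_associatedPrimes_iff.1 hq
      have hqx : ∀ r, r ∈ q ↔ r • x = 0 := fun r => by
        rw [hx, ← Subtype.coe_inj]; rfl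
      have hpq : p ≤ q := fun r hr => by
        rw [hqx, ← hy, ← map_smul]
        obtain ⟨y, rfl⟩ := Ideal.Quotient.mk_surjective y
        have : r • Ideal.Quotient.mk p y = 0 := by
          rw [← Ideal.Quotient.mk_eq_mk, ← Submodule.Quotient.mk_smul,
            Submodule.Quotient.mk_eq_zero]
          exact Ideal.mul_mem_right _ _ hr
        rw [this, _root_.map_zero]
      have hzq : z ∈ q := hqp.mem_of_pow_mem k ((hqx _).2
        (Module.mem_annihilator.1 (QuotSMulTop.mem_annihilator _ _) x))
      have hlt : p < q := lt_of_le_of_ne hpq fun h => hzp (h ▸ hzq)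
      have hqN : q ∈ associatedPrimes R (QuotSMulTop (z ^ k) N) :=
        associatedPrimes.subset_of_injective (Submodule.subtype_injective _) hq
      have := ih (fun i hi => length_H_quot_ne_top (B := R) _ (hzk k) (hN i (by omega))
        (hN (i + 1) (by omega))) hqN (fun h => hqm h.ge) hqN hqp
      refine le_trans ?_ (ringKrullDim_quotient_add_one_le hlt)
      rw [Nat.cast_succ]
      gcongr
    · exfalso
      push Not at hk
      set L := Module.length R (H (maximalIdeal R) 0 N) + Module.length R (H (maximalIdeal R) 1 N)
      have hL : L ≠ ⊤ := WithTop.add_ne_top.2 ⟨hN 0 (by omega), hN 1 (by omega)⟩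
      have hlen (k : ℕ) : Module.length R (LinearMap.range (g k)) ≤ L :=
        (length_le_length_H_zero _ _ (hk k)).trans
          ((length_H_quot_le (B := R) _ (hzk k) 0 (hN 1 (by omega))).trans
            (add_le_add (cokerLength_le _ _ _) (cokerLength_le _ _ _)))
      obtain ⟨c, hc⟩ := Ideal.exists_pow_inf_eq_pow_smul (Ideal.span {z}) (LinearMap.range f)
      have hker (j : ℕ) : ∀ r ∈ LinearMap.ker (g (c + j)),
          r ∈ Ideal.span {Ideal.Quotient.mk p z ^ j} := by
        intro r hr
        have h1 : f r ∈ (z ^ (c + j) • ⊤ : Submodule R N) := by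
          simpa [g] using hr
        have h2 : f r ∈ Ideal.span {z} ^ (c + j) • (⊤ : Submodule R N) ⊓ LinearMap.range f := by
          refine ⟨?_, r, rfl⟩
          rwa [Ideal.span_singleton_pow, Submodule.ideal_span_singleton_smul]
        rw [hc _ (by omega), Nat.add_sub_cancel_left, Ideal.span_singleton_pow,
          Submodule.ideal_span_singleton_smul, Submodule.mem_smul_pointwise_iff_exists] at h2
        obtain ⟨_, ⟨-, r', rfl⟩, h3⟩ := h2
        rw [← map_smul] at h3
        rw [← hf h3, Ideal.mem_span_singleton']
        refine ⟨r', ?_⟩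
        rw [Algebra.smul_def, Ideal.Quotient.algebraMap_eq, _root_.map_pow, mul_comm]
      have hj (j : ℕ) : (j : ℕ∞) ≤ L := by
        have hzu : ¬ IsUnit (Ideal.Quotient.mk p z) := fun hu => by
          have : IsLocalHom (Ideal.Quotient.mk p) :=
            IsLocalHom.of_surjective _ Ideal.Quotient.mk_surjective
          exact (mem_maximalIdeal z).1 hzm (isUnit_of_map_unit (Ideal.Quotient.mk p) z hu)
        refine (natCast_le_length_quotient_pow (R := R) (z := Ideal.Quotient.mk p z)
          (by rwa [Ne, Ideal.Quotient.eq_zero_iff_mem]) hzu j).trans ?_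
        refine le_trans ?_ (hlen (c + j))
        rw [← (g (c + j)).quotKerEquivRange.length_eq]
        let π : (R ⧸ p) →ₗ[R] (R ⧸ p) ⧸ Ideal.span {Ideal.Quotient.mk p z ^ j} :=
          (Submodule.mkQ _).restrictScalars R
        have hπ : Function.Surjective π := fun x => by
          obtain ⟨x, rfl⟩ := Submodule.mkQ_surjective _ x
          exact ⟨x, rfl⟩
        have hle : LinearMap.ker (g (c + j)) ≤ LinearMap.ker π := fun r hr => by
          have := (Submodule.Quotient.mk_eq_zero _).2 (hker j r hr)
          exact this
        refine Module.length_le_of_surjective (Submodule.liftQ _ π hle) fun x => ?_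
        obtain ⟨x, rfl⟩ := hπ x
        exact ⟨Submodule.Quotient.mk x, rfl⟩
      obtain ⟨n, hn⟩ := ENat.ne_top_iff_exists.1 hL
      have := hj (n + 1)
      rw [← hn, Nat.cast_le] at this
      omega

end Ass

section Thickening
variable {R : Type u} [CommRing R] [IsNoetherianRing R] [IsLocalRing R]
  {B : Type u} [CommRing B] [Algebra R B] [IsNoetherianRing B] {ι : Type*} (T : ι → B) (x : ι → R)

/-- The ideal of an `R`-algebra generated by the maximal ideal of `R` and a family. -/
def bigIdeal : Ideal B := (maximalIdeal R).map (algebraMap R B) ⊔ Ideal.span (Set.range T)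

variable {T} in
lemma isPowTorsion_of_bigIdeal {P : Type*} [AddCommGroup P] [Module R P] [Module B P]
    [IsScalarTower R B P] (h : IsPowTorsion (bigIdeal (R := R) T) P) :
    IsPowTorsion (maximalIdeal R) P := fun v => by
  obtain ⟨k, hk⟩ := h v
  refine ⟨k, fun r hr => ?_⟩
  rw [← algebraMap_smul B]
  apply hk
  have h1 := Ideal.mem_map_of_mem (algebraMap R B) hr
  rw [Ideal.map_pow] at h1
  exact Ideal.pow_right_mono le_sup_left k h1

variable {T}

lemma isMaximal_bigIdeal (hB : ∀ b : B, ∃ r : R, b - algebraMap R B r ∈ Ideal.span (Set.range T))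
    (hJ : bigIdeal (R := R) T ≠ ⊤) : (bigIdeal (R := R) T).IsMaximal := by
  rw [Ideal.isMaximal_iff, ← Ideal.ne_top_iff_one]
  refine ⟨hJ, fun K b hK hb hbK => ?_⟩
  obtain ⟨r, hr⟩ := hB b
  have hr' : b - algebraMap R B r ∈ bigIdeal (R := R) T := Ideal.mem_sup_right hr
  have hrK : algebraMap R B r ∈ K := by simpa using K.sub_mem hbK (hK hr')
  by_cases hrm : r ∈ maximalIdeal R
  · have : algebraMap R B r ∈ bigIdeal (R := R) T :=
      Ideal.mem_sup_left (Ideal.mem_map_of_mem _ hrm)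
    exact (hb (by simpa using Ideal.add_mem _ hr' this)).elim
  · have hu : IsUnit r := by simpa using hrm
    exact (Ideal.eq_top_iff_one K).1 (Ideal.eq_top_of_isUnit_mem _ hrK (hu.map _))

lemma isPowTorsion_torsionBy_of_symbFin
    (hB : ∀ b : B, ∃ r : R, b - algebraMap R B r ∈ Ideal.span (Set.range T))
    (hx : ∀ i, x i ∈ maximalIdeal R) (i : ι) (l : List ι)
    {P : Type u} [AddCommGroup P] [Module R P] [Module B P] [IsScalarTower R B P]
    [Module.Finite R P] (hT : ∀ i, ∃ k, ∀ v : P, T i ^ k • v = 0)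
    (hH : ∀ j < l.length + 1, Module.length R (H (maximalIdeal R) j P) ≠ ⊤)
    (hP : SymbFin (bigIdeal (R := R) T) ((i :: l).map fun i => T i - algebraMap R B (x i)) P) :
    IsPowTorsion (maximalIdeal R) (Submodule.torsionBy B P (T i - algebraMap R B (x i))) := by
  have := hP.1
  by_contra hcon
  obtain ⟨q, hq, hqJ⟩ : ∃ q ∈ associatedPrimes B
      (Submodule.torsionBy B P (T i - algebraMap R B (x i))), ¬ bigIdeal (R := R) T ≤ q := by
    by_contra! h
    exact hcon (isPowTorsion_of_bigIdeal (isPowTorsion_of_associatedPrimes _ h))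
  obtain ⟨hqp, v, hv⟩ := mem_associatedPrimes_iff.1 hq
  have hTq : Ideal.span (Set.range T) ≤ q := by
    rw [Ideal.span_le]
    rintro _ ⟨j, rfl⟩
    obtain ⟨k, hk⟩ := hT j
    exact hqp.mem_of_pow_mem k ((hv _).2 (Subtype.ext (hk v.1)))
  set p := q.comap (algebraMap R B)
  have hpp : p.IsPrime := Ideal.comap_isPrime _ _
  have hp : p ∈ associatedPrimes R P := mem_associatedPrimes_iff.2 ⟨hpp, v.1, fun r => by
    rw [Ideal.mem_comap, hv, ← Subtype.coe_inj]
    simp⟩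
  have hpm : p ≠ maximalIdeal R := fun h => hqJ <| by
    refine sup_le ?_ hTq
    rw [Ideal.map_le_iff_le_comap]
    exact h.ge
  have h1 := le_ringKrullDim_of_mem_associatedPrimes (l.length + 1) hH hp hpm
  have h2 : ringKrullDim (R ⧸ p) ≤ (l.map x).length := by
    refine ringKrullDim_le_of_le_radical p _ (by simpa using fun j _ => hx j) ?_
    set K := Ideal.span {y | y ∈ l.map x}
    intro r hr
    have h3 : algebraMap R B r ∈ bigIdeal (R := R) T :=
      Ideal.mem_sup_left (Ideal.mem_map_of_mem _ hr)
    obtain ⟨k, hk⟩ := hP.2 h3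
    have h4 : ∀ b ∈ K.map (algebraMap R B), ∃ c ∈ K, b - algebraMap R B c ∈ q := by
      intro b hb
      induction hb using Submodule.span_induction with
      | mem b hb =>
        obtain ⟨c, hc, rfl⟩ := hb
        exact ⟨c, hc, by simp⟩
      | zero => exact ⟨0, K.zero_mem, by simp⟩
      | add b b' _ _ ih ih' =>
        obtain ⟨c, hc, hcb⟩ := ih
        obtain ⟨c', hc', hcb'⟩ := ih'
        refine ⟨c + c', K.add_mem hc hc', ?_⟩
        rw [_root_.map_add, add_sub_add_comm]
        exact q.add_mem hcb hcb'
      | smul a b _ ih =>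
        obtain ⟨c, hc, hcb⟩ := ih
        obtain ⟨s, hs⟩ := hB a
        refine ⟨s * c, K.mul_mem_left s hc, ?_⟩
        have : a • b - algebraMap R B (s * c) =
            a * (b - algebraMap R B c) + algebraMap R B c * (a - algebraMap R B s) := by
          rw [_root_.map_mul, smul_eq_mul]; ring
        rw [this]
        exact q.add_mem (q.mul_mem_left _ hcb) (q.mul_mem_left _ (hTq hs))
    have hyq : ∀ j, x j ∈ p ⊔ K → T j - algebraMap R B (x j) ∈ q ⊔ K.map (algebraMap R B) := by
      intro j hj
      refine Ideal.sub_mem _ (Ideal.mem_sup_left (hTq (Ideal.subset_span ⟨j, rfl⟩))) ?_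
      have := Ideal.mem_map_of_mem (algebraMap R B) hj
      rw [Ideal.map_sup] at this
      have hle : p.map (algebraMap R B) ≤ q := Ideal.map_le_iff_le_comap.2 le_rfl
      exact (sup_le_sup_right hle (K.map (algebraMap R B))) this
    have h5 : Module.annihilator B P ⊔ Ideal.span
        {y | y ∈ (i :: l).map fun i => T i - algebraMap R B (x i)} ≤
          q ⊔ K.map (algebraMap R B) := by
      refine sup_le ?_ (Ideal.span_le.2 ?_)
      · refine le_trans (fun b hb => ?_) le_sup_left
        rw [hv]
        exact Subtype.ext (Module.mem_annihilator.1 hb v.1)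
      · intro y hy
        obtain ⟨j, hj, rfl⟩ := List.mem_map.1 hy
        rcases List.mem_cons.1 hj with rfl | hj
        · exact Ideal.mem_sup_left ((hv _).2 (Submodule.smul_torsionBy _ v))
        · exact hyq j (Ideal.mem_sup_right (Ideal.subset_span (List.mem_map_of_mem hj)))
    obtain ⟨a, ha, b, hb, hab⟩ := Submodule.mem_sup.1 (h5 hk)
    obtain ⟨c, hc, hcb⟩ := h4 b hb
    refine ⟨k, ?_⟩
    have h6 : r ^ k - c ∈ p := by
      rw [Ideal.mem_comap, map_sub, _root_.map_pow, ← hab, add_sub_assoc]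
      exact q.add_mem ha hcb
    have h7 := Ideal.add_mem (p ⊔ K) (Ideal.mem_sup_left h6) (Ideal.mem_sup_right hc)
    rwa [sub_add_cancel] at h7
  have h3 := h1.trans h2
  rw [List.length_map, Nat.cast_le] at h3
  omega

lemma allTors_of_symbFin
    (hB : ∀ b : B, ∃ r : R, b - algebraMap R B r ∈ Ideal.span (Set.range T))
    (hx : ∀ i, x i ∈ maximalIdeal R) (l : List ι)
    {P : Type u} [AddCommGroup P] [Module R P] [Module B P] [IsScalarTower R B P]
    [Module.Finite R P] (hT : ∀ i, ∃ k, ∀ v : P, T i ^ k • v = 0)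
    (hH : ∀ j < l.length, Module.length R (H (maximalIdeal R) j P) ≠ ⊤)
    (hP : SymbFin (bigIdeal (R := R) T) (l.map fun i => T i - algebraMap R B (x i)) P) :
    AllTors (maximalIdeal R) (l.map fun i => T i - algebraMap R B (x i)) P := by
  induction l generalizing P with
  | nil => trivial
  | cons i l ih =>
    have h1 := isPowTorsion_torsionBy_of_symbFin x hB hx i l hT hH hP
    have : Module.Finite R (QuotSMulTop (T i - algebraMap R B (x i)) P) :=
      Module.Finite.of_surjective _ (quotMk_surjective (R := R) _)
    refine ⟨h1, ih (fun j => ?_) (fun j hj => length_H_quot_ne_top _ h1 (hH j ?_) (hH (j + 1) ?_))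
      hP.quot⟩
    · obtain ⟨k, hk⟩ := hT j
      refine ⟨k, fun v => ?_⟩
      obtain ⟨v, rfl⟩ := Submodule.mkQ_surjective _ v
      rw [← map_smul, hk, _root_.map_zero]
    · simp; omega
    · simpa using hj

end Thickening

section Thickening
variable {R : Type u} [CommRing R] [IsNoetherianRing R] [IsLocalRing R]
  {B : Type u} [CommRing B] [Algebra R B] [IsNoetherianRing B] {ι : Type*} {T : ι → B}

lemma symbFin_of_isPowTorsion {P : Type u} [AddCommGroup P] [Module R P] [Module B P]
    [IsScalarTower R B P] [Module.Finite R P] (hT : ∀ i, ∃ k, ∀ v : P, T i ^ k • v = 0)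
    (h : IsPowTorsion (maximalIdeal R) P) (ys : List B) :
    SymbFin (bigIdeal (R := R) T) ys P := by
  refine ⟨Module.Finite.of_restrictScalars_finite R B P,
    le_trans ?_ (Ideal.radical_mono le_sup_left)⟩
  refine sup_le ?_ (Ideal.span_le.2 ?_)
  · obtain ⟨k, hk⟩ := h.exists_pow_smul
    rw [Ideal.map_le_iff_le_comap]
    intro r hr
    refine ⟨k, Module.mem_annihilator.2 fun v => ?_⟩
    rw [← _root_.map_pow, algebraMap_smul]
    exact hk _ (Ideal.pow_mem_pow hr k) v
  · rintro _ ⟨i, rfl⟩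
    obtain ⟨k, hk⟩ := hT i
    exact ⟨k, Module.mem_annihilator.2 hk⟩

lemma length_quot_eq_symb_add_lastKer [(bigIdeal (R := R) T).IsMaximal] (y : B) (ys : List B)
    {P : Type u} [AddCommGroup P] [Module R P] [Module B P] [IsScalarTower R B P]
    [Module.Finite R P] (hT : ∀ i, ∃ k, ∀ v : P, T i ^ k • v = 0)
    (hP : AllTors (maximalIdeal R) (y :: ys) P) :
    ((Module.length B (P ⧸ (Ideal.ofList (y :: ys) • ⊤ : Submodule B P))).toNat : ℤ) =
      symb (y :: ys) P + (lastKer (y :: ys) P).toNat := by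
  induction ys generalizing P y with
  | nil =>
    have e := Submodule.quotOfListConsSMulTopEquivQuotSMulTopInner P y []
    have h0 : (Ideal.ofList ([] : List B) • ⊤ : Submodule B (QuotSMulTop y P)) = ⊥ := by simp
    rw [e.length_eq, (Submodule.quotEquivOfEqBot _ h0).length_eq]
    simp [symb, lastKer]
  | cons y' ys ih =>
    have : Module.Finite R (QuotSMulTop y P) :=
      Module.Finite.of_surjective _ (quotMk_surjective (R := R) _)
    have e := Submodule.quotOfListConsSMulTopEquivQuotSMulTopInner P y (y' :: ys)
    rw [e.length_eq, ih y' (fun j => ?_) hP.2]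
    · have : Module.Finite R (Submodule.torsionBy B P y) :=
        Module.Finite.of_injective ((Submodule.torsionBy B P y).subtype.restrictScalars R)
          (Submodule.subtype_injective _)
      have h0 : symb (y' :: ys) (Submodule.torsionBy B P y) = 0 := by
        refine symb_eq_zero_of_length_ne_top (symbFin_of_isPowTorsion (T := T) (fun j => ?_) hP.1 ys)
        obtain ⟨k, hk⟩ := hT j
        exact ⟨k, fun v => Subtype.ext (hk v.1)⟩
      have h1 : symb (y :: y' :: ys) P = symb (y' :: ys) (QuotSMulTop y P) -
        symb (y' :: ys) (Submodule.torsionBy B P y) := rfl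
      rw [h1, h0, sub_zero]
      rfl
    · obtain ⟨k, hk⟩ := hT j
      refine ⟨k, fun v => ?_⟩
      obtain ⟨v, rfl⟩ := Submodule.mkQ_surjective _ v
      rw [← map_smul, hk, _root_.map_zero]

end Thickening

section Monomial
variable (R : Type u) [CommRing R] (σ : Type) (M : Type u) [AddCommGroup M] [Module R M]

/-- Functions from monomials to a module, with the action of polynomials by multiplication. -/
def MonFun (R : Type u) [CommRing R] (σ : Type) (M : Type u) [AddCommGroup M] [Module R M] :
    Type u := (σ →₀ ℕ) → M

instance : AddCommGroup (MonFun R σ M) := inferInstanceAs (AddCommGroup ((σ →₀ ℕ) → M))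
instance : Module R (MonFun R σ M) := inferInstanceAs (Module R ((σ →₀ ℕ) → M))

open Classical in
/-- Multiplication by a monomial. -/
noncomputable def monShift : Multiplicative (σ →₀ ℕ) →* Module.End R (MonFun R σ M) where
  toFun a :=
    { toFun := fun f d => if a.toAdd ≤ d then f (d - a.toAdd) else 0
      map_add' := fun f g => by
        funext d
        change (if _ then f _ + g _ else 0) = (if _ then f _ else 0) + (if _ then g _ else 0)
        split_ifs <;> simp
      map_smul' := fun r f => by
        funext d
        change (if _ then r • f _ else 0) = r • (if _ then f _ else 0)
        split_ifs <;> simp }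
  map_one' := by
    ext f
    funext d
    change (if (0 : σ →₀ ℕ) ≤ d then f (d - 0) else 0) = f d
    rw [if_pos (zero_le (a := d)), tsub_zero]
  map_mul' a b := by
    ext f
    funext d
    change (if a.toAdd + b.toAdd ≤ d then f (d - (a.toAdd + b.toAdd)) else 0) =
      if a.toAdd ≤ d then (if b.toAdd ≤ d - a.toAdd then f (d - a.toAdd - b.toAdd) else 0) else 0
    by_cases h : a.toAdd ≤ d
    · rw [if_pos h, tsub_tsub]
      congr 1
      rw [le_tsub_iff_left h]
    · rw [if_neg h, if_neg fun h' => h (le_trans le_self_add h')]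

noncomputable instance : Module (MvPolynomial σ R) (MonFun R σ M) :=
  Module.compHom _ (AddMonoidAlgebra.lift R _ (σ →₀ ℕ) (monShift R σ M)).toRingHom

variable {R σ M}

lemma monomial_smul (a : σ →₀ ℕ) (r : R) (f : MonFun R σ M) :
    MvPolynomial.monomial a r • f = r • monShift R σ M (Multiplicative.ofAdd a) f := by
  change (AddMonoidAlgebra.lift R _ (σ →₀ ℕ) (monShift R σ M)) (AddMonoidAlgebra.single a r) f = _
  rw [AddMonoidAlgebra.lift_single]
  rfl

instance : IsScalarTower R (MvPolynomial σ R) (MonFun R σ M) :=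
  IsScalarTower.of_algebraMap_smul fun r f => by
    rw [MvPolynomial.algebraMap_eq, ← MvPolynomial.monomial_zero', monomial_smul, ofAdd_zero,
      _root_.map_one, Module.End.one_apply]

/-- Multiplication by a monomial with coefficient one. -/
lemma monomial_one_smul (a : σ →₀ ℕ) (f : MonFun R σ M) (d : σ →₀ ℕ) :
    (MvPolynomial.monomial a (1 : R) • f : MonFun R σ M) (a + d) = f d := by
  classical
  rw [monomial_smul, one_smul]
  change (if a ≤ a + d then f (a + d - a) else 0) = f d
  rw [if_pos le_self_add, add_tsub_cancel_left]

lemma monomial_one_smul_of_not_le {a d : σ →₀ ℕ} (f : MonFun R σ M) (h : ¬ a ≤ d) :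
    (MvPolynomial.monomial a (1 : R) • f : MonFun R σ M) d = 0 := by
  classical
  rw [monomial_smul, one_smul]
  exact if_neg h

variable (R σ M) in
/-- The functions vanishing on the monomials dividing an element of a given set. -/
def monKer (D : Finset (σ →₀ ℕ)) : Submodule (MvPolynomial σ R) (MonFun R σ M) where
  carrier := {f | ∀ d ∈ D, ∀ d' ≤ d, f d' = 0}
  zero_mem' := fun _ _ _ _ => rfl
  add_mem' := fun {f g} hf hg d hd d' hd' => by
    change f d' + g d' = 0
    rw [hf d hd d' hd', hg d hd d' hd', add_zero]
  smul_mem' := fun p f hf => by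
    induction p using MvPolynomial.induction_on' with
    | monomial a r =>
      intro d hd d' hd'
      rw [monomial_smul]
      change r • (if _ then f _ else 0) = (0 : M)
      split_ifs
      · rw [hf d hd _ (tsub_le_self.trans hd'), smul_zero]
      · rw [smul_zero]
    | add p q hp hq =>
      intro d hd d' hd'
      rw [add_smul]
      change (p • f) d' + (q • f) d' = 0
      rw [hp d hd d' hd', hq d hd d' hd', add_zero]

lemma mem_monKer {D : Finset (σ →₀ ℕ)} {f : MonFun R σ M} (hD : IsLowerSet (D : Set (σ →₀ ℕ))) :
    f ∈ monKer R σ M D ↔ ∀ d ∈ D, f d = 0 :=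
  ⟨fun h d hd => h d hd d le_rfl, fun h _ hd d' hd' => h d' (hD hd' hd)⟩

variable (R σ M) in
/-- The module `M` tensored with the polynomials modulo the monomials not dividing an element of
a given set. -/
abbrev MonQuot (D : Finset (σ →₀ ℕ)) : Type u := MonFun R σ M ⧸ monKer R σ M D

open Classical in
variable (R M) in
/-- The function supported at a single monomial. -/
noncomputable def monSingle (a : σ →₀ ℕ) : M →ₗ[R] MonFun R σ M :=
  LinearMap.single R (fun _ : σ →₀ ℕ => M) a

variable (R M) in
/-- Evaluation at a monomial. -/
def monEval (a : σ →₀ ℕ) : MonFun R σ M →ₗ[R] M := LinearMap.proj (φ := fun _ : σ →₀ ℕ => M) a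

lemma monEval_apply (a : σ →₀ ℕ) (f : MonFun R σ M) : monEval R M a f = f a := rfl

lemma monSingle_same (a : σ →₀ ℕ) (m : M) : monSingle R M a m a = m := by
  classical
  exact Pi.single_eq_same (M := fun _ : σ →₀ ℕ => M) a m

lemma monSingle_ne {a d : σ →₀ ℕ} (h : d ≠ a) (m : M) :
    monSingle R M a m d = 0 := by
  classical
  exact Pi.single_eq_of_ne (M := fun _ : σ →₀ ℕ => M) h m

lemma monomial_smul_monSingle (a b : σ →₀ ℕ) (m : M) :
    MvPolynomial.monomial a (1 : R) • monSingle R M b m = monSingle R M (a + b) m := by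
  funext d
  by_cases h : a ≤ d
  · obtain ⟨d, rfl⟩ := exists_add_of_le h
    rw [monomial_one_smul]
    by_cases h' : d = b
    · rw [h', monSingle_same, monSingle_same]
    · rw [monSingle_ne h', monSingle_ne (by simpa using h')]
  · rw [monomial_one_smul_of_not_le _ h, monSingle_ne]
    rintro rfl
    exact h le_self_add

lemma sub_sum_monSingle_mem {D : Finset (σ →₀ ℕ)} (hD : IsLowerSet (D : Set (σ →₀ ℕ)))
    (f : MonFun R σ M) : f - ∑ a ∈ D, monSingle R M a (f a) ∈ monKer R σ M D := by
  classical
  rw [mem_monKer hD]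
  intro d hd
  change f d - monEval R M d (∑ a ∈ D, monSingle R M a (f a)) = 0
  simp only [map_sum, monEval_apply]
  rw [Finset.sum_eq_single d (fun b _ hb => monSingle_ne hb.symm _)
    (fun h => (h hd).elim), monSingle_same, sub_self]

end Monomial

section Monomial
variable {R : Type u} [CommRing R] {σ : Type} {M : Type u} [AddCommGroup M] [Module R M]

variable (R M) in
/-- The class in `MonQuot` of a function supported at a single monomial. -/
noncomputable def monMk (D : Finset (σ →₀ ℕ)) (a : σ →₀ ℕ) : M →ₗ[R] MonQuot R σ M D :=
  ((monKer R σ M D).mkQ.restrictScalars R) ∘ₗ monSingle R M a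

lemma monomial_smul_monMk (D : Finset (σ →₀ ℕ)) (a b : σ →₀ ℕ) (m : M) :
    MvPolynomial.monomial a (1 : R) • monMk R M D b m = monMk R M D (a + b) m := by
  change _ • (monKer R σ M D).mkQ _ = (monKer R σ M D).mkQ _
  rw [← map_smul, monomial_smul_monSingle]

lemma X_smul_monMk (D : Finset (σ →₀ ℕ)) (i : σ) (b : σ →₀ ℕ) (m : M) :
    (MvPolynomial.X i : MvPolynomial σ R) • monMk R M D b m =
      monMk R M D (Finsupp.single i 1 + b) m :=
  monomial_smul_monMk D (Finsupp.single i 1) b m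

variable {D : Finset (σ →₀ ℕ)}

lemma monMk_eq_zero (hD : IsLowerSet (D : Set (σ →₀ ℕ))) {a : σ →₀ ℕ} (ha : a ∉ D) :
    monMk R M D a = 0 := by
  ext m
  refine (Submodule.Quotient.mk_eq_zero _).2 ((mem_monKer hD).2 fun d hd => monSingle_ne ?_ m)
  rintro rfl
  exact ha hd

lemma sum_monMk (hD : IsLowerSet (D : Set (σ →₀ ℕ))) (f : MonFun R σ M) :
    ∑ a ∈ D, monMk R M D a (f a) = (monKer R σ M D).mkQ f := by
  have h := (Submodule.Quotient.eq _).2 (sub_sum_monSingle_mem hD f)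
  change (monKer R σ M D).mkQ f = (monKer R σ M D).mkQ _ at h
  rw [h, map_sum]
  rfl

lemma finite_monQuot [Module.Finite R M] (hD : IsLowerSet (D : Set (σ →₀ ℕ))) :
    Module.Finite R (MonQuot R σ M D) := by
  let f : (D → M) →ₗ[R] MonQuot R σ M D :=
    ∑ a : D, monMk R M D a.1 ∘ₗ LinearMap.proj a
  refine Module.Finite.of_surjective f fun v => ?_
  obtain ⟨v, rfl⟩ := Submodule.mkQ_surjective _ v
  refine ⟨fun a => v a.1, ?_⟩
  rw [← sum_monMk hD, ← Finset.sum_coe_sort]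
  simp [f]

lemma X_pow_smul_monQuot (hD : IsLowerSet (D : Set (σ →₀ ℕ))) (i : σ) :
    ∃ k, ∀ v : MonQuot R σ M D, (MvPolynomial.X i : MvPolynomial σ R) ^ k • v = 0 := by
  refine ⟨D.sup (fun d => d i) + 1, fun v => ?_⟩
  obtain ⟨v, rfl⟩ := Submodule.mkQ_surjective _ v
  rw [← sum_monMk hD, Finset.smul_sum]
  refine Finset.sum_eq_zero fun a ha => ?_
  rw [MvPolynomial.X_pow_eq_monomial, monomial_smul_monMk, monMk_eq_zero hD, LinearMap.zero_apply]
  intro h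
  have h1 : (Finsupp.single i (D.sup (fun d => d i) + 1) + a) i ≤ D.sup (fun d => d i) :=
    Finset.le_sup (f := fun d : σ →₀ ℕ => d i) h
  rw [Finsupp.add_apply, Finsupp.single_eq_same] at h1
  omega

variable {J : Ideal (MvPolynomial σ R)} {ys : List (MvPolynomial σ R)}

lemma symb_monQuot [IsNoetherianRing R] [Finite σ] [J.IsMaximal]
    (hD : IsLowerSet (D : Set (σ →₀ ℕ)))
    (h : SymbFin J ys (MonQuot R σ M D)) :
    symb ys (MonQuot R σ M D) = D.card * symb ys (MonQuot R σ M {0}) := by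
  classical
  induction hn : D.card generalizing D with
  | zero =>
    obtain rfl := Finset.card_eq_zero.1 hn
    have : Subsingleton (MonQuot R σ M ∅) := by
      rw [Submodule.Quotient.subsingleton_iff, eq_top_iff]
      exact fun f _ d hd => absurd hd (Finset.notMem_empty d)
    rw [symb_eq_zero_of_subsingleton]
    simp
  | succ n ih =>
    obtain ⟨d, hdD, hd⟩ := D.exists_maximal (Finset.card_pos.1 (by omega))
    have hd' : ∀ e ∈ D, d ≤ e → e = d := fun e he hde => le_antisymm (hd he hde) hde
    have hlow : IsLowerSet ((D.erase d : Finset _) : Set (σ →₀ ℕ)) := by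
      intro a b hba ha
      rw [SetLike.mem_coe, Finset.mem_erase] at ha ⊢
      exact ⟨fun hb => ha.1 (hd' a ha.2 (hb ▸ hba)), hD hba ha.2⟩
    have h0 : IsLowerSet (({0} : Finset (σ →₀ ℕ)) : Set (σ →₀ ℕ)) := by
      intro a b hba ha
      simp only [Finset.coe_singleton, Set.mem_singleton_iff] at ha ⊢
      exact le_antisymm (ha ▸ hba) (zero_le (a := b))
    let f : MonQuot R σ M {0} →ₗ[MvPolynomial σ R] MonQuot R σ M D :=
      Submodule.mapQ _ _ (LinearMap.lsmul _ _ (MvPolynomial.monomial d (1 : R))) (by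
        intro v hv
        rw [mem_monKer h0] at hv
        rw [Submodule.mem_comap, mem_monKer hD]
        intro e he
        by_cases hde : d ≤ e
        · rw [hd' e he hde]
          have := monomial_one_smul d v 0
          rw [add_zero] at this
          exact this.trans (hv 0 (Finset.mem_singleton_self _))
        · exact monomial_one_smul_of_not_le v hde)
    let g : MonQuot R σ M D →ₗ[MvPolynomial σ R] MonQuot R σ M (D.erase d) :=
      Submodule.mapQ _ _ LinearMap.id (fun v hv => (mem_monKer hlow).2 fun e he =>
        (mem_monKer hD).1 hv e (Finset.mem_of_mem_erase he))
    have hf : Function.Injective f := by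
      rw [← LinearMap.ker_eq_bot, eq_bot_iff]
      intro v hv
      obtain ⟨v, rfl⟩ := Submodule.mkQ_surjective _ v
      have h1 := (mem_monKer hD).1 ((Submodule.Quotient.mk_eq_zero _).1 hv) d hdD
      refine (Submodule.Quotient.mk_eq_zero _).2 ((mem_monKer h0).2 fun e he => ?_)
      rw [Finset.mem_singleton.1 he]
      have := monomial_one_smul d v 0
      rw [add_zero] at this
      exact this.symm.trans h1
    have hg : Function.Surjective g := fun v => by
      obtain ⟨v, rfl⟩ := Submodule.mkQ_surjective _ v
      exact ⟨(monKer R σ M D).mkQ v, rfl⟩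
    have hfg : Function.Exact f g := by
      intro v
      obtain ⟨v, rfl⟩ := Submodule.mkQ_surjective _ v
      constructor
      · intro hv
        have h1 := (mem_monKer hlow).1 ((Submodule.Quotient.mk_eq_zero _).1 hv)
        refine ⟨monMk R M {0} 0 (v d), ?_⟩
        have h2 : f (monMk R M {0} 0 (v d)) = monMk R M D (d + 0) (v d) :=
          monomial_smul_monMk D d 0 (v d)
        rw [h2, ← sum_monMk hD, add_zero, Finset.sum_eq_single d]
        · intro e he hed
          have : v e = 0 := h1 e (Finset.mem_erase.2 ⟨hed, he⟩)
          rw [this, _root_.map_zero]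
        · exact fun h => (h hdD).elim
      · rintro ⟨w, hw⟩
        obtain ⟨w, rfl⟩ := Submodule.mkQ_surjective _ w
        rw [← hw]
        refine (Submodule.Quotient.mk_eq_zero _).2 ((mem_monKer hlow).2 fun e he => ?_)
        refine monomial_one_smul_of_not_le w fun hde => ?_
        rw [Finset.mem_erase] at he
        exact he.1 (hd' e he.2 hde)
    rw [symb_eq_add_of_exact f g hf hg hfg h, ih hlow (h.of_surjective g hg)
      (by rw [Finset.card_erase_of_mem hdD, hn]; rfl)]
    push_cast
    ring

end Monomial

section Degree
variable {σ : Type} [DecidableEq σ]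

/-- The monomials of degree at most `n` in the variables of a finite set. -/
noncomputable def monSet (E : Finset σ) (n : ℕ) : Finset (σ →₀ ℕ) :=
  (Finset.range (n + 1)).biUnion fun k => E.finsuppAntidiag k

lemma mem_monSet {E : Finset σ} {n : ℕ} {a : σ →₀ ℕ} :
    a ∈ monSet E n ↔ a.degree ≤ n ∧ a.support ⊆ E := by
  simp only [monSet, Finset.mem_biUnion, Finset.mem_range, Finset.mem_finsuppAntidiag]
  constructor
  · rintro ⟨k, hk, rfl, h⟩
    rw [Finsupp.degree_apply, Finset.sum_subset h fun i _ hi => Finsupp.notMem_support_iff.1 hi]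
    exact ⟨Nat.lt_succ_iff.1 hk, h⟩
  · rintro ⟨h1, h⟩
    rw [Finsupp.degree_apply, Finset.sum_subset h fun i _ hi => Finsupp.notMem_support_iff.1 hi] at h1
    exact ⟨_, Nat.lt_succ_iff.2 h1, rfl, h⟩

lemma isLowerSet_monSet (E : Finset σ) (n : ℕ) :
    IsLowerSet (monSet E n : Set (σ →₀ ℕ)) := by
  intro a b hba ha
  rw [SetLike.mem_coe, mem_monSet] at ha ⊢
  exact ⟨(Finsupp.degree_mono hba).trans ha.1, (Finsupp.support_mono hba).trans ha.2⟩

lemma card_monSet (E : Finset σ) (n : ℕ) :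
    (monSet E n).card = (n + E.card).choose E.card := by
  rw [monSet, Finset.card_biUnion]
  · simp only [Finset.card_finsuppAntidiag_nat_eq_multichoose]
    have h : ∀ n e : ℕ, ∑ k ∈ Finset.range (n + 1), e.multichoose k = (e + 1).multichoose n := by
      intro n e
      induction n with
      | zero => simp
      | succ n ih => rw [Finset.sum_range_succ, ih, Nat.multichoose_succ_succ, add_comm]
    rw [h, Nat.multichoose_eq, add_right_comm, Nat.add_sub_cancel, add_comm n]
    exact Nat.choose_symm_of_eq_add (by omega)
  · intro k _ l _ hkl
    rw [Function.onFun, Finset.disjoint_left]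
    intro a ha hb
    rw [Finset.mem_finsuppAntidiag] at ha hb
    exact hkl (ha.1.symm.trans hb.1)

end Degree

section Monomial
variable {R : Type u} [CommRing R] {σ : Type} {M : Type u} [AddCommGroup M] [Module R M]

lemma sub_constantCoeff_mem_span (b : MvPolynomial σ R) :
    ∃ r : R, b - algebraMap R _ r ∈
      Ideal.span (Set.range (MvPolynomial.X : σ → MvPolynomial σ R)) := by
  induction b using MvPolynomial.induction_on with
  | C a => exact ⟨a, by rw [MvPolynomial.algebraMap_eq, sub_self]; exact zero_mem _⟩
  | add p q hp hq =>
    obtain ⟨r, hr⟩ := hp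
    obtain ⟨s, hs⟩ := hq
    refine ⟨r + s, ?_⟩
    rw [_root_.map_add, add_sub_add_comm]
    exact add_mem hr hs
  | mul_X p i _ =>
    refine ⟨0, ?_⟩
    rw [_root_.map_zero, sub_zero]
    exact Ideal.mul_mem_left _ _ (Ideal.subset_span ⟨i, rfl⟩)

instance isMaximal_bigIdeal_X [IsNoetherianRing R] [Finite σ] [IsLocalRing R] :
    (bigIdeal (R := R) (MvPolynomial.X : σ → MvPolynomial σ R)).IsMaximal := by
  refine isMaximal_bigIdeal sub_constantCoeff_mem_span fun h => ?_
  let f : MvPolynomial σ R →+* ResidueField R := (residue R).comp MvPolynomial.constantCoeff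
  have h1 : bigIdeal (R := R) (MvPolynomial.X : σ → MvPolynomial σ R) ≤ RingHom.ker f := by
    refine sup_le ?_ (Ideal.span_le.2 ?_)
    · rw [Ideal.map_le_iff_le_comap]
      intro r hr
      rw [Ideal.mem_comap, RingHom.mem_ker, MvPolynomial.algebraMap_eq]
      simp only [f, RingHom.comp_apply, MvPolynomial.constantCoeff_C]
      exact (residue_eq_zero_iff r).2 hr
    · rintro _ ⟨i, rfl⟩
      rw [SetLike.mem_coe, RingHom.mem_ker]
      simp [f]
  rw [h, top_le_iff] at h1
  exact RingHom.ker_ne_top f h1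

variable {D : Finset (σ →₀ ℕ)} {x : σ → R} {l : List σ}

variable (x l) in
/-- The list of the elements `X i - x i`. -/
noncomputable abbrev subList : List (MvPolynomial σ R) :=
  l.map fun i => MvPolynomial.X i - algebraMap R (MvPolynomial σ R) (x i)

lemma symbFin_monQuot [IsLocalRing R] [Module.Finite R M]
    (hD : IsLowerSet (D : Set (σ →₀ ℕ))) (hl : ∀ i, i ∈ l)
    (h : maximalIdeal R ≤ (Module.annihilator R M ⊔ Ideal.span (Set.range x)).radical) :
    SymbFin (bigIdeal (R := R) (MvPolynomial.X : σ → MvPolynomial σ R)) (subList x l)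
      (MonQuot R σ M D) := by
  have := finite_monQuot (R := R) (M := M) hD
  refine ⟨Module.Finite.of_restrictScalars_finite R _ _, ?_⟩
  set K := (Module.annihilator (MvPolynomial σ R) (MonQuot R σ M D) ⊔
    Ideal.span {y | y ∈ subList x l}).radical
  have hK : (Module.annihilator (MvPolynomial σ R) (MonQuot R σ M D) ⊔
    Ideal.span {y | y ∈ subList x l}) ≤ K := Ideal.le_radical
  have hX : ∀ i, (MvPolynomial.X i : MvPolynomial σ R) ∈ K := fun i => by
    obtain ⟨k, hk⟩ := X_pow_smul_monQuot (R := R) (M := M) hD i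
    exact ⟨k, Ideal.mem_sup_left (Module.mem_annihilator.2 hk)⟩
  refine sup_le ?_ (Ideal.span_le.2 (by rintro _ ⟨i, rfl⟩; exact hX i))
  rw [Ideal.map_le_iff_le_comap]
  have h1 : Module.annihilator R M ⊔ Ideal.span (Set.range x) ≤ K.comap (algebraMap R _) := by
    refine sup_le ?_ (Ideal.span_le.2 ?_)
    · intro r hr
      refine hK (Ideal.mem_sup_left (Module.mem_annihilator.2 fun v => ?_))
      obtain ⟨v, rfl⟩ := Submodule.mkQ_surjective _ v
      rw [algebraMap_smul, ← sum_monMk hD, Finset.smul_sum]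
      refine Finset.sum_eq_zero fun a _ => ?_
      rw [← map_smul, Module.mem_annihilator.1 hr, _root_.map_zero]
    · rintro _ ⟨i, rfl⟩
      have h2 : MvPolynomial.X i - algebraMap R (MvPolynomial σ R) (x i) ∈ K :=
        hK (Ideal.mem_sup_right (Ideal.subset_span (List.mem_map.2 ⟨i, hl i, rfl⟩)))
      have := K.sub_mem (hX i) h2
      rwa [sub_sub_cancel] at this
  intro r hr
  obtain ⟨k, hk⟩ := h hr
  have := h1 hk
  rw [Ideal.mem_comap, _root_.map_pow] at this
  exact (Ideal.radical_isRadical _) ⟨k, this⟩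

lemma length_eq_length_of_forall_smul {B V : Type*} [CommRing B] [Algebra R B] [AddCommGroup V]
    [Module R V] [Module B V] [IsScalarTower R B V]
    (h : ∀ b : B, ∃ r : R, ∀ v : V, b • v = r • v) : Module.length B V = Module.length R V := by
  let e : Submodule B V ≃o Submodule R V :=
    { toFun := fun p => p.restrictScalars R
      invFun := fun p =>
        { p with
          smul_mem' := fun b v hv => by
            obtain ⟨r, hr⟩ := h b
            rw [hr v]
            exact p.smul_mem r hv }
      left_inv := fun p => rfl
      right_inv := fun p => rfl
      map_rel_iff' := Iff.rfl }
  rw [← WithBot.coe_inj, Module.coe_length, Module.coe_length]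
  exact Order.krullDim_eq_of_orderIso e


section Quot
variable [Fintype σ] [DecidableEq σ] (n : ℕ)

variable (x) in
/-- Evaluation of polynomial-like functions at a family of elements of the ring. -/
noncomputable def monSum (D : Finset (σ →₀ ℕ)) : MonFun R σ M →ₗ[R] M :=
  ∑ a ∈ D, (∏ i, x i ^ a i) • monEval R M a

lemma monSum_apply (f : MonFun R σ M) : monSum x D f = ∑ a ∈ D, (∏ i, x i ^ a i) • f a := by
  simp [monSum, monEval_apply]

lemma monSum_monSingle (D : Finset (σ →₀ ℕ)) (b : σ →₀ ℕ) (m : M) :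
    monSum x D (monSingle R M b m) = if b ∈ D then (∏ i, x i ^ b i) • m else 0 := by
  rw [monSum_apply]
  split_ifs with h
  · rw [Finset.sum_eq_single b, monSingle_same]
    · intro a _ hab
      rw [monSingle_ne hab, smul_zero]
    · exact fun h' => (h' h).elim
  · refine Finset.sum_eq_zero fun a ha => ?_
    rw [monSingle_ne, smul_zero]
    rintro rfl
    exact h ha

lemma prod_pow_mem (a : σ →₀ ℕ) : ∏ i, x i ^ a i ∈ Ideal.span (Set.range x) ^ a.degree := by
  rw [Finsupp.degree_eq_sum, ← Finset.prod_pow_eq_pow_sum]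
  refine Ideal.prod_mem_prod fun i _ => Ideal.pow_mem_pow (Ideal.subset_span ?_) _
  exact ⟨i, rfl⟩

variable (x) in
/-- The map `MonQuot → M / Q ^ (n + 1) M` induced by evaluation. -/
noncomputable def monQuotSum : MonQuot R σ M (monSet Finset.univ n) →ₗ[R]
    M ⧸ (Ideal.span (Set.range x) ^ (n + 1) • ⊤ : Submodule R M) :=
  Submodule.liftQ ((monKer R σ M (monSet Finset.univ n)).restrictScalars R)
    (Submodule.mkQ _ ∘ₗ monSum x (monSet Finset.univ n)) (by
      intro f hf
      have hf := (mem_monKer (isLowerSet_monSet _ _)).1 hf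
      rw [LinearMap.mem_ker, LinearMap.comp_apply, monSum_apply, Finset.sum_eq_zero,
        _root_.map_zero]
      intro a ha
      rw [hf a ha, smul_zero])

lemma monQuotSum_monMk (b : σ →₀ ℕ) (m : M) :
    monQuotSum x n (monMk R M _ b m) = (∏ i, x i ^ b i) • Submodule.mkQ _ m := by
  change Submodule.mkQ _ (monSum x _ (monSingle R M b m)) = _
  rw [monSum_monSingle]
  split_ifs with h
  · rw [map_smul]
  · rw [_root_.map_zero, ← map_smul]
    refine ((Submodule.Quotient.mk_eq_zero _).2 (Submodule.smul_mem_smul ?_ Submodule.mem_top)).symm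
    refine Ideal.pow_le_pow_right ?_ (prod_pow_mem b)
    rw [mem_monSet] at h
    by_contra h'
    exact h ⟨by omega, Finset.subset_univ _⟩

lemma monQuotSum_smul (b : MvPolynomial σ R) (v : MonQuot R σ M (monSet Finset.univ n)) :
    monQuotSum x n (b • v) = MvPolynomial.aeval x b • monQuotSum x n v := by
  induction b using MvPolynomial.induction_on generalizing v with
  | C a =>
    rw [← MvPolynomial.algebraMap_eq, algebraMap_smul, map_smul, AlgHom.commutes]
    rfl
  | add p q hp hq => rw [add_smul, _root_.map_add, hp, hq, _root_.map_add, add_smul]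
  | mul_X p i hp =>
    rw [mul_smul, hp, _root_.map_mul, mul_smul]
    congr 1
    obtain ⟨v, rfl⟩ := Submodule.mkQ_surjective _ v
    rw [← sum_monMk (isLowerSet_monSet _ _), Finset.smul_sum, map_sum, map_sum, Finset.smul_sum]
    refine Finset.sum_congr rfl fun a _ => ?_
    rw [X_smul_monMk, monQuotSum_monMk, monQuotSum_monMk, smul_smul, MvPolynomial.aeval_X]
    congr 1
    simp only [Finsupp.add_apply, pow_add, Finset.prod_mul_distrib]
    congr 1
    rw [Finset.prod_eq_single i]
    · simp
    · intro j _ hj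
      rw [Finsupp.single_eq_of_ne hj, pow_zero]
    · simp

lemma smul_eq_aeval_smul {V : Type*} [AddCommGroup V] [Module R V] [Module (MvPolynomial σ R) V]
    [IsScalarTower R (MvPolynomial σ R) V]
    (h : ∀ i, ∀ v : V, (MvPolynomial.X i : MvPolynomial σ R) • v = x i • v)
    (b : MvPolynomial σ R) (v : V) : b • v = MvPolynomial.aeval x b • v := by
  induction b using MvPolynomial.induction_on generalizing v with
  | C a =>
    rw [← MvPolynomial.algebraMap_eq, algebraMap_smul, AlgHom.commutes]
    rfl
  | add p q hp hq => rw [add_smul, hp, hq, _root_.map_add, add_smul]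
  | mul_X p i hp =>
    rw [mul_smul, hp, h, _root_.map_mul, mul_smul, MvPolynomial.aeval_X]

lemma smul_monQuot_eq_zero {b : MvPolynomial σ R} (hb : b ∈ MvPolynomial.idealOfVars σ R ^ (n + 1))
    (v : MonQuot R σ M (monSet Finset.univ n)) : b • v = 0 := by
  rw [MvPolynomial.pow_idealOfVars_eq_span] at hb
  induction hb using Submodule.span_induction with
  | mem b hb =>
    obtain ⟨a, ha, rfl⟩ := hb
    obtain ⟨v, rfl⟩ := Submodule.mkQ_surjective _ v
    rw [← sum_monMk (isLowerSet_monSet _ _), Finset.smul_sum]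
    refine Finset.sum_eq_zero fun c _ => ?_
    rw [monomial_smul_monMk, monMk_eq_zero (isLowerSet_monSet _ _), LinearMap.zero_apply]
    rw [mem_monSet, _root_.map_add]
    have : a.degree = n + 1 := ha
    omega
  | zero => rw [zero_smul]
  | add b c _ _ hb hc => rw [add_smul, hb, hc, add_zero]
  | smul b c _ hc => rw [smul_assoc, hc, smul_zero]

lemma length_monQuot_quot (hl : ∀ i, i ∈ l) :
    Module.length (MvPolynomial σ R)
      (MonQuot R σ M (monSet Finset.univ n) ⧸ (Ideal.ofList (subList x l) • ⊤ :
        Submodule (MvPolynomial σ R) (MonQuot R σ M (monSet Finset.univ n)))) =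
      Module.length R (M ⧸ (Ideal.span (Set.range x) ^ (n + 1) • ⊤ : Submodule R M)) := by
  set D := monSet (Finset.univ : Finset σ) n
  have hD : IsLowerSet (D : Set (σ →₀ ℕ)) := isLowerSet_monSet _ _
  set K : Submodule (MvPolynomial σ R) (MonQuot R σ M D) := Ideal.ofList (subList x l) • ⊤
  have hX : ∀ i, ∀ v : MonQuot R σ M D ⧸ K,
      (MvPolynomial.X i : MvPolynomial σ R) • v = x i • v := by
    intro i v
    obtain ⟨v, rfl⟩ := Submodule.mkQ_surjective _ v
    rw [← algebraMap_smul (MvPolynomial σ R) (x i), ← sub_eq_zero, ← sub_smul, ← map_smul]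
    refine (Submodule.Quotient.mk_eq_zero _).2 (Submodule.smul_mem_smul (Ideal.subset_span ?_)
      trivial)
    exact List.mem_map.2 ⟨i, hl i, rfl⟩
  have hsm := smul_eq_aeval_smul hX
  rw [length_eq_length_of_forall_smul (R := R) fun b => ⟨_, hsm b⟩]
  let ψ : M →ₗ[R] MonQuot R σ M D ⧸ K := K.mkQ.restrictScalars R ∘ₗ monMk R M D 0
  have hψ : Function.Surjective ψ := by
    intro v
    obtain ⟨v, rfl⟩ := Submodule.mkQ_surjective _ v
    obtain ⟨v, rfl⟩ := Submodule.mkQ_surjective _ v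
    refine ⟨∑ a ∈ D, MvPolynomial.aeval x (MvPolynomial.monomial a (1 : R)) • v a, ?_⟩
    rw [← sum_monMk hD, map_sum, map_sum]
    refine Finset.sum_congr rfl fun a _ => ?_
    rw [map_smul, ← hsm]
    change _ • K.mkQ (monMk R M D 0 (v a)) = K.mkQ _
    rw [← map_smul, monomial_smul_monMk, add_zero]
  have hker : LinearMap.ker ψ = Ideal.span (Set.range x) ^ (n + 1) • ⊤ := by
    refine le_antisymm (fun m hm => ?_) (Submodule.smul_le.2 fun q hq m _ => ?_)
    · have h1 : ∀ v ∈ K, monQuotSum x n v = 0 := by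
        intro v hv
        induction hv using Submodule.smul_induction_on' with
        | smul b hb v _ =>
          have h2 : Ideal.ofList (subList x l) ≤ RingHom.ker (MvPolynomial.aeval x) := by
            refine Ideal.span_le.2 fun y hy => ?_
            obtain ⟨i, _, rfl⟩ := List.mem_map.1 hy
            simp
          rw [monQuotSum_smul, (RingHom.mem_ker).1 (h2 hb), zero_smul]
        | add v _ w _ hv hw => rw [_root_.map_add, hv, hw, add_zero]
      have h2 := h1 _ ((Submodule.Quotient.mk_eq_zero K).1 hm)
      rw [monQuotSum_monMk] at h2
      simp only [Finsupp.coe_zero, Pi.zero_apply, pow_zero, Finset.prod_const_one, one_smul] at h2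
      exact (Submodule.Quotient.mk_eq_zero _).1 h2
    · have h1 : (MvPolynomial.idealOfVars σ R ^ (n + 1)).map (MvPolynomial.aeval x) =
          Ideal.span (Set.range x) ^ (n + 1) := by
        rw [Ideal.map_pow, MvPolynomial.idealOfVars, Ideal.map_span, ← Set.range_comp]
        congr 3
        ext i
        simp
      rw [← h1, Ideal.mem_map_iff_of_surjective _ fun r => ⟨algebraMap R _ r, by simp⟩] at hq
      obtain ⟨b, hb, rfl⟩ := hq
      rw [LinearMap.mem_ker, map_smul, ← hsm]
      change b • K.mkQ (monMk R M D 0 m) = 0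
      rw [← map_smul, smul_monQuot_eq_zero n hb, _root_.map_zero]
  rw [← hker]
  exact (ψ.quotKerEquivOfSurjective hψ).length_eq.symm

end Quot

end Monomial

section Monomial
variable {R : Type u} [CommRing R] [IsNoetherianRing R] {σ : Type} {M : Type u} [AddCommGroup M]
  [Module R M] (I : Ideal R) (x : σ → R)

/-- Evaluation at a monomial on `MonQuot`. -/
noncomputable def monQuotEval {D : Finset (σ →₀ ℕ)} (a : σ →₀ ℕ) (ha : a ∈ D) : MonQuot R σ M D →ₗ[R] M :=
  Submodule.liftQ ((monKer R σ M D).restrictScalars R) (monEval R M a)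
    fun _ hf => hf a ha a le_rfl

lemma sum_monMk_comp_eval {D : Finset (σ →₀ ℕ)} (hD : IsLowerSet (D : Set (σ →₀ ℕ))) :
    ∑ a : D, monMk R M D a.1 ∘ₗ monQuotEval a.1 a.2 = LinearMap.id := by
  refine LinearMap.ext fun v => ?_
  obtain ⟨v, rfl⟩ := Submodule.mkQ_surjective _ v
  rw [LinearMap.sum_apply, LinearMap.id_apply]
  refine Eq.trans ?_ (sum_monMk (R := R) hD v)
  rw [← Finset.sum_coe_sort D]
  exact Finset.sum_congr rfl fun a _ => rfl

lemma H.map_sum {A A' : Type u} [AddCommGroup A] [Module R A] [AddCommGroup A'] [Module R A']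
    {ι : Type*} (s : Finset ι) (f : ι → A →ₗ[R] A') (n : ℕ) :
    H.map I n (∑ i ∈ s, f i) = ∑ i ∈ s, H.map I n (f i) := by
  classical
  induction s using Finset.induction_on with
  | empty => simp [H.map_zero]
  | insert i s hi ih => rw [Finset.sum_insert hi, Finset.sum_insert hi, H.map_add, ih]

lemma iSup_range_map_monMk {D : Finset (σ →₀ ℕ)} (hD : IsLowerSet (D : Set (σ →₀ ℕ))) (n : ℕ) :
    ⨆ a ∈ D, LinearMap.range (H.map I n (monMk R M D a)) = ⊤ := by
  rw [eq_top_iff]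
  intro v _
  have h1 : v = H.map I n (LinearMap.id) v := by rw [H.map_id]; rfl
  rw [h1, ← sum_monMk_comp_eval hD, H.map_sum, LinearMap.sum_apply]
  refine Submodule.sum_mem _ fun a _ => ?_
  rw [H.map_comp]
  exact Submodule.mem_iSup_of_mem a.1 (Submodule.mem_iSup_of_mem a.2 ⟨_, rfl⟩)

/-- The `R`-linear action of `X j - x j` on `MonQuot`. -/
noncomputable abbrev subAct (D : Finset (σ →₀ ℕ)) (j : σ) :
    MonQuot R σ M D →ₗ[R] MonQuot R σ M D :=
  act R (MvPolynomial.X j - algebraMap R (MvPolynomial σ R) (x j)) (MonQuot R σ M D)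

lemma subAct_comp_monMk (D : Finset (σ →₀ ℕ)) (j : σ) (b : σ →₀ ℕ) :
    subAct x D j ∘ₗ monMk R M D b + x j • monMk R M D b =
      monMk R M D (Finsupp.single j 1 + b) := by
  ext m
  rw [LinearMap.add_apply, LinearMap.comp_apply, ← X_smul_monMk]
  change (MvPolynomial.X j - algebraMap R (MvPolynomial σ R) (x j)) • monMk R M D b m +
    x j • monMk R M D b m = _
  rw [sub_smul, algebraMap_smul, sub_add_cancel]

variable [DecidableEq σ] [Fintype σ]

lemma iSup_range_subAct_sup (E : Finset σ) (d n : ℕ) :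
    (⨆ j ∈ Finset.univ \ E,
      LinearMap.range (H.map I n (subAct (M := M) x (monSet Finset.univ d) j))) ⊔
      ⨆ a ∈ monSet E d, LinearMap.range (H.map I n (monMk R M (monSet Finset.univ d) a)) = ⊤ := by
  set D := monSet (Finset.univ : Finset σ) d
  have hD : IsLowerSet (D : Set (σ →₀ ℕ)) := isLowerSet_monSet _ _
  set K := ⨆ j ∈ Finset.univ \ E, LinearMap.range (H.map I n (subAct (M := M) x D j))
  set L := ⨆ a ∈ monSet E d, LinearMap.range (H.map I n (monMk R M D a))
  have key : ∀ k, ∀ a : σ →₀ ℕ, a.degree = k →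
      LinearMap.range (H.map I n (monMk R M D a)) ≤ K ⊔ L := by
    intro k
    induction k with
    | zero =>
      intro a ha
      obtain rfl : a = 0 := (Finsupp.degree_eq_zero_iff a).1 ha
      refine le_sup_of_le_right (le_iSup₂_of_le 0 ?_ le_rfl)
      rw [mem_monSet]
      simp
    | succ k ih =>
      intro a ha
      by_cases haD : a ∈ D
      swap
      · rw [monMk_eq_zero hD haD, H.map_zero, LinearMap.range_zero]
        exact bot_le
      by_cases haE : a.support ⊆ E
      · exact le_sup_of_le_right (le_iSup₂_of_le a (mem_monSet.2 ⟨(mem_monSet.1 haD).1, haE⟩) le_rfl)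
      · obtain ⟨j, hja, hjE⟩ := Finset.not_subset.1 haE
        have hle : Finsupp.single j 1 ≤ a := by
          rw [Finsupp.single_le_iff]
          exact Nat.one_le_iff_ne_zero.2 (Finsupp.mem_support_iff.1 hja)
        obtain ⟨b, rfl⟩ := exists_add_of_le hle
        have hb : b.degree = k := by
          rw [_root_.map_add, Finsupp.degree_single] at ha
          omega
        rw [← subAct_comp_monMk, H.map_add, H.map_smul, H.map_comp]
        rintro _ ⟨v, rfl⟩
        refine add_mem (Submodule.mem_sup_left ?_) (ih b hb ⟨x j • v, ?_⟩)
        · exact Submodule.mem_iSup_of_mem j (Submodule.mem_iSup_of_mem (by simpa using hjE) ⟨_, rfl⟩)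
        · rw [map_smul]
          rfl
  rw [eq_top_iff, ← iSup_range_map_monMk I hD]
  exact iSup₂_le fun a _ => key _ a rfl

lemma length_quot_le_of_iSup_range {A V : Type u} [AddCommGroup A] [Module R A] [AddCommGroup V]
    [Module R V] {ι : Type*} (S : Finset ι) (f : ι → A →ₗ[R] V) (K : Submodule R V)
    (h : K ⊔ ⨆ a ∈ S, LinearMap.range (f a) = ⊤) :
    Module.length R (V ⧸ K) ≤ S.card * Module.length R A := by
  let g : (S → A) →ₗ[R] V ⧸ K := K.mkQ ∘ₗ ∑ a : S, f a.1 ∘ₗ LinearMap.proj a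
  have hg : Function.Surjective g := by
    rw [← LinearMap.range_eq_top, eq_top_iff]
    intro v _
    obtain ⟨v, rfl⟩ := K.mkQ_surjective v
    have hv : v ∈ K ⊔ ⨆ a ∈ S, LinearMap.range (f a) := h ▸ Submodule.mem_top
    have h2 : K ⊔ ⨆ a ∈ S, LinearMap.range (f a) ≤ (LinearMap.range g).comap K.mkQ := by
      refine sup_le (fun w hw => ?_) (iSup₂_le fun a ha => ?_)
      · rw [Submodule.mem_comap, Submodule.mkQ_apply, (Submodule.Quotient.mk_eq_zero K).2 hw]
        exact zero_mem _
      · rintro _ ⟨w, rfl⟩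
        classical
        refine ⟨Pi.single ⟨a, ha⟩ w, ?_⟩
        change K.mkQ _ = _
        congr 1
        rw [LinearMap.sum_apply, Finset.sum_eq_single ⟨a, ha⟩]
        · simp
        · intro b _ hb
          simp [Pi.single_eq_of_ne hb]
        · simp
    exact h2 hv
  refine (Module.length_le_of_surjective g hg).trans ?_
  rw [Module.length_pi_of_fintype]
  simp

lemma length_H_quot_iSup_subAct_le (E : Finset σ) (d n : ℕ) :
    Module.length R (H I n (MonQuot R σ M (monSet Finset.univ d)) ⧸ (⨆ j ∈ Finset.univ \ E,
      LinearMap.range (H.map I n (subAct (M := M) x (monSet Finset.univ d) j)))) ≤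
      (d + E.card).choose E.card * Module.length R (H I n M) := by
  have h := length_quot_le_of_iSup_range _ _ _ (iSup_range_subAct_sup (M := M) I x E d n)
  rwa [card_monSet] at h

end Monomial

section Main
variable {R : Type u} [CommRing R] [IsNoetherianRing R] [IsLocalRing R]
  {M : Type u} [AddCommGroup M] [Module R M] [Module.Finite R M]
  {σ : Type} [DecidableEq σ] [Fintype σ]

lemma length_H_monQuot_le (d n : ℕ) :
    Module.length R (H (maximalIdeal R) n (MonQuot R σ M (monSet Finset.univ d))) ≤
      (d + Fintype.card σ).choose (Fintype.card σ) *
        Module.length R (H (maximalIdeal R) n M) := by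
  have h := length_H_quot_iSup_subAct_le (M := M) (maximalIdeal R) (0 : σ → R) Finset.univ d n
  have h0 : (⨆ j ∈ (Finset.univ \ Finset.univ : Finset σ), LinearMap.range
      (H.map (maximalIdeal R) n (subAct (M := M) (0 : σ → R) (monSet Finset.univ d) j))) = ⊥ := by simp
  rw [(Submodule.quotEquivOfEqBot _ h0).length_eq] at h
  exact h

lemma cokerLength_subAct_le (x : σ → R) (j : σ) (d n : ℕ) :
    cokerLength (maximalIdeal R) n (subAct (M := M) x (monSet Finset.univ d) j) ≤
      (d + (Fintype.card σ - 1)).choose (Fintype.card σ - 1) *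
        Module.length R (H (maximalIdeal R) n M) := by
  have h := length_H_quot_iSup_subAct_le (M := M) (maximalIdeal R) x (Finset.univ \ {j}) d n
  rw [Finset.card_sdiff_of_subset (Finset.subset_univ _), Finset.card_singleton, Finset.card_univ] at h
  have h0 : (⨆ i ∈ (Finset.univ \ (Finset.univ \ {j}) : Finset σ), LinearMap.range
      (H.map (maximalIdeal R) n (subAct (M := M) x (monSet Finset.univ d) i))) =
      LinearMap.range (H.map (maximalIdeal R) n (subAct (M := M) x (monSet Finset.univ d) j)) := by
    rw [Finset.sdiff_sdiff_eq_self (Finset.subset_univ _), Finset.iSup_singleton]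
  rw [(Submodule.quotEquivOfEq _ _ h0).length_eq] at h
  exact h

lemma length_quot_two_subAct_le (x : σ → R) {i j : σ} (hij : i ≠ j) (d n : ℕ) :
    Module.length R (H (maximalIdeal R) n (MonQuot R σ M (monSet Finset.univ d)) ⧸
      (LinearMap.range (H.map (maximalIdeal R) n (subAct (M := M) x (monSet Finset.univ d) i)) ⊔
      LinearMap.range (H.map (maximalIdeal R) n (subAct (M := M) x (monSet Finset.univ d) j)))) ≤
      (d + (Fintype.card σ - 2)).choose (Fintype.card σ - 2) *
        Module.length R (H (maximalIdeal R) n M) := by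
  have h := length_H_quot_iSup_subAct_le (M := M) (maximalIdeal R) x (Finset.univ \ {i, j}) d n
  rw [Finset.card_sdiff_of_subset (Finset.subset_univ _), Finset.card_pair hij, Finset.card_univ] at h
  have h0 : (⨆ t ∈ (Finset.univ \ (Finset.univ \ {i, j}) : Finset σ), LinearMap.range
      (H.map (maximalIdeal R) n (subAct (M := M) x (monSet Finset.univ d) t))) =
      LinearMap.range (H.map (maximalIdeal R) n (subAct (M := M) x (monSet Finset.univ d) i)) ⊔
      LinearMap.range (H.map (maximalIdeal R) n (subAct (M := M) x (monSet Finset.univ d) j)) := by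
    rw [Finset.sdiff_sdiff_eq_self (Finset.subset_univ _), Finset.iSup_insert,
      Finset.iSup_singleton]
  rw [(Submodule.quotEquivOfEq _ _ h0).length_eq] at h
  exact h

theorem exists_hilbert_function_eq (k : ℕ) (x : Fin (k + 2) → R) (hx : ∀ i, x i ∈ maximalIdeal R)
    (hQ : maximalIdeal R ≤ (Module.annihilator R M ⊔ Ideal.span (Set.range x)).radical)
    (h : ℕ → ℕ) (hh : ∀ i < k + 2, Module.length R (H (maximalIdeal R) i M) = h i) :
    ∃ (χ : ℤ) (K : ℕ → ℕ), ∀ n,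
      ((Module.length R
        (M ⧸ (Ideal.span (Set.range x) ^ (n + 1) • ⊤ : Submodule R M))).toNat : ℤ) =
          (n + (k + 2)).choose (k + 2) * χ + K n ∧
      K n ≤ ∑ i ∈ Finset.range (k + 1), k.choose i *
        ((n + k).choose k * h i + (n + (k + 1)).choose (k + 1) * h (i + 1)) := by
  let l := List.finRange (k + 2)
  refine ⟨symb (subList x l) (MonQuot R (Fin (k + 2)) M {0}),
    fun n => (lastKer (subList x l) (MonQuot R (Fin (k + 2)) M (monSet Finset.univ n))).toNat,
    fun n => ?_⟩
  have hD := isLowerSet_monSet (Finset.univ : Finset (Fin (k + 2))) n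
  have hl : ∀ i, i ∈ l := List.mem_finRange
  have hS := symbFin_monQuot (M := M) hD hl hQ
  have hfin : Module.Finite R (MonQuot R (Fin (k + 2)) M (monSet Finset.univ n)) := finite_monQuot hD
  have hT := X_pow_smul_monQuot (R := R) (M := M) hD
  have hH : ∀ j < k + 2, Module.length R (H (maximalIdeal R) j
      (MonQuot R (Fin (k + 2)) M (monSet Finset.univ n))) ≠ ⊤ := by
    intro j hj
    refine ne_top_of_le_ne_top ?_ (length_H_monQuot_le n j)
    rw [hh j hj]
    exact_mod_cast ENat.natCast_ne_top _
  have hA : AllTors (maximalIdeal R) (subList x l) (MonQuot R (Fin (k + 2)) M (monSet Finset.univ n)) :=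
    allTors_of_symbFin x sub_constantCoeff_mem_span hx l hT (by simpa [l] using hH) hS
  have hl2 : l = 0 :: 1 :: (List.finRange k).map fun i => i.succ.succ := by
    simp only [l, List.finRange_succ, List.map_cons, List.map_map]
    rfl
  constructor
  · have h1 := length_monQuot_quot (M := M) (x := x) n hl
    rw [← h1]
    have h2 := symb_monQuot hD hS
    rw [card_monSet, Finset.card_univ, Fintype.card_fin] at h2
    rw [← h2]
    rw [hl2] at hA ⊢
    exact length_quot_eq_symb_add_lastKer _ _ hT hA
  · rw [← ENat.natCast_le_natCast]
    refine (ENat.natCast_toNat_le_self _).trans ?_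
    set a : ℕ → ℕ := fun i =>
      (n + k).choose k * h i + (n + (k + 1)).choose (k + 1) * h (i + 1)
    rw [hl2] at hA ⊢
    let y0 := MvPolynomial.X (0 : Fin (k + 2)) - algebraMap R (MvPolynomial (Fin (k + 2)) R) (x 0)
    let y1 := MvPolynomial.X (1 : Fin (k + 2)) - algebraMap R (MvPolynomial (Fin (k + 2)) R) (x 1)
    let ys := subList x ((List.finRange k).map fun i => i.succ.succ)
    have hA : AllTors (maximalIdeal R) (y0 :: y1 :: ys) (MonQuot R (Fin (k + 2)) M (monSet Finset.univ n)) := hA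
    have hys : ys.length = k := by simp [ys]
    change lastKer (y1 :: ys) (QuotSMulTop y0 (MonQuot R (Fin (k + 2)) M (monSet Finset.univ n))) ≤ _
    have key := lastKer_le (maximalIdeal R) y1 ys hA.2 (fun i hi =>
      length_H_quot_ne_top _ hA.1 (hH i (by omega)) (hH (i + 1) (by omega)))
      (fun i => (a i : ℕ∞)) (fun i hi => ?_)
    · rw [hys, binomSum_eq] at key
      exact_mod_cast key
    · have h3 := cokerLength_le_of_exact (maximalIdeal R) (φ := act R y0 (MonQuot R (Fin (k + 2)) M (monSet Finset.univ n))) (ψ := act R y1 (MonQuot R (Fin (k + 2)) M (monSet Finset.univ n)))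
        (ψ'' := act R y1 (QuotSMulTop y0 (MonQuot R (Fin (k + 2)) M (monSet Finset.univ n)))) (isPowTorsion_ker_act _ hA.1)
        (quotMk_surjective y0) (exact_act_quotMk y0) rfl i (hH (i + 1) (by omega))
      refine h3.trans ?_
      have h4 := length_quot_two_subAct_le (M := M) x (i := 0) (j := 1) (by simp) n i
      have h5 := cokerLength_subAct_le (M := M) x 0 n (i + 1)
      rw [Fintype.card_fin, hh _ (by omega)] at h4 h5
      exact_mod_cast add_le_add h4 h5

end Main

lemma eq_zero_and_bounds_of_growth {D e b c A : ℤ} {m₀ : ℕ} (hc : 0 < c)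
    (h1 : ∀ m : ℤ, m₀ ≤ m → -A ≤ D * (m + 1) * m - e * c * m)
    (h2 : ∀ m : ℤ, m₀ ≤ m → D * (m + 1) * m - e * c * m ≤ b * c * m + A) :
    D = 0 ∧ e ≤ 0 ∧ -b ≤ e := by
  have hA := le_abs_self A
  have hec := abs_nonneg (e * c)
  have hbc := abs_nonneg (b * c)
  have hA0 := abs_nonneg A
  have key : ∀ x : ℤ, (∀ m : ℤ, m₀ ≤ m → -A ≤ x * m) → 0 ≤ x := by
    intro x hx
    by_contra! hneg
    have := hx (m₀ + |A| + 1) (by linarith)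
    have h3 : x * (m₀ + |A| + 1) ≤ -1 * (m₀ + |A| + 1) :=
      mul_le_mul_of_nonneg_right (by omega) (by positivity)
    have : (0 : ℤ) ≤ m₀ := by positivity
    linarith
  have hD : D = 0 := by
    set m : ℤ := m₀ + |e * c| + |b * c| + |A| + 1 with hm
    have hm0 : (0 : ℤ) ≤ m₀ := by positivity
    have h1 := h1 m (by linarith)
    have h2 := h2 m (by linarith)
    have hec1 := le_abs_self (e * c)
    have hec2 := neg_abs_le (e * c)
    have hbc1 := le_abs_self (b * c)
    have hbc2 := neg_abs_le (b * c)
    rcases lt_trichotomy D 0 with hD | hD | hD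
    · have h3 : D * (m + 1) - e * c ≤ -1 := by nlinarith
      nlinarith
    · exact hD
    · have h3 : 1 ≤ D * (m + 1) - e * c - b * c := by nlinarith
      nlinarith
  subst hD
  have h3 := key (-(e * c)) fun m hm => by linarith [h1 m hm]
  have h4 := key ((e + b) * c) fun m hm => by linarith [h2 m hm]
  refine ⟨rfl, ?_, ?_⟩
  · by_contra! h
    nlinarith
  · by_contra! h
    nlinarith

lemma hilbertCoeff_bounds_of_growth (k : ℕ) (e : ℕ → ℤ) (χ a b : ℤ) (ha : 0 ≤ a) (K : ℕ → ℤ) (N : ℕ)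
    (hK : ∀ n ≥ N, ∑ i ∈ Finset.range (k + 2 + 1),
      (-1 : ℤ) ^ i * e i * ((n + (k + 2) - i).choose (k + 2 - i)) =
        (n + (k + 2)).choose (k + 2) * χ + K n)
    (hK0 : ∀ n, 0 ≤ K n)
    (hK1 : ∀ n, K n ≤ (n + k).choose k * a + (n + (k + 1)).choose (k + 1) * b) :
    e 1 ≤ 0 ∧ -b ≤ e 1 := by
  set T := ∑ i ∈ Finset.range (k + 1), |e (i + 2)|
  have hT : 0 ≤ T := Finset.sum_nonneg fun _ _ => abs_nonneg _
  have hrest : ∀ n, |∑ i ∈ Finset.range (k + 1), (-1 : ℤ) ^ (i + 2) * e (i + 2) *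
      ((n + (k + 2) - (i + 2)).choose (k + 2 - (i + 2)))| ≤ (n + k).choose k * T := by
    intro n
    refine (Finset.abs_sum_le_sum_abs _ _).trans ?_
    rw [Finset.mul_sum]
    refine Finset.sum_le_sum fun i hi => ?_
    rw [abs_mul, abs_mul, abs_pow, abs_neg, abs_one, one_pow, one_mul, mul_comm, Nat.abs_cast]
    refine mul_le_mul_of_nonneg_right ?_ (abs_nonneg _)
    have hi := Finset.mem_range.1 hi
    have h1 : n + (k + 2) - (i + 2) = n + (k - i) := by omega
    have h2 : k + 2 - (i + 2) = k - i := by omega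
    rw [h1, h2, ← Nat.choose_symm_add, ← Nat.choose_symm_add]
    exact_mod_cast Nat.choose_le_choose n (by omega)
  have hA : 0 ≤ T + a := by positivity
  have hmul1 : ∀ n : ℕ, ((n + (k + 1)).choose (k + 1) : ℤ) * (k + 1) =
      (n + k).choose k * (n + k + 1) := by
    intro n
    have := Nat.add_one_mul_choose_eq (n + k) k
    rw [mul_comm ((n + k).choose k : ℤ)]
    exact_mod_cast this.symm
  have hmul2 : ∀ n : ℕ, ((n + (k + 2)).choose (k + 2) : ℤ) * ((k + 1) * (k + 2)) =
      (n + k).choose k * ((n + k + 2) * (n + k + 1)) := by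
    intro n
    have h := Nat.add_one_mul_choose_eq (n + (k + 1)) (k + 1)
    have h' : ((n + (k + 2)).choose (k + 2) : ℤ) * (k + 2) =
      (n + (k + 1)).choose (k + 1) * (n + k + 2) := by
      rw [mul_comm ((n + (k + 1)).choose (k + 1) : ℤ)]
      exact_mod_cast h.symm
    linear_combination (k + 1 : ℤ) * h' + (n + k + 2 : ℤ) * hmul1 n
  have main : ∀ n ≥ N, (-((T + a) * ((k + 1) * (k + 2))) ≤
      (e 0 - χ) * ((n + k + 1 : ℤ) + 1) * (n + k + 1) - e 1 * (k + 2) * (n + k + 1)) ∧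
      (e 0 - χ) * ((n + k + 1 : ℤ) + 1) * (n + k + 1) - e 1 * (k + 2) * (n + k + 1) ≤
        b * (k + 2) * (n + k + 1) + (T + a) * ((k + 1) * (k + 2)) := by
    intro n hn
    have h := hK n hn
    rw [Finset.sum_range_succ', Finset.sum_range_succ'] at h
    have hr := abs_le.1 (hrest n)
    set r := ∑ i ∈ Finset.range (k + 1), (-1 : ℤ) ^ (i + 2) * e (i + 2) *
      ((n + (k + 2) - (i + 2)).choose (k + 2 - (i + 2)))
    have h0 := hK0 n
    have h1 := hK1 n
    have hc : (0 : ℤ) < (n + k).choose k := by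
      exact_mod_cast Nat.choose_pos (by omega)
    change r + _ + _ = _ at h
    have e1 : n + (k + 2) - (0 + 1) = n + (k + 1) := by omega
    have e2 : k + 2 - (0 + 1) = k + 1 := by omega
    simp only [e1, e2, zero_add, pow_one, pow_zero, Nat.sub_zero, one_mul] at h
    have hk : (0 : ℤ) < (k + 1) * (k + 2) := by positivity
    have hm1 := hmul1 n
    have hm2 := hmul2 n
    set c := ((n + k).choose k : ℤ)
    set c1 := ((n + (k + 1)).choose (k + 1) : ℤ)
    set c2 := ((n + (k + 2)).choose (k + 2) : ℤ)
    have ident : c * ((e 0 - χ) * ((n + k + 1 : ℤ) + 1) * (n + k + 1) -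
        e 1 * (k + 2) * (n + k + 1)) = (K n - r) * ((k + 1) * (k + 2)) := by
      linear_combination ((k + 1 : ℤ) * (k + 2)) * h - (e 0 - χ) * hm2 + (k + 2 : ℤ) * e 1 * hm1
    have hca : 0 ≤ c * a := by positivity
    constructor
    · refine le_of_mul_le_mul_left ?_ hc
      rw [ident]
      have := mul_le_mul_of_nonneg_right (show -(c * T + c * a) ≤ K n - r by linarith) hk.le
      linarith
    · refine le_of_mul_le_mul_left ?_ hc
      rw [ident]
      have := mul_le_mul_of_nonneg_right (show K n - r ≤ c * T + (c * a + c1 * b) by linarith) hk.le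
      refine this.trans (le_of_eq ?_)
      linear_combination (k + 2 : ℤ) * b * hm1
  have := eq_zero_and_bounds_of_growth (D := e 0 - χ) (e := e 1) (b := b) (c := k + 2)
    (A := (T + a) * ((k + 1) * (k + 2))) (m₀ := N + k + 1) (by positivity)
    (fun m hm => ?_) (fun m hm => ?_)
  · exact this.2
  all_goals
    push_cast at hm
    obtain ⟨n, hn⟩ := Int.eq_ofNat_of_zero_le (a := m - k - 1) (by linarith)
    obtain rfl : m = n + k + 1 := by linarith
  · exact (main n (by linarith)).1
  · exact (main n (by linarith)).2

section Radical
variable {R : Type*} [CommRing R] [IsNoetherianRing R] [IsLocalRing R]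
  {M : Type*} [AddCommGroup M] [Module R M] [Module.Finite R M]

lemma length_ne_top_of_le_radical {I : Ideal R}
    (h : maximalIdeal R ≤ (Module.annihilator R M ⊔ I).radical) :
    Module.length R (M ⧸ (I • ⊤ : Submodule R M)) ≠ ⊤ := by
  refine IsPowTorsion.length_ne_top (maximalIdeal R) fun x => ?_
  obtain ⟨k, hk⟩ := Ideal.exists_pow_le_of_le_radical_of_fg h (IsNoetherian.noetherian _)
  refine ⟨k, fun r hr => ?_⟩
  obtain ⟨a, ha, b, hb, rfl⟩ := Submodule.mem_sup.1 (hk hr)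
  obtain ⟨x, rfl⟩ := Submodule.mkQ_surjective _ x
  rw [← _root_.map_smul, Submodule.mkQ_apply, Submodule.Quotient.mk_eq_zero, add_smul,
    Module.mem_annihilator.1 ha, zero_add]
  exact Submodule.smul_mem_smul hb Submodule.mem_top

lemma le_radical_of_length_ne_top {I : Ideal R}
    (h : Module.length R (M ⧸ (I • ⊤ : Submodule R M)) ≠ ⊤) :
    maximalIdeal R ≤ (Module.annihilator R M ⊔ I).radical := by
  rw [Ideal.radical_eq_sInf]
  refine le_sInf fun P ⟨hP, hPp⟩ => ?_
  have hmem : (⟨P, hPp⟩ : PrimeSpectrum R) ∈ Module.support R (M ⧸ (I • ⊤ : Submodule R M)) := by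
    rw [Module.support_quotient]
    exact ⟨Module.mem_support_iff_of_finite.2 (le_sup_left.trans hP),
      (PrimeSpectrum.mem_zeroLocus _ _).2 fun r hr => hP (Ideal.mem_sup_right hr)⟩
  obtain ⟨k, hk⟩ := (isPowTorsion_of_length_ne_top h).exists_pow_smul
  have hk' : maximalIdeal R ^ k ≤ P := fun r hr =>
    Module.mem_support_iff_of_finite.1 hmem (Module.mem_annihilator.2 (hk r hr))
  exact Ideal.IsPrime.le_of_pow_le hk'

lemma length_quotient_pow_ne_top {I : Ideal R}
    (h : Module.length R (M ⧸ (I • ⊤ : Submodule R M)) ≠ ⊤) (n : ℕ) :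
    Module.length R (M ⧸ (I ^ n • ⊤ : Submodule R M)) ≠ ⊤ := by
  refine length_ne_top_of_le_radical ?_
  rcases Nat.eq_zero_or_pos n with rfl | hn
  · simp [Ideal.radical_top]
  · refine (le_radical_of_length_ne_top h).trans ?_
    rw [Ideal.radical_le_radical_iff]
    refine sup_le (le_sup_left.trans Ideal.le_radical) fun r hr => ⟨n, ?_⟩
    exact Ideal.mem_sup_right (Ideal.pow_mem_pow hr n)

end Radical

lemma moduleLength_eq_natCast {R M : Type*} [CommRing R] [AddCommGroup M] [Module R M] {l : ℕ} :
    moduleLength R M = (l : WithBot ℕ∞) ↔ Module.length R M = l := by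
  rw [moduleLength, ← Module.coe_length]
  norm_cast

lemma localCohomologyLength_eq_natCast {R M : Type u} [CommRing R] [IsLocalRing R]
    [IsNoetherianRing R] [AddCommGroup M] [Module R M] {i l : ℕ} :
    localCohomologyLength R M i = (l : WithBot ℕ∞) ↔
      Module.length R (H (maximalIdeal R) i M) = l := by
  rw [localCohomologyLength, moduleLength_eq_natCast,
    (localCohomologyEquiv (maximalIdeal R) i M).length_eq]

lemma hasHilbertCoeffsMod_iff {R : Type*} {M : Type*} [CommRing R] [AddCommGroup M] [Module R M]
    {Q : Ideal R} {s : ℕ} {e : ℕ → ℤ}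
    (hfin : ∀ n, Module.length R (M ⧸ (Q ^ (n + 1) • ⊤ : Submodule R M)) ≠ ⊤) :
    HasHilbertCoeffsMod M Q s e ↔ ∃ N : ℕ, ∀ n ≥ N,
      ((Module.length R (M ⧸ (Q ^ (n + 1) • ⊤ : Submodule R M))).toNat : ℤ) =
        ∑ i ∈ Finset.range (s + 1), (-1 : ℤ) ^ i * e i * ((n + s - i).choose (s - i)) := by
  refine exists_congr fun N => forall₂_congr fun n _ => ?_
  constructor
  · rintro ⟨l, h1, h2⟩
    rw [moduleLength_eq_natCast.1 h1, ← h2]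
    rfl
  · intro h
    exact ⟨_, moduleLength_eq_natCast.2 (ENat.natCast_toNat (hfin n)).symm, h⟩

section Bounds
variable {R M : Type u} [CommRing R] [IsNoetherianRing R] [IsLocalRing R]
    [AddCommGroup M] [Module R M] [Module.Finite R M]

theorem hilbertCoeff_one_bounds (k : ℕ) {Q : Ideal R} (hQ : IsParameterIdealFor M (k + 2) Q)
    {e : ℕ → ℤ} (he : HasHilbertCoeffsMod M Q (k + 2) e) (h : ℕ → ℕ)
    (hh : ∀ i < k + 2, Module.length R (H (maximalIdeal R) i M) = h i) :
    e 1 ≤ 0 ∧ -∑ i ∈ Finset.range (k + 1), (k.choose i : ℤ) * h (i + 1) ≤ e 1 := by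
  obtain ⟨⟨x, hx, rfl⟩, l, hl⟩ := hQ
  have hl : Module.length R (M ⧸ (Ideal.span (Set.range x) • ⊤ : Submodule R M)) ≠ ⊤ := by
    rw [moduleLength_eq_natCast.1 hl]
    exact ENat.natCast_ne_top l
  obtain ⟨N, hN⟩ := (hasHilbertCoeffsMod_iff fun n => length_quotient_pow_ne_top hl _).1 he
  obtain ⟨χ, K, hK⟩ := exists_hilbert_function_eq k x hx (le_radical_of_length_ne_top hl) h hh
  refine hilbertCoeff_bounds_of_growth k e χ (∑ i ∈ Finset.range (k + 1), (k.choose i : ℤ) * h i) _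
    (by positivity) (fun n => K n) N (fun n hn => ?_) (fun n => by positivity) fun n => ?_
  · rw [← hN n hn, (hK n).1]
  · refine (Nat.cast_le.2 (hK n).2).trans (le_of_eq ?_)
    push_cast
    rw [Finset.mul_sum, Finset.mul_sum, ← Finset.sum_add_distrib]
    exact Finset.sum_congr rfl fun i _ => by ring

end Bounds

section DSequence
variable {S : Type*} [CommRing S] {X : Type*} [AddCommGroup X] [Module S X]

/-- The ideal generated by `x 0, …, x (j - 1)`. -/
def initIdeal (x : ℕ → S) : ℕ → Ideal S
  | 0 => ⊥
  | j + 1 => initIdeal x j ⊔ Ideal.span {x j}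

lemma initIdeal_succ' (x : ℕ → S) (j : ℕ) :
    initIdeal x (j + 1) = Ideal.span {x 0} ⊔ initIdeal (fun i => x (i + 1)) j := by
  induction j with
  | zero => simp [initIdeal]
  | succ j ih =>
    change initIdeal x (j + 1) ⊔ _ = _ ⊔ (_ ⊔ _)
    rw [ih, sup_assoc]

lemma initIdeal_eq_span (x : ℕ → S) (j : ℕ) :
    initIdeal x j = Ideal.span (Set.range fun i : Fin j => x i) := by
  induction j with
  | zero => simp [initIdeal]
  | succ j ih =>
    rw [initIdeal, ih, ← Ideal.span_union]
    congr 1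
    ext y
    simp [Fin.exists_iff_castSucc, eq_comm]

lemma initIdeal_mono (x : ℕ → S) : Monotone (initIdeal x) :=
  monotone_nat_of_le_succ fun _ => le_sup_left

variable (X) in
/-- The submodule `(x 0, …, x (j - 1)) X`. -/
def initSub (x : ℕ → S) (j : ℕ) : Submodule S X := initIdeal x j • (⊤ : Submodule S X)

lemma initSub_mono (x : ℕ → S) : Monotone (initSub X x) := fun _ _ h =>
  Submodule.smul_mono_left (N := (⊤ : Submodule S X)) (initIdeal_mono x h)

lemma smul_mem_initSub_succ (x : ℕ → S) (j : ℕ) (u : X) : x j • u ∈ initSub X x (j + 1) :=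
  Submodule.smul_mem_smul (Ideal.mem_sup_right (Ideal.mem_span_singleton_self _))
    Submodule.mem_top

lemma exists_add_smul_of_mem_smul_initSub_succ (x : ℕ → S) (j : ℕ) (I : Ideal S) {u : X}
    (hu : u ∈ I • initSub X x (j + 1)) :
    ∃ v ∈ I • initSub X x j, ∃ w ∈ (I • ⊤ : Submodule S X), u = v + x j • w := by
  rw [initSub, initIdeal, Submodule.sup_smul, Submodule.smul_sup, Submodule.mem_sup] at hu
  obtain ⟨v, hv, z, hz, rfl⟩ := hu
  rw [← Submodule.mul_smul, mul_comm, Submodule.mul_smul, Submodule.ideal_span_singleton_smul] at hz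
  obtain ⟨w, hw, rfl⟩ := hz
  exact ⟨v, hv, w, hw, rfl⟩

lemma exists_add_smul_of_mem_initSub_succ (x : ℕ → S) (j : ℕ) {u : X}
    (hu : u ∈ initSub X x (j + 1)) : ∃ v ∈ initSub X x j, ∃ w : X, u = v + x j • w := by
  have hu' : u ∈ (⊤ : Ideal S) • initSub X x (j + 1) := by rwa [Submodule.top_smul]
  obtain ⟨v, hv, w, -, h⟩ := exists_add_smul_of_mem_smul_initSub_succ x j _ hu'
  exact ⟨v, by rwa [Submodule.top_smul] at hv, w, h⟩

variable (X) in
/-- `x` behaves up to index `s` like a `d`-sequence on `X`. -/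
structure IsDSeq (x : ℕ → S) (s : ℕ) : Prop where
  sq_mem : ∀ j < s, ∀ u : X, x j • x j • u ∈ initSub X x j → x j • u ∈ initSub X x j
  succ_mem : ∀ j, j + 1 < s → ∀ u : X, x j • u ∈ initSub X x j →
    x (j + 1) • u ∈ initSub X x (j + 1)

namespace IsDSeq
variable {x : ℕ → S} {s : ℕ}

lemma smul_mem (h : IsDSeq X x s) {j : ℕ} {u : X} (hu : x j • u ∈ initSub X x j) {k : ℕ} (hk : j ≤ k) (hks : k < s) :
    x k • u ∈ initSub X x k := by
  induction k, hk using Nat.le_induction with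
  | base => exact hu
  | succ k hk ih => exact h.succ_mem k hks u (ih (by omega))

lemma mem_initSub (h : IsDSeq X x s) {j : ℕ} {u : X} (hu : x j • u ∈ initSub X x j) {k : ℕ} (hjk : j ≤ k)
    (hk : k ≤ s) (huk : u ∈ initSub X x k) : u ∈ initSub X x j := by
  induction k, hjk using Nat.le_induction with
  | base => exact huk
  | succ k hjk ih =>
    refine ih (by omega) ?_
    obtain ⟨v, hv, w, rfl⟩ := exists_add_smul_of_mem_initSub_succ x k huk
    have h1 := h.smul_mem hu hjk (by omega)
    rw [smul_add] at h1
    have h2 := (Submodule.add_mem_iff_right _ (Submodule.smul_mem _ _ hv)).1 h1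
    exact Submodule.add_mem _ hv (h.sq_mem k (by omega) w h2)

lemma mem_pow_smul_initSub (h : IsDSeq X x s) {j : ℕ} (hj : j ≤ s) (n : ℕ) {u : X} (hu : u ∈ initSub X x j)
    (hu' : u ∈ (initIdeal x s ^ (n + 1) • ⊤ : Submodule S X)) :
    u ∈ initIdeal x s ^ n • initSub X x j := by
  induction n generalizing j u with
  | zero => simpa using hu
  | succ n ihn =>
    induction hj using Nat.decreasingInduction generalizing u with
    | self =>
      rwa [initSub, ← Submodule.mul_smul, ← pow_succ]
    | of_succ j hj ihj =>
      have h1 := ihj (initSub_mono x j.le_succ hu) hu'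
      obtain ⟨v, hv, w, hw, rfl⟩ := exists_add_smul_of_mem_smul_initSub_succ x j _ h1
      have hxw : x j • w ∈ initSub X x j :=
        (Submodule.add_mem_iff_right _ (Submodule.smul_le_right hv)).1 hu
      have hws : w ∈ initSub X x s :=
        Submodule.smul_mono_left (Ideal.pow_le_self (Nat.succ_ne_zero n)) hw
      have h2 := ihn hj.le (h.mem_initSub hxw hj.le le_rfl hws) hw
      refine Submodule.add_mem _ hv ?_
      rw [pow_succ', Submodule.mul_smul]
      refine Submodule.smul_mem_smul ?_ h2
      exact initIdeal_mono x hj (Ideal.mem_sup_right (Ideal.mem_span_singleton_self _))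

lemma exists_of_smul_mem_sup (h : IsDSeq X x s) {j : ℕ} (hj : j < s) (n : ℕ) {w : X}
    (hw : x j • w ∈ initSub X x j ⊔ initIdeal x s ^ (n + 1) • ⊤) :
    ∃ w' ∈ (initIdeal x s ^ n • ⊤ : Submodule S X), x j • (w - w') ∈ initSub X x j := by
  obtain ⟨v, hv, q, hq, hvq⟩ := Submodule.mem_sup.1 hw
  have hq1 : q ∈ initSub X x (j + 1) := by
    rw [← Submodule.add_mem_iff_right _ (initSub_mono x j.le_succ hv), hvq]
    exact smul_mem_initSub_succ x j w
  obtain ⟨v', hv', w', hw', rfl⟩ := exists_add_smul_of_mem_smul_initSub_succ x j _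
    (h.mem_pow_smul_initSub (by omega) n hq1 hq)
  refine ⟨w', hw', ?_⟩
  rw [smul_sub, ← hvq, ← add_assoc, add_sub_cancel_right]
  exact Submodule.add_mem _ hv (Submodule.smul_le_right hv')

end IsDSeq

end DSequence

section DSequence
variable {S : Type*} [CommRing S] {X : Type*} [AddCommGroup X] [Module S X]

variable (X) in
/-- The submodule `(x 0, …, x (j - 1)) X : x j`. -/
def colonSub (x : ℕ → S) (j : ℕ) : Submodule S X :=
  (initSub X x j).comap (LinearMap.lsmul S X (x j))

lemma initSub_le_colonSub (x : ℕ → S) (j : ℕ) : initSub X x j ≤ colonSub X x j :=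
  fun _ hu => Submodule.smul_mem _ _ hu

variable (X) in
/-- The length of `((x 0, …, x (j - 1)) X : x j) / (x 0, …, x (j - 1)) X`. -/
noncomputable def colonLength (x : ℕ → S) (j : ℕ) : ℕ∞ :=
  Module.length S (Submodule.torsionBy S (X ⧸ initSub X x j) (x j))

variable (X) in
/-- The length of `X / ((x 0, …, x (j - 1)) X + Q ^ n X)`, where `Q = (x 0, …, x (s - 1))`. -/
noncomputable def partialLength (x : ℕ → S) (s j n : ℕ) : ℕ∞ :=
  Module.length S (X ⧸ (initSub X x j ⊔ initIdeal x s ^ n • ⊤ : Submodule S X))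

namespace IsDSeq
variable {x : ℕ → S} {s : ℕ}

lemma partialLength_eq_add_colon (h : IsDSeq X x s) {j : ℕ} (hj : j < s) (n : ℕ) :
    partialLength X x s j (n + 1) = partialLength X x s (j + 1) (n + 1) +
      Module.length S (X ⧸ (colonSub X x j ⊔ initIdeal x s ^ n • ⊤ : Submodule S X)) := by
  have hxj : x j ∈ initIdeal x s :=
    initIdeal_mono x hj (Ideal.mem_sup_right (Ideal.mem_span_singleton_self _))
  have hle : (colonSub X x j ⊔ initIdeal x s ^ n • ⊤ : Submodule S X) ≤
      (initSub X x j ⊔ initIdeal x s ^ (n + 1) • ⊤ : Submodule S X).comap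
        (LinearMap.lsmul S X (x j)) := by
    refine sup_le (Submodule.comap_mono le_sup_left) fun u hu => Submodule.mem_sup_right ?_
    rw [pow_succ', Submodule.mul_smul]
    exact Submodule.smul_mem_smul hxj hu
  have hle2 : (initSub X x j ⊔ initIdeal x s ^ (n + 1) • ⊤ : Submodule S X) ≤
      initSub X x (j + 1) ⊔ initIdeal x s ^ (n + 1) • ⊤ :=
    sup_le_sup_right (initSub_mono x j.le_succ) _
  rw [add_comm (partialLength X x s (j + 1) (n + 1))]
  refine Module.length_eq_add_of_exact (Submodule.mapQ _ _ _ hle) (Submodule.factor hle2)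
    ?_ (Submodule.factor_surjective hle2) ?_
  · rw [injective_iff_map_eq_zero]
    intro u hu
    obtain ⟨u, rfl⟩ := Submodule.mkQ_surjective _ u
    rw [Submodule.mkQ_apply, Submodule.mapQ_apply, Submodule.Quotient.mk_eq_zero] at hu
    obtain ⟨w, hw, hw'⟩ := h.exists_of_smul_mem_sup hj n hu
    rw [Submodule.mkQ_apply, Submodule.Quotient.mk_eq_zero]
    rw [← sub_add_cancel u w]
    exact Submodule.add_mem_sup hw' hw
  · intro v
    obtain ⟨v, rfl⟩ := Submodule.mkQ_surjective _ v
    constructor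
    · intro hv
      replace hv := (Submodule.Quotient.mk_eq_zero _).1 hv
      obtain ⟨a, ha, b, hb, rfl⟩ := Submodule.mem_sup.1 hv
      obtain ⟨c, hc, w, rfl⟩ := exists_add_smul_of_mem_initSub_succ x j ha
      refine ⟨Submodule.Quotient.mk w, ?_⟩
      rw [Submodule.mapQ_apply, Submodule.mkQ_apply, Submodule.Quotient.eq]
      have : x j • w - (c + x j • w + b) = -(c + b) := by abel
      rw [LinearMap.lsmul_apply, this]
      exact Submodule.neg_mem _ (Submodule.add_mem_sup hc hb)
    · rintro ⟨w, hw⟩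
      obtain ⟨w, rfl⟩ := Submodule.mkQ_surjective _ w
      rw [← hw]
      refine (Submodule.Quotient.mk_eq_zero _).2 ?_
      exact Submodule.mem_sup_left (smul_mem_initSub_succ x j w)

lemma partialLength_eq_add_colonLength (h : IsDSeq X x s) {j : ℕ} (hj : j < s) (n : ℕ) :
    partialLength X x s j (n + 1) = colonLength X x j +
      Module.length S (X ⧸ (colonSub X x j ⊔ initIdeal x s ^ (n + 1) • ⊤ : Submodule S X)) := by
  have hle1 : initSub X x j ≤ initSub X x j ⊔ initIdeal x s ^ (n + 1) • ⊤ := le_sup_left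
  have hle : (initSub X x j ⊔ initIdeal x s ^ (n + 1) • ⊤ : Submodule S X) ≤
      colonSub X x j ⊔ initIdeal x s ^ (n + 1) • ⊤ :=
    sup_le_sup_right (initSub_le_colonSub x j) _
  refine Module.length_eq_add_of_exact
    (Submodule.factor hle1 ∘ₗ (Submodule.torsionBy S (X ⧸ initSub X x j) (x j)).subtype)
    (Submodule.factor hle) ?_ (Submodule.factor_surjective hle) ?_
  · rw [injective_iff_map_eq_zero]
    rintro ⟨u, hu⟩ hu'
    obtain ⟨u, rfl⟩ := Submodule.mkQ_surjective _ u
    have hu : x j • u ∈ initSub X x j := by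
      rwa [Submodule.mem_torsionBy_iff, Submodule.mkQ_apply, ← Submodule.Quotient.mk_smul,
        Submodule.Quotient.mk_eq_zero] at hu
    have hu' : u ∈ initSub X x j ⊔ initIdeal x s ^ (n + 1) • ⊤ := by
      rw [← Submodule.Quotient.mk_eq_zero]
      exact hu'
    have hus : u ∈ initSub X x s := by
      refine (sup_le (initSub_mono x hj.le) ?_ : _ ≤ initSub X x s) hu'
      exact Submodule.smul_mono_left (Ideal.pow_le_self (Nat.succ_ne_zero n))
    rw [Subtype.ext_iff]
    exact (Submodule.Quotient.mk_eq_zero _).2 (h.mem_initSub hu hj.le le_rfl hus)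
  · intro v
    obtain ⟨v, rfl⟩ := Submodule.mkQ_surjective _ v
    constructor
    · intro hv
      replace hv := (Submodule.Quotient.mk_eq_zero _).1 hv
      obtain ⟨a, ha, b, hb, rfl⟩ := Submodule.mem_sup.1 hv
      refine ⟨⟨Submodule.Quotient.mk a, ?_⟩, ?_⟩
      · rw [Submodule.mem_torsionBy_iff, ← Submodule.Quotient.mk_smul,
          Submodule.Quotient.mk_eq_zero]
        exact ha
      · change Submodule.Quotient.mk a = Submodule.Quotient.mk (a + b)
        rw [Submodule.Quotient.eq, sub_add_cancel_left]
        exact Submodule.neg_mem _ (Submodule.mem_sup_right hb)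
    · rintro ⟨⟨w, hw⟩, hwv⟩
      obtain ⟨w, rfl⟩ := Submodule.mkQ_surjective _ w
      rw [Submodule.mem_torsionBy_iff, Submodule.mkQ_apply, ← Submodule.Quotient.mk_smul,
        Submodule.Quotient.mk_eq_zero] at hw
      rw [← hwv]
      change Submodule.Quotient.mk w = 0
      rw [Submodule.Quotient.mk_eq_zero]
      exact Submodule.mem_sup_left hw

lemma partialLength_succ_add (h : IsDSeq X x s) {j : ℕ} (hj : j < s) (n : ℕ) :
    partialLength X x s j (n + 2) + colonLength X x j =
      partialLength X x s (j + 1) (n + 2) + partialLength X x s j (n + 1) := by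
  rw [h.partialLength_eq_add_colon hj (n + 1), h.partialLength_eq_add_colonLength hj n, add_assoc,
    add_comm (colonLength X x j)]

lemma partialLength_one (h : IsDSeq X x s) {j : ℕ} (hj : j < s) :
    partialLength X x s j 1 = partialLength X x s (j + 1) 1 := by
  have h0 : Module.length S
      (X ⧸ (colonSub X x j ⊔ initIdeal x s ^ 0 • ⊤ : Submodule S X)) = 0 := by
    rw [Module.length_eq_zero_iff, Submodule.Quotient.subsingleton_iff]
    simp
  rw [h.partialLength_eq_add_colon hj 0, h0, add_zero]

lemma partialLength_self (n : ℕ) : partialLength X x s s (n + 1) = partialLength X x s s 1 := by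
  have : ∀ n, (initSub X x s ⊔ initIdeal x s ^ (n + 1) • ⊤ : Submodule S X) = initSub X x s :=
    fun n => sup_eq_left.2 (Submodule.smul_mono_left (Ideal.pow_le_self (Nat.succ_ne_zero n)))
  rw [partialLength, partialLength, this n, this 0]

end IsDSeq

end DSequence

/-- Summing a polynomial in binomial form. -/
lemma sum_choose_step (t : ℕ) (a : ℕ → ℤ) (w : ℤ) (h h' : ℕ → ℤ) (h0 : h 0 = h' 0)
    (hstep : ∀ n, h (n + 1) + w = h' (n + 1) + h n)
    (hh : ∀ n, h' n = ∑ i ∈ Finset.range (t + 1), a i * ((n + t - i).choose (t - i))) (n : ℕ) :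
    h n = ∑ i ∈ Finset.range (t + 1 + 1), (if i = t + 1 then w else if i = t then a t - w else a i) *
      ((n + (t + 1) - i).choose (t + 1 - i)) := by
  have hsum : ∀ n, ∑ i ∈ Finset.range (t + 1 + 1),
      (if i = t + 1 then w else if i = t then a t - w else a i) *
      ((n + (t + 1) - i).choose (t + 1 - i) : ℤ) =
      ∑ i ∈ Finset.range (t + 1), a i * ((n + (t + 1) - i).choose (t + 1 - i)) - w * n := by
    intro n
    rw [Finset.sum_range_succ, Finset.sum_range_succ, Finset.sum_range_succ _ t,
      Finset.sum_congr rfl fun i hi => ?_]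
    rotate_left
    · exact fun i => a i * ((n + (t + 1) - i).choose (t + 1 - i))
    · rw [if_neg, if_neg]
      · have := Finset.mem_range.1 hi
        omega
      · have := Finset.mem_range.1 hi
        omega
    have e1 : n + (t + 1) - t = n + 1 := by omega
    have e2 : t + 1 - t = 1 := by omega
    simp only [e1, e2, Nat.choose_one_right, if_true, Nat.sub_self, Nat.choose_zero_right]
    rw [if_neg (by omega)]
    push_cast
    ring
  rw [hsum]
  induction n with
  | zero =>
    rw [h0, hh]
    simp only [Nat.cast_zero, mul_zero, sub_zero]
    refine Finset.sum_congr rfl fun i hi => ?_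
    simp only [zero_add, Nat.choose_self]
  | succ n ih =>
    have h1 := hstep n
    rw [hh, ih] at h1
    have h2 : ∀ i ∈ Finset.range (t + 1), a i * ((n + 1 + (t + 1) - i).choose (t + 1 - i) : ℤ) =
        a i * ((n + 1 + t - i).choose (t - i)) + a i * ((n + (t + 1) - i).choose (t + 1 - i)) := by
      intro i hi
      have hi := Finset.mem_range.1 hi
      have e1 : n + 1 + (t + 1) - i = (n + 1 + t - i) + 1 := by omega
      have e2 : t + 1 - i = (t - i) + 1 := by omega
      have e3 : n + (t + 1) - i = n + 1 + t - i := by omega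
      rw [e1, e2, e3, Nat.choose_succ_succ]
      push_cast
      ring
    rw [Finset.sum_congr rfl h2, Finset.sum_add_distrib]
    push_cast
    linarith

section DSequence
variable {S : Type*} [CommRing S] {X : Type*} [AddCommGroup X] [Module S X] {x : ℕ → S}

lemma partialLength_le (s j n : ℕ) : partialLength X x s j n ≤ partialLength X x s 0 n := by
  have hle : (initSub X x 0 ⊔ initIdeal x s ^ n • ⊤ : Submodule S X) ≤
      initSub X x j ⊔ initIdeal x s ^ n • ⊤ :=
    sup_le_sup_right (initSub_mono x j.zero_le) _
  exact Module.length_le_of_surjective _ (Submodule.factor_surjective hle)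

lemma partialLength_zero (s n : ℕ) : partialLength X x s 0 n =
    Module.length S (X ⧸ (initIdeal x s ^ n • ⊤ : Submodule S X)) := by
  have : (initSub X x 0 ⊔ initIdeal x s ^ n • ⊤ : Submodule S X) = initIdeal x s ^ n • ⊤ := by
    simp [initSub, initIdeal]
  rw [partialLength, this]

theorem IsDSeq.exists_coeffs {k : ℕ} (h : IsDSeq X x (k + 2)) (hfin : ∀ n, Module.length S
      (X ⧸ (initIdeal x (k + 2) ^ (n + 1) • ⊤ : Submodule S X)) ≠ ⊤) :
    ∃ a : ℕ → ℤ, (∀ n, ((Module.length S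
      (X ⧸ (initIdeal x (k + 2) ^ (n + 1) • ⊤ : Submodule S X))).toNat : ℤ) =
        ∑ i ∈ Finset.range (k + 2 + 1), a i * ((n + (k + 2) - i).choose (k + 2 - i))) ∧
      a 1 = (colonLength X x (k + 1)).toNat - (colonLength X x k).toNat := by
  have hp : ∀ j n, partialLength X x (k + 2) j (n + 1) ≠ ⊤ := fun j n =>
    ne_top_of_le_ne_top (by rw [partialLength_zero]; exact hfin n) (partialLength_le _ _ _)
  have hw : ∀ j < k + 2, colonLength X x j ≠ ⊤ := fun j hj =>
    ne_top_of_le_ne_top (hp j 0)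
      (by rw [h.partialLength_eq_add_colonLength hj]; exact le_self_add)
  set p : ℕ → ℕ → ℤ := fun j n => (partialLength X x (k + 2) j (n + 1)).toNat
  set w : ℕ → ℤ := fun j => (colonLength X x j).toNat
  have h0 : ∀ j < k + 2, p j 0 = p (j + 1) 0 := fun j hj => by
    simp only [p, zero_add, h.partialLength_one hj]
  have hstep : ∀ j < k + 2, ∀ n, p j (n + 1) + w j = p (j + 1) (n + 1) + p j n := fun j hj n => by
    have := congrArg ENat.toNat (h.partialLength_succ_add hj n)
    rw [ENat.toNat_add (hp _ _) (hw j hj), ENat.toNat_add (hp _ _) (hp _ _)] at this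
    simp only [p, w]
    exact_mod_cast this
  have main : ∀ t ≤ k, ∃ a : ℕ → ℤ, (∀ n, p (k - t) n =
      ∑ i ∈ Finset.range (t + 2 + 1), a i * ((n + (t + 2) - i).choose (t + 2 - i))) ∧
      a 1 = w (k + 1) - w k := by
    intro t
    induction t with
    | zero =>
      intro _
      have hs : ∀ n, p (k + 2) n = ∑ i ∈ Finset.range (0 + 1),
          (fun _ => p (k + 2) 0) i * ((n + 0 - i).choose (0 - i) : ℤ) := fun n => by
        simp [p, IsDSeq.partialLength_self (X := X) n]
      have h1 := sum_choose_step 0 _ (w (k + 1)) (p (k + 1)) _ (h0 _ (by omega))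
        (hstep _ (by omega)) hs
      have h2 := sum_choose_step 1 _ (w k) (p k) _ (h0 _ (by omega)) (hstep _ (by omega)) h1
      exact ⟨_, h2, by simp⟩
    | succ t ih =>
      intro ht
      obtain ⟨a, ha, ha1⟩ := ih (by omega)
      have e : k - t = k - (t + 1) + 1 := by omega
      rw [e] at ha
      have h1 := sum_choose_step (t + 2) _ (w (k - (t + 1))) (p (k - (t + 1))) _
        (h0 _ (by omega)) (hstep _ (by omega)) ha
      exact ⟨_, h1, by simpa using ha1⟩
  obtain ⟨a, ha, ha1⟩ := main k le_rfl
  refine ⟨a, fun n => ?_, ha1⟩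
  rw [← ha n, Nat.sub_self, ← partialLength_zero]

end DSequence

section FilterSeq
variable {S : Type u} [CommRing S] {X : Type u} [AddCommGroup X] [Module S X]

lemma length_powTors [IsNoetherianRing S] (I : Ideal S) :
    Module.length S (powTors I X) = Module.length S (H I 0 X) := by
  have h : powTors I X = LinearMap.range (H.ev I X) := by
    ext u
    constructor
    · rintro ⟨k, hk⟩
      exact H.mem_range_ev I u k hk
    · rintro ⟨y, rfl⟩
      exact H.ev_torsion I y
  rw [h, ← (LinearEquiv.ofInjective _ (H.ev_injective I)).length_eq]

lemma length_powTors_congr {S : Type*} [CommRing S] {X Y : Type*} [AddCommGroup X] [Module S X]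
    [AddCommGroup Y] [Module S Y] (I : Ideal S) (e : X ≃ₗ[S] Y) :
    Module.length S (powTors I X) = Module.length S (powTors I Y) := by
  have h : powTors I Y = (powTors I X).map e.toLinearMap := by
    ext y
    obtain ⟨u, rfl⟩ := e.surjective y
    simp only [mem_powTors, Submodule.mem_map, LinearEquiv.coe_coe, EmbeddingLike.apply_eq_iff_eq,
      exists_eq_right, ← _root_.map_smul, LinearEquiv.map_eq_zero_iff]
  rw [h, (e.submoduleMap (powTors I X)).length_eq]

lemma torsionBy_eq_powTors_congr {S : Type*} [CommRing S] {X Y : Type*} [AddCommGroup X]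
    [Module S X] [AddCommGroup Y] [Module S Y] (I : Ideal S) (e : X ≃ₗ[S] Y) {r : S}
    (h : Submodule.torsionBy S X r = powTors I X) :
    Submodule.torsionBy S Y r = powTors I Y := by
  ext y
  obtain ⟨u, rfl⟩ := e.surjective y
  have hu := SetLike.ext_iff.1 h u
  simpa only [mem_powTors, Submodule.mem_torsionBy_iff, ← _root_.map_smul,
    LinearEquiv.map_eq_zero_iff] using hu

variable (X) in
/-- `x` is, up to index `s`, a filter regular sequence on `X` all of whose members annihilate the
torsion submodules in question. -/
def IsFilterSeq [IsLocalRing S] (x : ℕ → S) (s : ℕ) : Prop :=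
  ∀ j < s, Submodule.torsionBy S (X ⧸ initSub X x j) (x j) =
    powTors (maximalIdeal S) (X ⧸ initSub X x j)

lemma IsFilterSeq.smul_mem_iff [IsLocalRing S] {x : ℕ → S} {s : ℕ} (h : IsFilterSeq X x s) {j : ℕ}
    (hj : j < s) (u : X) : x j • u ∈ initSub X x j ↔
      ∃ k, ∀ r ∈ maximalIdeal S ^ k, r • u ∈ initSub X x j := by
  have := SetLike.ext_iff.1 (h j hj) (Submodule.Quotient.mk u)
  simpa only [mem_powTors, Submodule.mem_torsionBy_iff, ← Submodule.Quotient.mk_smul,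
    Submodule.Quotient.mk_eq_zero] using this

lemma IsFilterSeq.isDSeq [IsLocalRing S] [IsNoetherianRing S] [Module.Finite S X] {x : ℕ → S}
    {s : ℕ} (h : IsFilterSeq X x s) : IsDSeq X x s where
  sq_mem j hj u hu := by
    obtain ⟨a, ha⟩ := (isPowTorsion_powTors (I := maximalIdeal S)
      (X ⧸ initSub X x j)).exists_pow_smul
    obtain ⟨k, hk⟩ := (h.smul_mem_iff hj _).1 hu
    refine (h.smul_mem_iff hj u).2 ⟨a + k, fun r hr => ?_⟩
    rw [pow_add] at hr
    refine Submodule.mul_induction_on hr (fun b hb c hc => ?_) fun b c hb hc => ?_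
    · have hc' : x j • c • u ∈ initSub X x j := by
        rw [smul_comm]
        exact hk c hc
      have hmem : Submodule.Quotient.mk (c • u) ∈
          powTors (maximalIdeal S) (X ⧸ initSub X x j) := by
        rw [← h j hj, Submodule.mem_torsionBy_iff, ← Submodule.Quotient.mk_smul,
          Submodule.Quotient.mk_eq_zero]
        exact hc'
      have := congrArg Subtype.val (ha b hb ⟨_, hmem⟩)
      rw [mul_smul, ← Submodule.Quotient.mk_eq_zero (initSub X x j)]
      exact this
    · rw [add_smul]
      exact Submodule.add_mem _ hb hc
  succ_mem j hj u hu := by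
    obtain ⟨k, hk⟩ := (h.smul_mem_iff (by omega) u).1 hu
    exact (h.smul_mem_iff hj u).2 ⟨k, fun r hr => initSub_mono x j.le_succ (hk r hr)⟩

lemma IsFilterSeq.colonLength_eq [IsLocalRing S] [IsNoetherianRing S] {x : ℕ → S} {s : ℕ}
    (h : IsFilterSeq X x s) {j : ℕ} (hj : j < s) :
    colonLength X x j = Module.length S (powTors (maximalIdeal S) (X ⧸ initSub X x j)) := by
  rw [colonLength, h j hj]

lemma comap_mkQ_smul_top {S : Type*} [CommRing S] {X : Type*} [AddCommGroup X] [Module S X]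
    (N : Submodule S X) (I : Ideal S) :
    (I • ⊤ : Submodule S (X ⧸ N)).comap N.mkQ = N ⊔ I • ⊤ := by
  have : (I • ⊤ : Submodule S (X ⧸ N)) = (I • ⊤ : Submodule S X).map N.mkQ := by
    rw [Submodule.map_smul'', Submodule.map_top, Submodule.range_mkQ]
  rw [this, Submodule.comap_map_mkQ]

/-- Two quotients of `X` with the same kernel are isomorphic. -/
noncomputable def equivOfKerEq {S : Type*} [CommRing S] {X Y Z : Type*} [AddCommGroup X]
    [Module S X] [AddCommGroup Y] [Module S Y] [AddCommGroup Z] [Module S Z] (f : X →ₗ[S] Y)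
    (g : X →ₗ[S] Z) (hf : Function.Surjective f) (hg : Function.Surjective g)
    (h : LinearMap.ker f = LinearMap.ker g) : Y ≃ₗ[S] Z :=
  (f.quotKerEquivOfSurjective hf).symm ≪≫ₗ Submodule.quotEquivOfEq _ _ h ≪≫ₗ
    g.quotKerEquivOfSurjective hg

/-- The first member of a sequence can be divided out. -/
noncomputable def quotInitSubEquiv {S : Type*} [CommRing S] {X : Type*} [AddCommGroup X]
    [Module S X] (x : ℕ → S) (j : ℕ) : (X ⧸ initSub X x (j + 1)) ≃ₗ[S]
      (QuotSMulTop (x 0) X ⧸ initSub (QuotSMulTop (x 0) X) (fun i => x (i + 1)) j) :=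
  equivOfKerEq (initSub X x (j + 1)).mkQ
    ((initSub (QuotSMulTop (x 0) X) (fun i => x (i + 1)) j).mkQ ∘ₗ (x 0 • (⊤ : Submodule S X)).mkQ)
    (fun y => by
      obtain ⟨u, rfl⟩ := Submodule.mkQ_surjective _ y
      exact ⟨u, rfl⟩)
    (fun y => by
      obtain ⟨v, rfl⟩ := Submodule.mkQ_surjective _ y
      obtain ⟨u, rfl⟩ := Submodule.mkQ_surjective _ v
      exact ⟨u, rfl⟩)
    (by
      rw [LinearMap.ker_comp, Submodule.ker_mkQ, Submodule.ker_mkQ, initSub, initSub,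
        initIdeal_succ', Submodule.sup_smul, Submodule.ideal_span_singleton_smul]
      exact (comap_mkQ_smul_top _ _).symm)

/-- The quotient by the first zero members of a sequence. -/
noncomputable def quotInitSubZeroEquiv {S : Type*} [CommRing S] {X : Type*} [AddCommGroup X]
    [Module S X] (x : ℕ → S) : (X ⧸ initSub X x 0) ≃ₗ[S] X :=
  Submodule.quotEquivOfEqBot _ (by simp [initSub, initIdeal])

lemma isFilterSeq_succ [IsLocalRing S] {x : ℕ → S} {s : ℕ}
    (h0 : Submodule.torsionBy S X (x 0) = powTors (maximalIdeal S) X)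
    (h : IsFilterSeq (QuotSMulTop (x 0) X) (fun i => x (i + 1)) s) : IsFilterSeq X x (s + 1) := by
  intro j hj
  cases j with
  | zero => exact torsionBy_eq_powTors_congr _ (quotInitSubZeroEquiv x).symm h0
  | succ j => exact torsionBy_eq_powTors_congr _ (quotInitSubEquiv x j).symm (h j (by omega))

end FilterSeq

section NoetherianCompletion

/-- A ring complete with respect to `I.map g`, which is dense over `A`, for a polynomial ring
`A` and its irrelevant ideal `I`, is Noetherian. -/
lemma isNoetherianRing_of_isAdicComplete_map {σ R S : Type*} [Finite σ] [CommRing R]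
    [IsNoetherianRing R] [CommRing S] (g : MvPolynomial σ R →+* S)
    [IsAdicComplete ((MvPolynomial.idealOfVars σ R).map g) S]
    (hg : Function.Surjective
      ((Ideal.Quotient.mk ((MvPolynomial.idealOfVars σ R).map g)).comp g)) :
    IsNoetherianRing S := by
  let J := MvPolynomial.idealOfVars σ R
  let A := MvPolynomial σ R
  let P := AdicCompletion J A
  have hP : IsNoetherianRing P :=
    isNoetherianRing_of_ringEquiv _ (MvPowerSeries.toAdicCompletionAlgEquiv σ R).toRingEquiv
  have hle : ∀ n, J ^ n ≤ ((J.map g) ^ n).comap g := fun n => by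
    rw [← Ideal.map_pow]
    exact Ideal.le_comap_map
  let F : (n : ℕ) → P →+* S ⧸ (J.map g) ^ n := fun n =>
    (Ideal.quotientMap _ g (hle n)).comp (AdicCompletion.evalₐ J n : P →+* A ⧸ J ^ n)
  have hF : ∀ {m n : ℕ} (hmn : m ≤ n), (Ideal.Quotient.factorPow (J.map g) hmn).comp (F n) = F m := by
    intro m n hmn
    refine RingHom.ext fun x => ?_
    obtain ⟨y, rfl⟩ := AdicCompletion.mk_surjective J A x
    change Ideal.Quotient.factorPow (J.map g) hmn (Ideal.quotientMap _ g (hle n)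
      (AdicCompletion.evalₐ J n (AdicCompletion.mk J A y))) = Ideal.quotientMap _ g (hle m)
      (AdicCompletion.evalₐ J m (AdicCompletion.mk J A y))
    rw [AdicCompletion.evalₐ_mk J n y, AdicCompletion.evalₐ_mk J m y, Ideal.quotientMap_mk,
      Ideal.quotientMap_mk, Ideal.Quotient.factorPow, Ideal.Quotient.factor_mk, ← sub_eq_zero, ← map_sub,
      ← map_sub, Ideal.Quotient.eq_zero_iff_mem]
    refine hle m ?_
    have := (y.2 hmn).symm
    rw [SModEq.sub_mem] at this
    simpa using this
  let f : P →+* S := IsAdicComplete.liftRingHom (J.map g) F hF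
  have hf : ∀ n x, Ideal.Quotient.mk ((J.map g) ^ n) (f x) = F n x := fun n x =>
    IsAdicComplete.mk_liftRingHom _ F hF n x
  have hfg : f.comp (algebraMap A P) = g := by
    refine RingHom.ext fun a => ?_
    refine (IsHausdorff.eq_iff_smodEq (I := J.map g)).2 fun n => ?_
    rw [SModEq.sub_mem, smul_eq_mul, Ideal.mul_top, ← Ideal.Quotient.eq, RingHom.comp_apply, hf]
    simp only [F, RingHom.comp_apply]
    change Ideal.quotientMap _ g _ (AdicCompletion.evalₐ J n (algebraMap A P a)) = _
    rw [AlgHom.commutes]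
    rfl
  have := AdicCompletion.isAdicComplete_self J (MvPolynomial.idealOfVars_fg σ R)
  have hmap : (J.map (algebraMap A P)).map f = J.map g := by rw [Ideal.map_map, hfg]
  have hfs : Function.Surjective f := by
    have : IsHausdorff ((J.map (algebraMap A P)).map f) S := by rw [hmap]; infer_instance
    refine surjective_of_mk_map_comp_surjective (I := J.map (algebraMap A P)) f fun y => ?_
    obtain ⟨z, rfl⟩ := Ideal.Quotient.mk_surjective y
    obtain ⟨a, ha⟩ := hg (Ideal.Quotient.mk _ z)
    refine ⟨algebraMap A P a, ?_⟩
    rw [RingHom.comp_apply, ← RingHom.comp_apply f, hfg, Ideal.Quotient.eq, hmap,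
      ← Ideal.Quotient.eq]
    exact ha
  exact isNoetherianRing_of_surjective _ _ f hfs

instance isNoetherianRing_adicCompletion {R : Type*} [CommRing R] [IsNoetherianRing R]
    (I : Ideal R) : IsNoetherianRing (AdicCompletion I R) := by
  obtain ⟨s, hs⟩ := I.fg_of_isNoetherianRing
  let g0 : MvPolynomial s R →ₐ[R] R := MvPolynomial.aeval (fun i : s => (i : R))
  let g : MvPolynomial s R →+* AdicCompletion I R := (algebraMap R _).comp (g0 : _ →+* R)
  have hmap : (MvPolynomial.idealOfVars s R).map g = I.map (algebraMap R (AdicCompletion I R)) := by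
    rw [← Ideal.map_map]
    congr 1
    rw [MvPolynomial.idealOfVars, Ideal.map_span, ← Set.range_comp, ← hs]
    congr 1
    ext r
    simp [g0]
  have hc := AdicCompletion.isAdicComplete_self I I.fg_of_isNoetherianRing
  rw [← hmap] at hc
  refine isNoetherianRing_of_isAdicComplete_map g fun y => ?_
  obtain ⟨z, rfl⟩ := Ideal.Quotient.mk_surjective y
  obtain ⟨r, hr⟩ := Ideal.Quotient.mk_surjective (AdicCompletion.evalOneₐ I z)
  refine ⟨MvPolynomial.C r, ?_⟩
  rw [RingHom.comp_apply, Ideal.Quotient.eq, hmap,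
    ← AdicCompletion.ker_evalOneₐ_eq_map I I.fg_of_isNoetherianRing, RingHom.mem_ker, map_sub,
    sub_eq_zero]
  refine Eq.trans ?_ hr
  change AdicCompletion.evalOneₐ I (algebraMap R _ (MvPolynomial.aeval _ (MvPolynomial.C r))) = _
  rw [MvPolynomial.aeval_C, AlgHom.commutes]
  rfl

end NoetherianCompletion

section DimLE

variable {S : Type u} [CommRing S]

/-- All primes in the support of `N` have coheight at most `k`. -/
def DimLE (k : ℕ) (S : Type*) [CommRing S] (N : Type*) [AddCommGroup N] [Module S N] : Prop :=
  ∀ p ∈ Module.support S N, ringKrullDim (S ⧸ p.asIdeal) ≤ k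

section

variable {k : ℕ} {A B C : Type*} [AddCommGroup A] [Module S A] [AddCommGroup B] [Module S B]
  [AddCommGroup C] [Module S C]

lemma DimLE.of_injective (h : DimLE k S B) (f : A →ₗ[S] B) (hf : Function.Injective f) :
    DimLE k S A := fun p hp => h p (Module.support_subset_of_injective f hf hp)

lemma DimLE.of_surjective (h : DimLE k S A) (f : A →ₗ[S] B) (hf : Function.Surjective f) :
    DimLE k S B := fun p hp => h p (Module.support_subset_of_surjective f hf hp)

lemma support_subset_of_exact {f : A →ₗ[S] B} {g : B →ₗ[S] C} (h : Function.Exact f g) :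
    Module.support S B ⊆ Module.support S A ∪ Module.support S C := by
  rw [Module.support_of_exact (f := (LinearMap.ker g).subtype) (g := g.rangeRestrict)
    (fun y => by simp [LinearMap.rangeRestrict, Subtype.ext_iff]) (Submodule.subtype_injective _)
    g.surjective_rangeRestrict]
  refine Set.union_subset_union ?_ (Module.support_subset_of_injective _
    (Submodule.subtype_injective _))
  refine Module.support_subset_of_surjective (f.codRestrict (LinearMap.ker g) fun a => h.apply_apply_eq_zero a) ?_
  rintro ⟨b, hb⟩
  obtain ⟨a, rfl⟩ := (h b).1 hb
  exact ⟨a, rfl⟩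

lemma DimLE.of_exact {f : A →ₗ[S] B} {g : B →ₗ[S] C} (h : Function.Exact f g)
    (hA : DimLE k S A) (hC : DimLE k S C) : DimLE k S B := fun p hp =>
  (support_subset_of_exact h hp).elim (hA p) (hC p)

lemma DimLE.supportDim_le (h : DimLE k S A) : Module.supportDim S A ≤ k := by
  refine iSup_le fun l => ?_
  refine le_trans ?_ (h l.head.1 l.head.2)
  rw [ringKrullDim_quotient]
  let l' : LTSeries (PrimeSpectrum.zeroLocus (l.head.1.asIdeal : Set S)) :=
    { length := l.length
      toFun := fun i => ⟨(l i).1, (l.head_le i : l.head.1 ≤ (l i).1)⟩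
      step := fun i => l.step i }
  exact Order.LTSeries.length_le_krullDim l'

lemma ringKrullDim_le_of_mem_support {p : PrimeSpectrum S} (hp : p ∈ Module.support S A) :
    ringKrullDim (S ⧸ p.asIdeal) ≤ Module.supportDim S A := by
  rw [ringKrullDim_quotient]
  refine Order.krullDim_le_of_strictMono
    (fun q => ⟨q.1, Module.mem_support_mono (p := p) (q := q.1) q.2 hp⟩) fun a b hab => hab

lemma dimLE_iff : DimLE k S A ↔ Module.supportDim S A ≤ k :=
  ⟨DimLE.supportDim_le, fun h _ hp => (ringKrullDim_le_of_mem_support hp).trans h⟩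

end

variable [IsLocalRing S] [IsNoetherianRing S]

lemma DimLE.of_quotSMulTop {k : ℕ} {N : Type*} [AddCommGroup N] [Module S N] [Module.Finite S N]
    {x : S} (hx : x ∈ maximalIdeal S) (h : DimLE k S (QuotSMulTop x N)) : DimLE (k + 1) S N := by
  rw [dimLE_iff] at h ⊢
  refine (Module.supportDim_le_supportDim_quotSMulTop_succ hx).trans ?_
  push_cast
  gcongr

lemma ringKrullDim_quotient_maximalIdeal : ringKrullDim (S ⧸ maximalIdeal S) = 0 :=
  ringKrullDim_eq_zero_of_field (ResidueField S)

lemma eq_maximalIdeal_of_ringKrullDim_le {p : Ideal S} [p.IsPrime]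
    (h : ringKrullDim (S ⧸ p) ≤ 0) : p = maximalIdeal S := by
  by_contra hne
  have hlt : p < maximalIdeal S := lt_of_le_of_ne (le_maximalIdeal ‹p.IsPrime›.ne_top) hne
  have := (ringKrullDim_quotient_add_one_le hlt).trans h
  rw [ringKrullDim_quotient_maximalIdeal] at this
  exact absurd this (by decide)

/-- The dimension drops when `x` avoids the nonmaximal minimal primes of the support. -/
lemma DimLE.quotSMulTop {k : ℕ} {N : Type*} [AddCommGroup N] [Module S N] [Module.Finite S N]
    (h : DimLE (k + 1) S N) {x : S}
    (hx : ∀ p ∈ (Module.annihilator S N).minimalPrimes, p ≠ maximalIdeal S → x ∉ p) :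
    DimLE k S (QuotSMulTop x N) := by
  intro p hp
  rw [Module.support_quotSMulTop] at hp
  have hxp : x ∈ p.asIdeal := by simpa [PrimeSpectrum.mem_zeroLocus] using hp.2
  obtain ⟨q, hq, hqp⟩ := Ideal.exists_minimalPrimes_le (Module.mem_support_iff_of_finite.1 hp.1)
  have hqP : q.IsPrime := hq.1.1
  by_cases hqm : q = maximalIdeal S
  · have : p.asIdeal = maximalIdeal S := le_antisymm (le_maximalIdeal p.2.ne_top) (hqm ▸ hqp)
    rw [this, ringKrullDim_quotient_maximalIdeal]
    exact_mod_cast Nat.zero_le k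
  · have hne : q ≠ p.asIdeal := by
      rintro rfl
      exact hx _ hq hqm hxp
    have h1 := (ringKrullDim_quotient_add_one_le (lt_of_le_of_ne hqp hne)).trans
      (h ⟨q, hqP⟩ (Module.mem_support_iff_of_finite.2 hq.1.2))
    have hc : ((k + 1 : ℕ) : WithBot ℕ∞) = (k : WithBot ℕ∞) + 1 := by push_cast; rfl
    rw [hc] at h1
    exact ENat.WithBot.add_le_add_one_right_iff.1 h1

lemma dimLE_zero_iff {N : Type*} [AddCommGroup N] [Module S N] [Module.Finite S N] :
    DimLE 0 S N ↔ Module.length S N ≠ ⊤ := by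
  constructor
  · intro h
    refine IsPowTorsion.length_ne_top (maximalIdeal S) ?_
    refine isPowTorsion_of_associatedPrimes _ fun p hp => ?_
    have hpP : p.IsPrime := hp.isPrime
    have hps : (⟨p, hpP⟩ : PrimeSpectrum S) ∈ Module.support S N :=
      Module.mem_support_iff_of_finite.2 (by
        obtain ⟨-, v, hv⟩ := mem_associatedPrimes_iff.1 hp
        exact fun r hr => (hv r).2 (Module.mem_annihilator.1 hr v))
    exact (eq_maximalIdeal_of_ringKrullDim_le (by exact_mod_cast h _ hps)).ge
  · intro h p hp
    have hT := isPowTorsion_of_length_ne_top h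
    obtain ⟨k, hk⟩ := hT.exists_pow_smul
    have hle : maximalIdeal S ^ k ≤ Module.annihilator S N := fun r hr =>
      Module.mem_annihilator.2 fun v => hk r hr v
    have := p.2.le_of_pow_le (hle.trans (Module.mem_support_iff_of_finite.1 hp))
    rw [le_antisymm (le_maximalIdeal p.2.ne_top) this, ringKrullDim_quotient_maximalIdeal]
    rfl

end DimLE

section Generic

variable {S : Type u} [CommRing S] [IsLocalRing S]

/-- A set of elements of the maximal ideal of `S` which is closed under powers and contains,
in every power of the maximal ideal, elements avoiding given nonmaximal primes. -/
structure IsGeneric (G : Set S) : Prop where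
  mem_maximalIdeal : ∀ x ∈ G, x ∈ maximalIdeal S
  pow_mem : ∀ x ∈ G, ∀ n, x ^ (n + 1) ∈ G
  exists_avoid : ∀ (t : ℕ) (P : Set (Ideal S)), P.Finite →
    (∀ p ∈ P, p.IsPrime ∧ p ≠ maximalIdeal S) → ∃ x ∈ G, x ∈ maximalIdeal S ^ t ∧ ∀ p ∈ P, x ∉ p

lemma isGeneric_image [IsNoetherianRing S] {R : Type u} [CommRing R] [IsLocalRing R]
    [IsNoetherianRing R] [Algebra R S]
    (hRS : maximalIdeal S = (maximalIdeal R).map (algebraMap R S)) :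
    IsGeneric (algebraMap R S '' (maximalIdeal R : Set R)) where
  mem_maximalIdeal := by
    rintro _ ⟨x, hx, rfl⟩
    rw [hRS]
    exact Ideal.mem_map_of_mem _ hx
  pow_mem := by
    rintro _ ⟨x, hx, rfl⟩ n
    exact ⟨x ^ (n + 1), Ideal.pow_mem_of_mem _ hx _ n.succ_pos, by simp⟩
  exists_avoid t P hP hp := by
    obtain ⟨z, hz, hzp⟩ := exists_mem_forall_notMem (I := maximalIdeal R ^ (t + 1))
      (hP.image (Ideal.comap (algebraMap R S)))
      (by
        rintro _ ⟨p, hpP, rfl⟩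
        have := (hp p hpP).1
        exact Ideal.comap_isPrime _ _)
      (by
        rintro _ ⟨p, hpP, rfl⟩ hle
        have hpr := (hp p hpP).1
        have h1 := (Ideal.comap_isPrime (algebraMap R S) p).le_of_pow_le hle
        refine not_maximalIdeal_le hpr (hp p hpP).2 ?_
        rw [hRS]
        exact Ideal.map_le_iff_le_comap.2 h1)
    refine ⟨_, ⟨z, Ideal.pow_le_self t.succ_ne_zero hz, rfl⟩, ?_, fun p hpP =>
      hzp _ ⟨p, hpP, rfl⟩⟩
    rw [hRS, ← Ideal.map_pow]
    exact Ideal.mem_map_of_mem _ (Ideal.pow_le_pow_right t.le_succ hz)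

variable [IsNoetherianRing S]

lemma exists_pow_smul_powTors (X : Type u) [AddCommGroup X] [Module S X] [Module.Finite S X] :
    ∃ t, ∀ x ∈ maximalIdeal S ^ t, ∀ v ∈ powTors (maximalIdeal S) X, x • v = 0 := by
  have h := isPowTorsion_powTors (maximalIdeal S) X
  obtain ⟨t, ht⟩ := IsPowTorsion.exists_pow_smul _ h
  exact ⟨t, fun x hx v hv => congrArg Subtype.val (ht x hx ⟨v, hv⟩)⟩

lemma torsionBy_eq_powTors {X : Type u} [AddCommGroup X] [Module S X] [Module.Finite S X] {x : S}
    (hx : ∀ p ∈ associatedPrimes S X, p ≠ maximalIdeal S → x ∉ p)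
    (h : ∀ v ∈ powTors (maximalIdeal S) X, x • v = 0) :
    Submodule.torsionBy S X x = powTors (maximalIdeal S) X := by
  refine le_antisymm (fun v hv => ?_) fun v hv => (Submodule.mem_torsionBy_iff _ _).2 (h v hv)
  have h := isPowTorsion_torsionBy hx
  obtain ⟨k, hk⟩ := h ⟨v, hv⟩
  exact (mem_powTors (maximalIdeal S)).2 ⟨k, fun r hr => congrArg Subtype.val (hk r hr)⟩

/-- The nonmaximal associated primes. -/
def nonmaxAss (S : Type*) [CommRing S] [IsLocalRing S] (X : Type*) [AddCommGroup X] [Module S X] :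
    Set (Ideal S) := {p ∈ associatedPrimes S X | p ≠ maximalIdeal S}

lemma nonmaxAss_finite (X : Type*) [AddCommGroup X] [Module S X] [Module.Finite S X] :
    (nonmaxAss S X).Finite := (associatedPrimes.finite S X).subset fun _ h => h.1

lemma isPrime_of_mem_nonmaxAss {X : Type*} [AddCommGroup X] [Module S X] {p : Ideal S}
    (h : p ∈ nonmaxAss S X) : p.IsPrime ∧ p ≠ maximalIdeal S := ⟨h.1.isPrime, h.2⟩

lemma IsGeneric.exists_torsionBy_eq {G : Set S} (hG : IsGeneric G) (X : Type u) [AddCommGroup X]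
    [Module S X] [Module.Finite S X] (t : ℕ) (P : Set (Ideal S)) (hP : P.Finite)
    (hp : ∀ p ∈ P, p.IsPrime ∧ p ≠ maximalIdeal S) : ∃ x ∈ G, x ∈ maximalIdeal S ^ t ∧
      (∀ p ∈ P, x ∉ p) ∧
      ∀ n, Submodule.torsionBy S X (x ^ (n + 1)) = powTors (maximalIdeal S) X := by
  obtain ⟨t', ht'⟩ := exists_pow_smul_powTors (S := S) X
  obtain ⟨x, hxG, hxt, hxp⟩ := hG.exists_avoid (t + t') (P ∪ nonmaxAss S X)
    (hP.union (nonmaxAss_finite X)) fun p h => h.elim (hp p) isPrime_of_mem_nonmaxAss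
  refine ⟨x, hxG, Ideal.pow_le_pow_right (by omega) hxt, fun p h => hxp p (Or.inl h), fun n => ?_⟩
  refine torsionBy_eq_powTors (fun p hpX hpm hmem => hxp p (Or.inr ⟨hpX, hpm⟩)
    (hpX.isPrime.mem_of_pow_mem _ hmem)) (ht' _ ?_)
  rw [pow_succ']
  exact Ideal.mul_mem_right _ _ (Ideal.pow_le_pow_right (by omega) hxt)

lemma IsGeneric.exists_isFilterSeq {G : Set S} (hG : IsGeneric G) (s : ℕ) (X : Type u)
    [AddCommGroup X] [Module S X] [Module.Finite S X] :
    ∃ y : ℕ → S, (∀ i, y i ∈ G) ∧ IsFilterSeq X y s := by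
  induction s generalizing X with
  | zero =>
    obtain ⟨x, hx, -⟩ := hG.exists_avoid 0 ∅ Set.finite_empty (by simp)
    exact ⟨fun _ => x, fun _ => hx, fun j hj => absurd hj (by omega)⟩
  | succ s ih =>
    obtain ⟨x, hxG, -, -, hx⟩ := hG.exists_torsionBy_eq X 0 ∅ Set.finite_empty (by simp)
    obtain ⟨y, hyG, hy⟩ := ih (QuotSMulTop x X)
    refine ⟨fun | 0 => x | i + 1 => y i, fun i => ?_, isFilterSeq_succ ?_ hy⟩
    · cases i with
      | zero => exact hxG
      | succ i => exact hyG i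
    · simpa using hx 0

lemma IsFilterSeq.dimLE {X : Type u} [AddCommGroup X] [Module S X] [Module.Finite S X] {x : ℕ → S}
    {s : ℕ} (h : IsFilterSeq X x s) {d : ℕ} (hd : DimLE (s + d) S X) :
    DimLE d S (X ⧸ initSub X x s) := by
  induction s generalizing d with
  | zero =>
    rw [zero_add] at hd
    exact hd.of_surjective (initSub X x 0).mkQ (Submodule.mkQ_surjective _)
  | succ s ih =>
    have h1 := ih (fun j hj => h j (by omega)) (d := d + 1) (by rwa [show s + (d + 1) = s + 1 + d by omega])
    have h2 : DimLE d S (QuotSMulTop (x s) (X ⧸ initSub X x s)) := by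
      refine h1.quotSMulTop fun p hp hpm hxp => hpm ?_
      have hpa := Module.associatedPrimes.minimalPrimes_annihilator_subset_associatedPrimes _ _ hp
      obtain ⟨hpP, v, hv⟩ := mem_associatedPrimes_iff.1 hpa
      have : v ∈ powTors (maximalIdeal S) (X ⧸ initSub X x s) := by
        rw [← h s (by omega)]
        exact (Submodule.mem_torsionBy_iff _ _).2 ((hv _).1 hxp)
      obtain ⟨k, hk⟩ := (mem_powTors (maximalIdeal S)).1 this
      exact le_antisymm (le_maximalIdeal hpP.ne_top)
        (hpP.le_of_pow_le fun r hr => (hv r).2 (hk r hr))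
    refine h2.of_surjective (Submodule.liftQ _ ((initSub X x s).liftQ (initSub X x (s + 1)).mkQ
      (by rw [Submodule.ker_mkQ]; exact initSub_mono x s.le_succ)) ?_) ?_
    · intro v hv
      obtain ⟨w, -, rfl⟩ := (Submodule.mem_smul_pointwise_iff_exists _ _ _).1 hv
      obtain ⟨w, rfl⟩ := Submodule.mkQ_surjective _ w
      rw [LinearMap.mem_ker, ← map_smul]
      refine (Submodule.Quotient.mk_eq_zero _).2 ?_
      refine Submodule.smul_mem_smul ?_ Submodule.mem_top
      rw [initIdeal_eq_span]
      exact Ideal.subset_span ⟨⟨s, by omega⟩, rfl⟩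
    · intro v
      obtain ⟨w, rfl⟩ := Submodule.mkQ_surjective _ v
      exact ⟨Submodule.mkQ _ ((initSub X x s).mkQ w), rfl⟩

end Generic

lemma exists_maximal_disjoint {S : Type*} [CommRing S] {J : Type*} [AddCommGroup J] [Module S J]
    {N K : Submodule S J} (h : Disjoint N K) :
    ∃ C, N ≤ C ∧ Disjoint C K ∧ ∀ C', C ≤ C' → Disjoint C' K → C' = C := by
  obtain ⟨C, hNC, hC⟩ := zorn_le_nonempty₀ {C : Submodule S J | Disjoint C K}
    (fun c hc hchain y hy => ⟨sSup c,
      (hchain.directedOn.disjoint_sSup_left).2 fun a ha => hc ha, fun z hz => le_sSup hz⟩) N h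
  exact ⟨C, hNC, hC.1, fun C' hle hC' => (hC.eq_of_le hC' hle).symm⟩

section Hull

variable {S : Type u} [CommRing S] [IsLocalRing S]

/-- `E` is an injective module which is an essential extension of a copy of the residue field,
spanned by `e`. -/
structure IsResidueHull (E : Type u) [AddCommGroup E] [Module S E] (e : E) : Prop where
  baer : Module.Baer S E
  ne_zero : e ≠ 0
  smul_eq_zero : ∀ r ∈ maximalIdeal S, r • e = 0
  essential : ∀ N : Submodule S E, Disjoint N (Submodule.span S {e}) → N = ⊥

lemma baer_of_retract {J E : Type u} [AddCommGroup J] [Module S J] [AddCommGroup E] [Module S E]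
    (hJ : Module.Baer S J) (i : E →ₗ[S] J) (p : J →ₗ[S] E) (h : ∀ x, p (i x) = x) :
    Module.Baer S E := by
  intro I g
  obtain ⟨g', hg'⟩ := hJ I (i ∘ₗ g)
  exact ⟨p ∘ₗ g', fun x hx => by simp [hg' x hx, h]⟩

variable (S) in
lemma exists_isResidueHull : ∃ (E : Type u) (_ : AddCommGroup E) (_ : Module S E) (e : E),
    IsResidueHull (S := S) E e := by
  obtain ⟨J, _, _, hJ, i, hi⟩ : ∃ (J : Type u) (_ : AddCommGroup J) (_ : Module S J),
      Module.Baer S J ∧ ∃ i : ResidueField S →ₗ[S] J, Function.Injective i := by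
    let P := (EnoughInjectives.presentation (ModuleCat.of S (ResidueField S))).some
    have := P.injective
    refine ⟨P.J, inferInstance, inferInstance,
      Module.Baer.iff_injective.2 ((Module.injective_iff_injective_object S P.J).2 P.injective),
      P.f.hom, (ModuleCat.mono_iff_injective _).1 P.mono⟩
  let e : J := i 1
  let k : Submodule S J := Submodule.span S {e}
  obtain ⟨C, -, hCk, hCmax⟩ := exists_maximal_disjoint (S := S) (J := J) (N := ⊥) (K := k)
    disjoint_bot_left
  obtain ⟨E, hkE, hEC, hEmax⟩ := exists_maximal_disjoint hCk.symm
  have heE : e ∈ E := hkE (Submodule.mem_span_singleton_self e)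
  let φ : E →ₗ[S] J ⧸ C := C.mkQ ∘ₗ E.subtype
  have hφ : Function.Injective φ := by
    rw [← LinearMap.ker_eq_bot, eq_bot_iff]
    intro v hv
    have hvC : (v : J) ∈ C := (Submodule.Quotient.mk_eq_zero _).1 (LinearMap.mem_ker.1 hv)
    exact Subtype.ext (Submodule.disjoint_def.1 hEC _ v.2 hvC)
  obtain ⟨g, hg⟩ := hJ.extension_property φ hφ E.subtype
  have hgE (v : J) (hv : v ∈ E) : g (C.mkQ v) = v := LinearMap.congr_fun hg ⟨v, hv⟩
  have key : C.comap (g ∘ₗ C.mkQ) = C := by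
    have : Disjoint (C ⊔ C.comap (g ∘ₗ C.mkQ)) k := by
      rw [sup_eq_right.2]
      · refine Submodule.disjoint_def.2 fun v hv hvk => ?_
        have h2 : g (C.mkQ v) ∈ C := hv
        rw [hgE v (hkE hvk)] at h2
        exact Submodule.disjoint_def.1 hCk v h2 hvk
      · intro v hv
        have : C.mkQ v = 0 := (Submodule.Quotient.mk_eq_zero _).2 hv
        simp [this]
    exact le_antisymm (le_sup_right.trans (hCmax _ le_sup_left this).le) fun v hv => by
      have : C.mkQ v = 0 := (Submodule.Quotient.mk_eq_zero _).2 hv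
      simp [this]
  have hrange : LinearMap.range (g ∘ₗ C.mkQ) = E := by
    refine hEmax _ (fun v hv => ⟨v, hgE v hv⟩) (Submodule.disjoint_def.2 ?_)
    rintro _ ⟨v, rfl⟩ hv
    have : v ∈ C := by
      rw [← key]
      exact hv
    have : C.mkQ v = 0 := (Submodule.Quotient.mk_eq_zero _).2 this
    simp [this]
  refine ⟨E, inferInstance, inferInstance, ⟨e, heE⟩, ?_, ?_, ?_, ?_⟩
  · exact baer_of_retract hJ E.subtype ((g ∘ₗ C.mkQ).codRestrict E fun v => by
      rw [← hrange]
      exact ⟨v, rfl⟩) fun v => Subtype.ext (hgE v v.2)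
  · intro h
    have : i 1 = 0 := congrArg Subtype.val h
    exact one_ne_zero (hi (this.trans (_root_.map_zero i).symm))
  · intro r hr
    refine Subtype.ext ?_
    change r • i 1 = 0
    rw [← _root_.map_smul, Algebra.smul_def, mul_one,
      show algebraMap S (ResidueField S) r = 0 from (residue_eq_zero_iff r).2 hr, _root_.map_zero]
  · intro N hN
    have h1 : Disjoint (N.map E.subtype) k := by
      refine Submodule.disjoint_def.2 ?_
      rintro _ ⟨v, hv, rfl⟩ hvk
      obtain ⟨a, ha⟩ := Submodule.mem_span_singleton.1 hvk
      exact congrArg Subtype.val (Submodule.disjoint_def.1 hN v hv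
        (Submodule.mem_span_singleton.2 ⟨a, Subtype.ext ha⟩))
    have h2 : Disjoint (C ⊔ N.map E.subtype) k := by
      refine Submodule.disjoint_def.2 fun v hv hvk => ?_
      obtain ⟨c, hc, n, hn, rfl⟩ := Submodule.mem_sup.1 hv
      obtain ⟨n, hnN, rfl⟩ := hn
      have hcE : c ∈ E := by
        have := E.sub_mem (hkE hvk) n.2
        simpa using this
      have : c = 0 := Submodule.disjoint_def.1 hEC c hcE hc
      subst this
      rw [zero_add] at hvk ⊢
      exact Submodule.disjoint_def.1 h1 _ ⟨n, hnN, rfl⟩ hvk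
    have h3 := hCmax _ le_sup_left h2
    refine eq_bot_iff.2 fun v hv => ?_
    have hvC : (v : J) ∈ C := h3 ▸ Submodule.mem_sup_right ⟨v, hv, rfl⟩
    exact Subtype.ext (Submodule.disjoint_def.1 hEC _ v.2 hvC)

namespace IsResidueHull

variable {E : Type u} [AddCommGroup E] [Module S E] {e : E}

lemma exists_ne_zero (hE : IsResidueHull (S := S) E e) {A : Type u} [AddCommGroup A] [Module S A] {a : A} (ha : a ≠ 0) :
    ∃ f : A →ₗ[S] E, f a ≠ 0 := by
  let t := LinearMap.toSpanSingleton S A a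
  let t' : (S ⧸ LinearMap.ker t) →ₗ[S] A := (LinearMap.ker t).liftQ t le_rfl
  have ht' : Function.Injective t' := LinearMap.ker_eq_bot.1 (Submodule.ker_liftQ_eq_bot _ _ _ le_rfl)
  have hle : LinearMap.ker t ≤ maximalIdeal S := by
    refine le_maximalIdeal fun h => ha ?_
    have h1 : (1 : S) ∈ LinearMap.ker t := h ▸ Submodule.mem_top
    simpa [t] using h1
  obtain ⟨f, hf⟩ := hE.baer.extension_property t' ht'
    ((LinearMap.ker t).liftQ (LinearMap.toSpanSingleton S E e) fun r hr => by
      simpa using hE.smul_eq_zero r (hle hr))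
  refine ⟨f, ?_⟩
  have h1 := LinearMap.congr_fun hf ((LinearMap.ker t).mkQ 1)
  have h2 : f (t 1) = LinearMap.toSpanSingleton S E e 1 := h1
  rw [LinearMap.toSpanSingleton_apply_one, LinearMap.toSpanSingleton_apply_one] at h2
  rw [h2]
  exact hE.ne_zero

end IsResidueHull

end Hull

lemma mem_smul_top_pi_iff {S : Type*} [CommRing S] (I : Ideal S) {n : ℕ} (x : Fin n → S) :
    x ∈ (I • ⊤ : Submodule S (Fin n → S)) ↔ ∀ i, x i ∈ I := by
  constructor
  · intro h i
    have h1 : x i ∈ (I • ⊤ : Submodule S (Fin n → S)).map (LinearMap.proj i) := ⟨x, h, rfl⟩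
    rw [Submodule.map_smul''] at h1
    have h2 := Submodule.smul_mono le_rfl le_top h1
    rwa [Ideal.smul_eq_mul, Ideal.mul_top] at h2
  · intro h
    rw [pi_eq_sum_univ' x]
    exact Submodule.sum_mem _ fun i _ => Submodule.smul_mem_smul (h i) Submodule.mem_top

lemma isPrecomplete_pi {S : Type*} [CommRing S] (I : Ideal S) [IsPrecomplete I S] (n : ℕ) :
    IsPrecomplete I (Fin n → S) where
  prec' f hf := by
    have h1 (i : Fin n) : ∃ L : S, ∀ k, f k i ≡ L [SMOD (I ^ k • ⊤ : Submodule S S)] := by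
      refine IsPrecomplete.prec inferInstance fun {a b} hab => ?_
      have := SModEq.sub_mem.1 (hf hab)
      rw [mem_smul_top_pi_iff] at this
      rw [SModEq.sub_mem, Ideal.smul_eq_mul, Ideal.mul_top]
      exact this i
    choose L hL using h1
    refine ⟨L, fun k => ?_⟩
    rw [SModEq.sub_mem, mem_smul_top_pi_iff]
    intro i
    have := SModEq.sub_mem.1 (hL i k)
    rwa [Ideal.smul_eq_mul, Ideal.mul_top] at this

lemma finite_of_finite_quotSMulTop {S : Type*} [CommRing S] (I : Ideal S) [IsPrecomplete I S]
    {K : Type*} [AddCommGroup K] [Module S K] [IsHausdorff I K] {x : S} (hx : x ∈ I)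
    (h : Module.Finite S (QuotSMulTop x K)) : Module.Finite S K := by
  obtain ⟨n, f, hf⟩ := Module.Finite.exists_fin' S (QuotSMulTop x K)
  have hlift (i : Fin n) : ∃ v : K, Submodule.mkQ _ v = f (Pi.single i 1) :=
    Submodule.mkQ_surjective _ _
  choose v hv using hlift
  let g : (Fin n → S) →ₗ[S] K := Fintype.linearCombination S v
  have := isPrecomplete_pi I n
  have hle : (x • (⊤ : Submodule S K)) ≤ I • ⊤ := by
    intro w hw
    obtain ⟨w, -, rfl⟩ := (Submodule.mem_smul_pointwise_iff_exists _ _ _).1 hw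
    exact Submodule.smul_mem_smul hx Submodule.mem_top
  have hg : Submodule.mkQ (x • (⊤ : Submodule S K)) ∘ₗ g = f := by
    refine LinearMap.pi_ext' fun i => LinearMap.ext_ring ?_
    simpa [g] using hv i
  refine Module.Finite.of_surjective g (surjective_of_mkQ_comp_surjective (I := I) fun w => ?_)
  obtain ⟨w, rfl⟩ := Submodule.mkQ_surjective _ w
  obtain ⟨u, hu⟩ := hf (Submodule.mkQ _ w)
  refine ⟨u, ?_⟩
  rw [← hg] at hu
  refine (Submodule.Quotient.eq _).2 (hle ?_)
  exact (Submodule.Quotient.eq _).1 hu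

lemma exact_lcomp {S : Type u} [CommRing S] {E A B C : Type u} [AddCommGroup E] [Module S E]
    (hE : Module.Baer S E)
    [AddCommGroup A] [Module S A] [AddCommGroup B] [Module S B] [AddCommGroup C] [Module S C]
    {f : A →ₗ[S] B} {g : B →ₗ[S] C} (h : Function.Exact f g) :
    Function.Exact (LinearMap.lcomp S E g) (LinearMap.lcomp S E f) := by
  intro φ
  constructor
  · intro hφ
    have hle : LinearMap.ker g ≤ LinearMap.ker φ := by
      intro b hb
      obtain ⟨a, rfl⟩ := (h b).1 hb
      exact LinearMap.congr_fun hφ a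
    obtain ⟨ψ, hψ⟩ := hE.extension_property ((LinearMap.ker g).liftQ g le_rfl)
      (LinearMap.ker_eq_bot.1 (Submodule.ker_liftQ_eq_bot _ _ _ le_rfl))
      ((LinearMap.ker g).liftQ φ hle)
    exact ⟨ψ, LinearMap.ext fun b => LinearMap.congr_fun hψ (Submodule.mkQ _ b)⟩
  · rintro ⟨ψ, rfl⟩
    refine LinearMap.ext fun a => ?_
    change ψ (g (f a)) = 0
    rw [(h _).2 ⟨a, rfl⟩, _root_.map_zero]

section

variable {S : Type u} [CommRing S] [IsLocalRing S]
variable {E : Type u} [AddCommGroup E] [Module S E] {e : E}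

lemma IsResidueHull.length_dual_ne_top (hE : IsResidueHull (S := S) E e) {A : Type u}
    [AddCommGroup A] [Module S A] (hA : Module.length S A ≠ ⊤) :
    Module.length S (A →ₗ[S] E) ≠ ⊤ := by
  have hA' := Module.length_ne_top_iff.1 hA
  clear hA
  induction hA' with
  | of_subsingleton =>
    rw [Module.length_eq_zero]
    simp
  | @of_simple_quotient A _ _ N hsimple hN ih =>
    have h1 : Module.length S ((A ⧸ N) →ₗ[S] E) ≠ ⊤ := by
      have := IsSimpleModule.nontrivial S (A ⧸ N)
      obtain ⟨v, hv⟩ := exists_ne (0 : A ⧸ N)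
      have hspan : Submodule.span S {v} = ⊤ :=
        (eq_bot_or_eq_top _).resolve_left (by simpa using hv)
      have hmv : ∀ r ∈ maximalIdeal S, r • v = 0 := by
        intro r hr
        by_contra hne
        have h2 : Submodule.span S {r • v} = ⊤ :=
          (eq_bot_or_eq_top _).resolve_left (by simpa using hne)
        obtain ⟨a, ha⟩ := Submodule.mem_span_singleton.1 (h2 ▸ Submodule.mem_top : v ∈ _)
        rw [smul_smul] at ha
        have hu : IsUnit (1 - a * r) := by
          by_contra hn
          have h3 : (1 - a * r) ∈ maximalIdeal S := hn
          have h4 := (maximalIdeal S).add_mem h3 ((maximalIdeal S).mul_mem_left a hr)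
          rw [sub_add_cancel] at h4
          exact h4 isUnit_one
        refine hv (hu.smul_eq_zero.1 ?_)
        rw [sub_smul, one_smul, ha, sub_self]
      let ev : ((A ⧸ N) →ₗ[S] E) →ₗ[S] E := LinearMap.applyₗ v
      have hev (f) : ev f ∈ Submodule.span S {e} := by
        by_contra hne
        have hfv : ∀ r ∈ maximalIdeal S, r • f v = 0 := fun r hr => by
          rw [← _root_.map_smul, hmv r hr, _root_.map_zero]
        refine hne ?_
        have h5 : Submodule.span S {f v} = ⊥ := hE.essential _ (Submodule.disjoint_def.2 ?_)
        · have : f v = 0 := by simpa using h5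
          change f v ∈ _
          simp [this]
        · intro w hw hwe
          obtain ⟨r, rfl⟩ := Submodule.mem_span_singleton.1 hw
          by_cases hr : r ∈ maximalIdeal S
          · exact hfv r hr
          · have hu : IsUnit r := by simpa using hr
            refine absurd ?_ hne
            change f v ∈ _
            rwa [← (Submodule.span S {e}).smul_mem_iff_of_isUnit hu]
      have hinj : Function.Injective (ev.codRestrict _ hev) := by
        intro f g hfg
        refine LinearMap.ext_on hspan ?_
        rintro _ rfl
        exact congrArg Subtype.val hfg
      refine length_ne_top_of_injective _ hinj ?_
      have hle : ∀ r ∈ maximalIdeal S, LinearMap.toSpanSingleton S E e r = 0 := by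
        simpa using hE.smul_eq_zero
      have hsurj : Function.Surjective (((maximalIdeal S).liftQ
          (LinearMap.toSpanSingleton S E e) hle).codRestrict (Submodule.span S {e}) (by
            intro w
            obtain ⟨w, rfl⟩ := Submodule.mkQ_surjective _ w
            exact Submodule.mem_span_singleton.2 ⟨w, rfl⟩)) := by
        rintro ⟨w, hw⟩
        obtain ⟨r, rfl⟩ := Submodule.mem_span_singleton.1 hw
        exact ⟨Submodule.mkQ _ r, rfl⟩
      refine length_ne_top_of_surjective _ hsurj ?_
      have : IsSimpleModule S (S ⧸ maximalIdeal S) :=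
        isSimpleModule_iff_isCoatom.2 (maximalIdeal.isMaximal S).out
      rw [Module.length_eq_one]
      simp
    have h2 := length_le_add_of_exact _ _ (exact_lcomp hE.baer (LinearMap.exact_subtype_mkQ N))
    exact ne_top_of_le_ne_top (WithTop.add_ne_top.2 ⟨h1, ih⟩) h2

lemma isHausdorff_dual {A : Type u} [AddCommGroup A] [Module S A]
    (hA : IsPowTorsion (maximalIdeal S) A) : IsHausdorff (maximalIdeal S) (A →ₗ[S] E) where
  haus' φ hφ := by
    refine LinearMap.ext fun a => ?_
    obtain ⟨k, hk⟩ := hA a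
    have h := SModEq.zero.1 (hφ k)
    refine Submodule.smul_induction_on h (fun r hr ψ _ => ?_) fun ψ χ hψ hχ => ?_
    · change r • ψ a = 0
      rw [← _root_.map_smul, hk r hr, _root_.map_zero]
    · rw [LinearMap.add_apply, hψ, hχ]
      simp

end

lemma exists_les_quot {S : Type u} [CommRing S] [IsNoetherianRing S] (I : Ideal S) {X : Type u}
    [AddCommGroup X] [Module S X] {x : S} (hx : IsPowTorsion I (Submodule.torsionBy S X x))
    (i : ℕ) : ∃ (π : H I i X →ₗ[S] H I i (QuotSMulTop x X))
      (δ : H I i (QuotSMulTop x X) →ₗ[S] H I (i + 1) X),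
      Function.Exact (LinearMap.lsmul S (H I i X) x) π ∧ Function.Exact π δ ∧
      Function.Exact δ (LinearMap.lsmul S (H I (i + 1) X) x) := by
  obtain ⟨δ, h1, h2, h3⟩ := H.exists_les I (act S x X) (quotMk S x X) (isPowTorsion_ker_act I hx)
    (quotMk_surjective x) (exact_act_quotMk x) i
  have h (n : ℕ) : H.map I n (act S x X) = LinearMap.lsmul S (H I n X) x := by
    have : act S x X = x • LinearMap.id := rfl
    rw [this, H.map_smul, H.map_id]
    rfl
  rw [h] at h1 h3
  exact ⟨_, δ, h1, h2, h3⟩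

lemma exists_injective_of_exact_lsmul {S : Type*} [CommRing S] {N C : Type*} [AddCommGroup N]
    [Module S N] [AddCommGroup C] [Module S C] {x : S} {g : N →ₗ[S] C}
    (h : Function.Exact (LinearMap.lsmul S N x) g) :
    ∃ j : QuotSMulTop x N →ₗ[S] C, Function.Injective j ∧
      LinearMap.range j = LinearMap.range g := by
  have hker : LinearMap.ker g = x • (⊤ : Submodule S N) := by
    ext v
    rw [LinearMap.mem_ker, h v, Submodule.mem_smul_pointwise_iff_exists]
    simp
  refine ⟨(x • (⊤ : Submodule S N)).liftQ g hker.ge, ?_, Submodule.range_liftQ _ _ _⟩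
  exact LinearMap.ker_eq_bot.1 (Submodule.ker_liftQ_eq_bot _ _ _ hker.le)

section

variable {S : Type u} [CommRing S] [IsLocalRing S] [IsNoetherianRing S]
variable {E : Type u} [AddCommGroup E] [Module S E] {e : E}

lemma exists_dual_les (hE : Module.Baer S E) {X : Type u} [AddCommGroup X] [Module S X] {x : S}
    (hx : IsPowTorsion (maximalIdeal S) (Submodule.torsionBy S X x)) (i : ℕ) :
    ∃ (j : QuotSMulTop x (H (maximalIdeal S) (i + 1) X →ₗ[S] E) →ₗ[S]
        (H (maximalIdeal S) i (QuotSMulTop x X) →ₗ[S] E))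
      (q : (H (maximalIdeal S) i (QuotSMulTop x X) →ₗ[S] E) →ₗ[S]
        (H (maximalIdeal S) i X →ₗ[S] E)), Function.Injective j ∧ Function.Exact j q := by
  obtain ⟨π, δ, -, h2, h3⟩ := exists_les_quot (maximalIdeal S) hx i
  have h4 := exact_lcomp hE h3
  have h5 : LinearMap.lcomp S E (LinearMap.lsmul S (H (maximalIdeal S) (i + 1) X) x) =
      LinearMap.lsmul S (H (maximalIdeal S) (i + 1) X →ₗ[S] E) x := by
    refine LinearMap.ext fun φ => LinearMap.ext fun v => ?_
    change φ (x • v) = x • φ v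
    rw [_root_.map_smul]
  rw [h5] at h4
  obtain ⟨j, hj, hr⟩ := exists_injective_of_exact_lsmul h4
  refine ⟨j, LinearMap.lcomp S E π, hj, ?_⟩
  rw [LinearMap.exact_iff, hr, ← LinearMap.exact_iff]
  exact exact_lcomp hE h2

lemma exists_mem_isPowTorsion_torsionBy (X : Type u) [AddCommGroup X] [Module S X]
    [Module.Finite S X] :
    ∃ x ∈ maximalIdeal S, IsPowTorsion (maximalIdeal S) (Submodule.torsionBy S X x) := by
  obtain ⟨x, hx, hxp⟩ := exists_mem_forall_notMem (I := maximalIdeal S) (nonmaxAss_finite X)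
    (fun p hp => (isPrime_of_mem_nonmaxAss hp).1)
    (fun p hp => not_maximalIdeal_le (isPrime_of_mem_nonmaxAss hp).1 hp.2)
  exact ⟨x, hx, isPowTorsion_torsionBy fun p hp hpm => hxp p ⟨hp, hpm⟩⟩

lemma length_powTors_ne_top (X : Type*) [AddCommGroup X] [Module S X] [Module.Finite S X] :
    Module.length S (powTors (maximalIdeal S) X) ≠ ⊤ :=
  IsPowTorsion.length_ne_top (maximalIdeal S) (isPowTorsion_powTors _ _)

lemma length_H_zero_ne_top (X : Type u) [AddCommGroup X] [Module S X] [Module.Finite S X] :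
    Module.length S (H (maximalIdeal S) 0 X) ≠ ⊤ := by
  rw [← length_powTors]
  exact length_powTors_ne_top X

lemma finite_of_length_ne_top {N : Type*} [AddCommGroup N] [Module S N]
    (h : Module.length S N ≠ ⊤) : Module.Finite S N := by
  have := isFiniteLength_iff_isNoetherian_isArtinian.1 (Module.length_ne_top_iff.1 h)
  have := this.1
  infer_instance

/-- Over a complete ring the dual of a local cohomology module is finitely generated. -/
lemma finite_dual_H [IsPrecomplete (maximalIdeal S) S] (hE : IsResidueHull (S := S) E e) (i : ℕ)
    (X : Type u) [AddCommGroup X] [Module S X] [Module.Finite S X] :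
    Module.Finite S (H (maximalIdeal S) i X →ₗ[S] E) := by
  induction i generalizing X with
  | zero => exact finite_of_length_ne_top (hE.length_dual_ne_top (length_H_zero_ne_top X))
  | succ i ih =>
    obtain ⟨x, hxm, hx⟩ := exists_mem_isPowTorsion_torsionBy (S := S) X
    obtain ⟨j, -, hj, -⟩ := exists_dual_les hE.baer hx i
    have := ih (QuotSMulTop x X)
    have : IsHausdorff (maximalIdeal S) (H (maximalIdeal S) (i + 1) X →ₗ[S] E) :=
      isHausdorff_dual fun v => H.torsion _ v
    exact finite_of_finite_quotSMulTop (maximalIdeal S) hxm (Module.Finite.of_injective j hj)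

variable [IsPrecomplete (maximalIdeal S) S]

lemma dimLE_dual_H (hE : IsResidueHull (S := S) E e) (i : ℕ)
    (X : Type u) [AddCommGroup X] [Module S X] [Module.Finite S X] :
    DimLE i S (H (maximalIdeal S) i X →ₗ[S] E) := by
  induction i generalizing X with
  | zero =>
    have := finite_dual_H hE 0 X
    exact dimLE_zero_iff.2 (hE.length_dual_ne_top (length_H_zero_ne_top X))
  | succ i ih =>
    obtain ⟨x, hxm, hx⟩ := exists_mem_isPowTorsion_torsionBy (S := S) X
    obtain ⟨j, -, hj, -⟩ := exists_dual_les hE.baer hx i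
    have := finite_dual_H hE (i + 1) X
    exact DimLE.of_quotSMulTop hxm ((ih (QuotSMulTop x X)).of_injective j hj)

/-- The duals of the intermediate local cohomology modules in degrees `1 ≤ i < s` have dimension
less than `i`. -/
def DualDimLT (S : Type u) [CommRing S] [IsLocalRing S] (E : Type u) [AddCommGroup E] [Module S E] (s : ℕ) (X : Type u) [AddCommGroup X]
    [Module S X] : Prop :=
  ∀ i, i + 1 < s → DimLE i S (H (maximalIdeal S) (i + 1) X →ₗ[S] E)

lemma dualDimLT_of_nonmaxAss (hE : IsResidueHull (S := S) E e) {s : ℕ}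
    (X : Type u) [AddCommGroup X] [Module S X] [Module.Finite S X]
    (h : ∀ p ∈ nonmaxAss S X, ringKrullDim (S ⧸ p) = s) : DualDimLT S E s X := by
  intro i hi p hp
  by_contra hdim
  have := finite_dual_H hE (i + 1) X
  have hle := dimLE_dual_H hE (i + 1) X p hp
  obtain ⟨x, hx, hxp⟩ := exists_mem_forall_notMem (I := p.asIdeal) (nonmaxAss_finite X)
    (fun q hq => (isPrime_of_mem_nonmaxAss hq).1)
    (fun q hq hpq => by
      have h1 : ringKrullDim (S ⧸ q) ≤ ringKrullDim (S ⧸ p.asIdeal) :=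
        ringKrullDim_le_of_surjective (Ideal.Quotient.factor hpq)
          (Ideal.Quotient.factor_surjective hpq)
      rw [h q hq] at h1
      have h2 : s ≤ i + 1 := by exact_mod_cast h1.trans hle
      omega)
  have hxt := isPowTorsion_torsionBy fun q hq hqm => hxp q ⟨hq, hqm⟩
  obtain ⟨j, -, hj, -⟩ := exists_dual_les hE.baer hxt i
  refine hdim (((dimLE_dual_H hE i (QuotSMulTop x X)).of_injective j hj) p ?_)
  rw [Module.support_quotSMulTop]
  exact ⟨hp, by simpa [PrimeSpectrum.mem_zeroLocus] using hx⟩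

lemma DualDimLT.quotSMulTop (hE : IsResidueHull (S := S) E e) {s : ℕ} {X : Type u} [AddCommGroup X]
    [Module S X] [Module.Finite S X] (h : DualDimLT S E (s + 1) X) {x : S}
    (hx : IsPowTorsion (maximalIdeal S) (Submodule.torsionBy S X x))
    (hx' : ∀ i < s, ∀ p ∈ (Module.annihilator S (H (maximalIdeal S) (i + 1) X →ₗ[S] E)).minimalPrimes,
      p ≠ maximalIdeal S → x ∉ p) :
    DualDimLT S E s (QuotSMulTop x X) := by
  intro i hi
  obtain ⟨j, q, -, hjq⟩ := exists_dual_les hE.baer hx (i + 1)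
  have := finite_dual_H hE (i + 2) X
  exact DimLE.of_exact hjq ((h (i + 1) (by omega)).quotSMulTop (hx' (i + 1) hi))
    (h i (by omega))

lemma DualDimLT.exists_generic (hE : IsResidueHull (S := S) E e) {s : ℕ} {X : Type u}
    [AddCommGroup X] [Module S X] [Module.Finite S X] (h : DualDimLT S E (s + 1) X)
    {G : Set S} (hG : IsGeneric G) (t : ℕ) :
    ∃ x ∈ G, x ∈ maximalIdeal S ^ t ∧
      (∀ n, Submodule.torsionBy S X (x ^ (n + 1)) = powTors (maximalIdeal S) X) ∧
      ∀ n, DualDimLT S E s (QuotSMulTop (x ^ (n + 1)) X) := by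
  obtain ⟨x, hxG, hxt, hxp, hx⟩ := hG.exists_torsionBy_eq X t
    (⋃ i ∈ Finset.range s,
      {p ∈ (Module.annihilator S (H (maximalIdeal S) (i + 1) X →ₗ[S] E)).minimalPrimes |
        p ≠ maximalIdeal S})
    (Set.Finite.biUnion (Finset.finite_toSet _) fun i _ =>
      (Ideal.finite_minimalPrimes_of_isNoetherianRing S _).subset fun p hp => hp.1)
    (by
      intro p hp
      simp only [Set.mem_iUnion] at hp
      obtain ⟨i, -, hp, hpm⟩ := hp
      exact ⟨hp.1.1, hpm⟩)
  refine ⟨x, hxG, hxt, hx, fun n => h.quotSMulTop hE ?_ ?_⟩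
  · rw [hx n]
    exact isPowTorsion_powTors _ _
  · intro i hi p hp hpm hmem
    refine hxp p ?_ (hp.1.1.mem_of_pow_mem _ hmem)
    simp only [Set.mem_iUnion]
    exact ⟨i, Finset.mem_range.2 hi, hp, hpm⟩

lemma DualDimLT.exists_pow_smul_H_one (hE : IsResidueHull (S := S) E e) {s : ℕ} (hs : 1 < s)
    {X : Type u} [AddCommGroup X] [Module S X] [Module.Finite S X] (h : DualDimLT S E s X) :
    ∃ t, ∀ r ∈ maximalIdeal S ^ t, ∀ v : H (maximalIdeal S) 1 X, r • v = 0 := by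
  have := finite_dual_H hE 1 X
  have h1 := isPowTorsion_of_length_ne_top (R := S) (dimLE_zero_iff.1 (h 0 hs))
  obtain ⟨t, ht⟩ := IsPowTorsion.exists_pow_smul _ h1
  refine ⟨t, fun r hr v => ?_⟩
  by_contra hne
  obtain ⟨f, hf⟩ := hE.exists_ne_zero hne
  rw [_root_.map_smul] at hf
  exact hf (LinearMap.congr_fun (ht r hr f) v)

end

section

variable {S : Type u} [CommRing S]

lemma eq_of_le_of_length_le {N : Type*} [AddCommGroup N] [Module S N] {A B : Submodule S N}
    (hAB : A ≤ B) (hA : Module.length S A ≠ ⊤) (h : Module.length S B ≤ Module.length S A) :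
    A = B := by
  have h1 := length_eq_sub_add_quot (Submodule.comap B.subtype A)
  have h2 : Module.length S (Submodule.comap B.subtype A) = Module.length S A :=
    (Submodule.comapSubtypeEquivOfLe hAB).length_eq
  rw [h2] at h1
  have h3 : Module.length S (B ⧸ Submodule.comap B.subtype A) = 0 := by
    by_contra hne
    rw [h1] at h
    lift Module.length S A to ℕ using hA with a
    cases hc : Module.length S (B ⧸ Submodule.comap B.subtype A) with
    | top => simp [hc] at h
    | coe c =>
      rw [hc] at h hne
      have h4 : a + c ≤ a := by exact_mod_cast h
      exact hne (by simp; omega)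
  have h4 := Module.length_eq_zero_iff.1 h3
  exact le_antisymm hAB
    (Submodule.comap_subtype_eq_top.1 (Submodule.Quotient.subsingleton_iff.1 h4))

/-- The length of a torsion module is bounded by a common bound for the lengths of the kernels of
the powers of an element. -/
lemma length_le_of_torsionBy_pow {I : Ideal S} {N : Type*} [AddCommGroup N] [Module S N]
    (hN : IsPowTorsion I N) {x : S} (hx : x ∈ I) {l : ℕ}
    (h : ∀ n, Module.length S (Submodule.torsionBy S N (x ^ (n + 1))) ≤ l) :
    Module.length S N ≤ l := by
  have hfin (n) : Module.length S (Submodule.torsionBy S N (x ^ (n + 1))) ≠ ⊤ :=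
    ne_top_of_le_ne_top (ENat.natCast_ne_top l) (h n)
  have hmono {a b : ℕ} (hab : a ≤ b) :
      Submodule.torsionBy S N (x ^ (a + 1)) ≤ Submodule.torsionBy S N (x ^ (b + 1)) :=
    Submodule.torsionBy_le_torsionBy_of_dvd _ _ (pow_dvd_pow x (by omega))
  obtain ⟨n, hn⟩ : ∃ n, ∀ m, Module.length S (Submodule.torsionBy S N (x ^ (m + 1))) ≤
      Module.length S (Submodule.torsionBy S N (x ^ (n + 1))) := by
    have hbdd : BddAbove (Set.range fun n =>
        (Module.length S (Submodule.torsionBy S N (x ^ (n + 1)))).toNat) :=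
      ⟨l, by
        rintro _ ⟨n, rfl⟩
        exact ENat.toNat_le_of_le_natCast (h n)⟩
    obtain ⟨n, hn⟩ := Nat.sSup_mem (Set.range_nonempty _) hbdd
    refine ⟨n, fun m => ?_⟩
    rw [← ENat.natCast_toNat (hfin m), ← ENat.natCast_toNat (hfin n), ENat.natCast_le_natCast]
    exact (le_csSup hbdd ⟨m, rfl⟩).trans hn.ge
  have htop : Submodule.torsionBy S N (x ^ (n + 1)) = ⊤ := by
    refine eq_top_iff.2 fun v _ => ?_
    obtain ⟨k, hk⟩ := hN v
    have h1 : v ∈ Submodule.torsionBy S N (x ^ (n + k + 1)) := by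
      rw [Submodule.mem_torsionBy_iff, add_assoc, pow_add, pow_succ, mul_smul, mul_smul, smul_comm _ x,
        hk _ (Ideal.pow_mem_pow hx k)]
      simp
    rwa [← eq_of_le_of_length_le (hmono (Nat.le_add_right n k)) (hfin n) (hn _)] at h1
  have h2 := h n
  rwa [htop, Module.length_top] at h2

variable [IsLocalRing S] [IsNoetherianRing S]

lemma length_torsionBy_H_le {X : Type u} [AddCommGroup X] [Module S X] {I : Ideal S} {x : S}
    (hx : IsPowTorsion I (Submodule.torsionBy S X x)) (i : ℕ) :
    Module.length S (Submodule.torsionBy S (H I (i + 1) X) x) ≤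
      Module.length S (H I i (QuotSMulTop x X)) := by
  obtain ⟨π, δ, -, -, h3⟩ := exists_les_quot I hx i
  have : Submodule.torsionBy S (H I (i + 1) X) x = LinearMap.range δ := h3.linearMap_ker_eq
  rw [this]
  exact Module.length_le_of_surjective _ δ.surjective_rangeRestrict

lemma length_powTors_add_length_torsionBy {X : Type u} [AddCommGroup X] [Module S X] {I : Ideal S}
    {x : S} (hx : Submodule.torsionBy S X x = powTors I X) :
    Module.length S (powTors I X) + Module.length S (Submodule.torsionBy S (H I 1 X) x) =
      Module.length S (powTors I (QuotSMulTop x X)) := by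
  have hx' : IsPowTorsion I (Submodule.torsionBy S X x) := by
    rw [hx]
    exact isPowTorsion_powTors _ _
  obtain ⟨π, δ, h1, h2, h3⟩ := exists_les_quot I hx' 0
  have h4 : Submodule.torsionBy S (H I 1 X) x = LinearMap.range δ := h3.linearMap_ker_eq
  have hπ : Function.Injective π := by
    rw [injective_iff_map_eq_zero]
    intro v hv
    obtain ⟨w, rfl⟩ := (h1 v).1 hv
    refine H.ev_injective I ?_
    rw [LinearMap.lsmul_apply, _root_.map_smul, _root_.map_zero]
    have : H.ev I X w ∈ powTors I X := H.ev_torsion I w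
    rw [← hx] at this
    exact (Submodule.mem_torsionBy_iff _ _).1 this
  rw [length_powTors, length_powTors, h4, length_eq_ker_add_range δ, h2.linearMap_ker_eq,
    (LinearEquiv.ofInjective π hπ).length_eq]

variable {E : Type u} [AddCommGroup E] [Module S E] {e : E} [IsPrecomplete (maximalIdeal S) S]

/-- If the jumps of the torsion lengths along generic filter-regular sequences are bounded, so are
the lengths of the intermediate local cohomology modules. -/
lemma length_H_le_of_jump_le (hE : IsResidueHull (S := S) E e) {G : Set S} (hG : IsGeneric G)
    {l : ℕ} (k : ℕ) (X : Type u) [AddCommGroup X] [Module S X] [Module.Finite S X]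
    (h : DualDimLT S E (k + 2) X)
    (hl : ∀ x : ℕ → S, (∀ i, x i ∈ G) → IsFilterSeq X x (k + 2) →
      Module.length S (powTors (maximalIdeal S) (X ⧸ initSub X x (k + 1))) ≤
        l + Module.length S (powTors (maximalIdeal S) (X ⧸ initSub X x k))) :
    ∀ i < k + 1, Module.length S (H (maximalIdeal S) (i + 1) X) ≤ l := by
  induction k generalizing X with
  | zero =>
    intro i hi
    obtain rfl : i = 0 := by omega
    obtain ⟨x, hxG, -, hx, -⟩ := h.exists_generic hE hG 0
    refine length_le_of_torsionBy_pow (fun v => H.torsion _ v) (hG.mem_maximalIdeal x hxG)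
      fun n => ?_
    obtain ⟨y, hyG, hy⟩ := hG.exists_isFilterSeq 1 (QuotSMulTop (x ^ (n + 1)) X)
    let z : ℕ → S := fun | 0 => x ^ (n + 1) | i + 1 => y i
    have h1 := hl z (fun i => by
      cases i with
      | zero => exact hG.pow_mem x hxG n
      | succ i => exact hyG i) (isFilterSeq_succ (hx n) hy)
    rw [length_powTors_congr _ (quotInitSubZeroEquiv z), length_powTors_congr _
      ((quotInitSubEquiv z 0).trans (quotInitSubZeroEquiv (X := QuotSMulTop (z 0) X) _)),
      ← length_powTors_add_length_torsionBy (hx n), add_comm (l : ℕ∞)] at h1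
    exact (ENat.add_le_add_iff_left (length_powTors_ne_top X)).1 h1
  | succ k ih =>
    obtain ⟨t, ht⟩ := h.exists_pow_smul_H_one hE (by omega)
    obtain ⟨x, hxG, hxt, hx, hx'⟩ := h.exists_generic hE hG t
    have htor (n : ℕ) :
        IsPowTorsion (maximalIdeal S) (Submodule.torsionBy S X (x ^ (n + 1))) := by
      rw [hx n]
      exact isPowTorsion_powTors _ _
    have key (n : ℕ) : ∀ i < k + 1,
        Module.length S (H (maximalIdeal S) (i + 1) (QuotSMulTop (x ^ (n + 1)) X)) ≤ l := by
      refine ih _ (hx' n) fun y hyG hy => ?_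
      let z : ℕ → S := fun | 0 => x ^ (n + 1) | i + 1 => y i
      have h1 := hl z (fun i => by
        cases i with
        | zero => exact hG.pow_mem x hxG n
        | succ i => exact hyG i) (isFilterSeq_succ (hx n) hy)
      rwa [length_powTors_congr _ (quotInitSubEquiv z (k + 1)),
        length_powTors_congr _ (quotInitSubEquiv z k)] at h1
    intro i hi
    cases i with
    | zero =>
      obtain ⟨π, -, h1, -, -⟩ := exists_les_quot (maximalIdeal S) (htor 0) 1
      refine le_trans (Module.length_le_of_injective π ?_) (key 0 0 (by omega))
      rw [injective_iff_map_eq_zero]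
      intro v hv
      obtain ⟨w, rfl⟩ := (h1 v).1 hv
      exact ht _ (by simpa using hxt) w
    | succ i =>
      exact length_le_of_torsionBy_pow (fun v => H.torsion _ v) (hG.mem_maximalIdeal x hxG)
        fun n => (length_torsionBy_H_le (htor n) (i + 1)).trans (key n i (by omega))

end

section Dense

/-- A local homomorphism with dense image along which the maximal ideal extends to the
maximal ideal. -/
structure IsDenseLocal (R S : Type u) [CommRing R] [IsLocalRing R] [CommRing S] [IsLocalRing S]
    [Algebra R S] : Prop where
  maximalIdeal_eq : maximalIdeal S = (maximalIdeal R).map (algebraMap R S)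
  dense : ∀ n (c : S), ∃ r : R, c - algebraMap R S r ∈ maximalIdeal S ^ n

/-- A linear map with dense image from an `R`-module to an `S`-module which is strict for the
adic filtrations. -/
structure IsDenseStrict (S : Type u) {R M X : Type u} [CommRing R] [IsLocalRing R] [CommRing S]
    [IsLocalRing S] [Algebra R S] [AddCommGroup M] [Module R M] [AddCommGroup X] [Module R X]
    [Module S X] (ι : M →ₗ[R] X) : Prop where
  mem_of_mem : ∀ n v, ι v ∈ (maximalIdeal S ^ n • ⊤ : Submodule S X) →
    v ∈ (maximalIdeal R ^ n • ⊤ : Submodule R M)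
  dense : ∀ n u, ∃ v, u - ι v ∈ (maximalIdeal S ^ n • ⊤ : Submodule S X)

variable {R S : Type u} [CommRing R] [IsLocalRing R] [CommRing S] [IsLocalRing S] [Algebra R S]
variable {M X : Type u} [AddCommGroup M] [Module R M] [AddCommGroup X] [Module R X] [Module S X]
variable [IsScalarTower R S X]

/-- The map induced on quotients by an element of the base ring. -/
def quotMap (S : Type u) [CommRing S] [Algebra R S] [Module S X] [IsScalarTower R S X]
    (ι : M →ₗ[R] X) (a : R) : QuotSMulTop a M →ₗ[R] QuotSMulTop (algebraMap R S a) X :=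
  (a • (⊤ : Submodule R M)).liftQ
    (((algebraMap R S a • (⊤ : Submodule S X)).mkQ.restrictScalars R) ∘ₗ ι) (by
      intro v hv
      obtain ⟨w, -, rfl⟩ := (Submodule.mem_smul_pointwise_iff_exists _ _ _).1 hv
      refine (Submodule.Quotient.mk_eq_zero _).2 ?_
      rw [_root_.map_smul, ← algebraMap_smul S a (ι w)]
      exact Submodule.smul_mem_pointwise_smul _ _ _ Submodule.mem_top)

lemma mem_smul_top_quot_iff {S X : Type*} [CommRing S] [AddCommGroup X] [Module S X] (I : Ideal S)
    (N : Submodule S X) (u : X) :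
    N.mkQ u ∈ (I • ⊤ : Submodule S (X ⧸ N)) ↔ ∃ p ∈ N, u - p ∈ (I • ⊤ : Submodule S X) := by
  have h : (I • ⊤ : Submodule S (X ⧸ N)) = (I • ⊤ : Submodule S X).map N.mkQ := by
    rw [Submodule.map_smul'', Submodule.map_top, Submodule.range_mkQ]
  rw [h]
  constructor
  · rintro ⟨w, hw, hwu⟩
    refine ⟨u - w, (Submodule.Quotient.eq N).1 hwu.symm, ?_⟩
    rwa [sub_sub_cancel]
  · rintro ⟨p, hp, hu⟩
    refine ⟨u - p, hu, ?_⟩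
    rw [_root_.map_sub, Submodule.mkQ_apply _ p, (Submodule.Quotient.mk_eq_zero N).2 hp, sub_zero]

lemma IsDenseStrict.quotMap {ι : M →ₗ[R] X} (h : IsDenseStrict S ι) (a : R) :
    IsDenseStrict S (quotMap S ι a) where
  mem_of_mem n v hv := by
    obtain ⟨v, rfl⟩ := Submodule.mkQ_surjective _ v
    obtain ⟨p, hp, hvp⟩ := (mem_smul_top_quot_iff _ _ (ι v)).1 hv
    obtain ⟨u, -, rfl⟩ := (Submodule.mem_smul_pointwise_iff_exists _ _ _).1 hp
    obtain ⟨w, hw⟩ := h.dense n u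
    refine (mem_smul_top_quot_iff _ _ v).2
      ⟨a • w, Submodule.smul_mem_pointwise_smul _ _ _ Submodule.mem_top, h.mem_of_mem n _ ?_⟩
    have h1 : ι (v - a • w) = (ι v - algebraMap R S a • u) + algebraMap R S a • (u - ι w) := by
      rw [_root_.map_sub, _root_.map_smul, smul_sub, ← algebraMap_smul S a (ι w)]
      abel
    rw [h1]
    exact Submodule.add_mem _ hvp (Submodule.smul_mem _ _ hw)
  dense n u := by
    obtain ⟨u, rfl⟩ := Submodule.mkQ_surjective _ u
    obtain ⟨v, hv⟩ := h.dense n u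
    exact ⟨Submodule.mkQ _ v, (mem_smul_top_quot_iff _ _ (u - ι v)).2
      ⟨0, Submodule.zero_mem _, by rwa [sub_zero]⟩⟩

lemma length_eq_of_isDenseLocal (hRS : IsDenseLocal R S) {N : Type*} [AddCommGroup N] [Module R N]
    [Module S N] [IsScalarTower R S N] {n : ℕ} (hn : ∀ c ∈ maximalIdeal S ^ n, ∀ v : N, c • v = 0) :
    Module.length R N = Module.length S N := by
  refine (length_eq_length_of_forall_smul (R := R) (B := S) fun c => ?_).symm
  obtain ⟨r, hr⟩ := hRS.dense n c
  refine ⟨r, fun v => ?_⟩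
  have := hn _ hr v
  rwa [sub_smul, sub_eq_zero, algebraMap_smul] at this

lemma exists_pow_smul_eq_zero [IsNoetherianRing S] {N : Type*} [AddCommGroup N] [Module S N]
    (h : Module.length S N ≠ ⊤) : ∃ n, ∀ c ∈ maximalIdeal S ^ n, ∀ v : N, c • v = 0 := by
  have h1 := isPowTorsion_of_length_ne_top (R := S) h
  have := finite_of_length_ne_top h
  exact IsPowTorsion.exists_pow_smul _ h1

variable [IsNoetherianRing R] [IsNoetherianRing S] [Module.Finite R M] [Module.Finite S X]

lemma IsDenseStrict.injective {ι : M →ₗ[R] X} (h : IsDenseStrict S ι) :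
    Function.Injective ι := by
  rw [injective_iff_map_eq_zero]
  intro v hv
  have h1 := Ideal.iInf_pow_smul_eq_bot_of_isLocalRing (M := M) (maximalIdeal R)
    (Ideal.IsPrime.ne_top inferInstance)
  have h2 : v ∈ (⨅ i : ℕ, maximalIdeal R ^ i • ⊤ : Submodule R M) :=
    (Submodule.mem_iInf _).2 fun n => h.mem_of_mem n v (by rw [hv]; exact Submodule.zero_mem _)
  rwa [h1] at h2

/-- Lengths of quotients by extended ideals agree. -/
lemma IsDenseStrict.length_quotient_eq (hRS : IsDenseLocal R S) {ι : M →ₗ[R] X}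
    (h : IsDenseStrict S ι) (Q : Ideal R)
    (hfin : Module.length S (X ⧸ (Q.map (algebraMap R S) • ⊤ : Submodule S X)) ≠ ⊤) :
    Module.length R (M ⧸ (Q • ⊤ : Submodule R M)) =
      Module.length S (X ⧸ (Q.map (algebraMap R S) • ⊤ : Submodule S X)) := by
  let N : Submodule S X := Q.map (algebraMap R S) • ⊤
  obtain ⟨n, hn⟩ := exists_pow_smul_eq_zero hfin
  rw [← length_eq_of_isDenseLocal hRS hn]
  let f : M →ₗ[R] X ⧸ N := (N.mkQ.restrictScalars R) ∘ₗ ι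
  have hle : (maximalIdeal S ^ n • ⊤ : Submodule S X) ≤ N := by
    refine Submodule.smul_le.2 fun c hc v _ => ?_
    exact (Submodule.Quotient.mk_eq_zero N).1 (hn c hc (N.mkQ v))
  have hsurj : Function.Surjective f := by
    intro u
    obtain ⟨u, rfl⟩ := N.mkQ_surjective u
    obtain ⟨v, hv⟩ := h.dense n u
    exact ⟨v, ((Submodule.Quotient.eq N).2 (hle hv)).symm⟩
  have key (j : ℕ) : ∀ u ∈ N, ∃ w ∈ (Q • ⊤ : Submodule R M),
      u - ι w ∈ (maximalIdeal S ^ j • ⊤ : Submodule S X) := by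
    have hadd : ∀ u u' : X, (∃ w ∈ (Q • ⊤ : Submodule R M),
        u - ι w ∈ (maximalIdeal S ^ j • ⊤ : Submodule S X)) →
        (∃ w ∈ (Q • ⊤ : Submodule R M), u' - ι w ∈ (maximalIdeal S ^ j • ⊤ : Submodule S X)) →
        ∃ w ∈ (Q • ⊤ : Submodule R M),
          u + u' - ι w ∈ (maximalIdeal S ^ j • ⊤ : Submodule S X) := by
      rintro u u' ⟨w, hw, h1⟩ ⟨w', hw', h2⟩
      refine ⟨w + w', Submodule.add_mem _ hw hw', ?_⟩
      rw [_root_.map_add, add_sub_add_comm]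
      exact Submodule.add_mem _ h1 h2
    intro u hu
    refine Submodule.smul_induction_on hu (fun c hc x _ => ?_) hadd
    induction hc using Submodule.span_induction generalizing x with
    | mem c hmem =>
      obtain ⟨q, hq, rfl⟩ := hmem
      obtain ⟨w, hw⟩ := h.dense j x
      refine ⟨q • w, Submodule.smul_mem_smul hq Submodule.mem_top, ?_⟩
      have : algebraMap R S q • x - ι (q • w) = algebraMap R S q • (x - ι w) := by
        rw [_root_.map_smul, smul_sub, algebraMap_smul, algebraMap_smul]
      rw [this]
      exact Submodule.smul_mem _ _ hw
    | zero => exact ⟨0, Submodule.zero_mem _, by simp⟩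
    | add c c' _ _ ih ih' =>
      rw [add_smul]
      exact hadd _ _ (ih x Submodule.mem_top) (ih' x Submodule.mem_top)
    | smul c' c _ ih =>
      rw [smul_assoc, ← smul_comm c c' x]
      exact ih (c' • x) Submodule.mem_top
  have hker : LinearMap.ker f = Q • ⊤ := by
    refine le_antisymm (fun v hv => ?_) (Submodule.smul_le.2 fun q hq v _ => ?_)
    · have hvN : ι v ∈ N := (Submodule.Quotient.mk_eq_zero N).1 hv
      have h1 := Ideal.iInf_pow_smul_eq_bot_of_isLocalRing
        (M := M ⧸ (Q • ⊤ : Submodule R M)) (maximalIdeal R) (Ideal.IsPrime.ne_top inferInstance)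
      have h2 : (Q • ⊤ : Submodule R M).mkQ v ∈
          (⨅ i : ℕ, maximalIdeal R ^ i • ⊤ : Submodule R (M ⧸ (Q • ⊤ : Submodule R M))) := by
        refine (Submodule.mem_iInf _).2 fun j => (mem_smul_top_quot_iff _ _ v).2 ?_
        obtain ⟨w, hw, hvw⟩ := key j _ hvN
        exact ⟨w, hw, h.mem_of_mem j _ (by rwa [_root_.map_sub])⟩
      rw [h1] at h2
      exact (Submodule.Quotient.mk_eq_zero _).1 h2
    · refine (Submodule.Quotient.mk_eq_zero N).2 ?_
      change ι (q • v) ∈ N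
      rw [_root_.map_smul, ← algebraMap_smul S q (ι v)]
      exact Submodule.smul_mem_smul (Ideal.mem_map_of_mem _ hq) Submodule.mem_top
  rw [← hker]
  exact (f.quotKerEquivOfSurjective hsurj).length_eq

end Dense

section Descent

variable {R S : Type u} [CommRing R] [IsLocalRing R] [CommRing S] [IsLocalRing S] [Algebra R S]
variable [IsNoetherianRing R] [IsNoetherianRing S]

lemma length_H_zero_le_of_isDenseStrict (hRS : IsDenseLocal R S) {M X : Type u} [AddCommGroup M]
    [Module R M] [AddCommGroup X] [Module R X] [Module S X] [IsScalarTower R S X]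
    [Module.Finite R M] [Module.Finite S X] {ι : M →ₗ[R] X} (h : IsDenseStrict S ι) :
    Module.length R (H (maximalIdeal R) 0 M) ≤ Module.length S (H (maximalIdeal S) 0 X) := by
  rw [← length_powTors, ← length_powTors]
  have hX := exists_pow_smul_eq_zero (length_powTors_ne_top (S := S) X)
  obtain ⟨n, hn⟩ := hX
  rw [← length_eq_of_isDenseLocal hRS hn]
  have hmem : ∀ v ∈ powTors (maximalIdeal R) M, ι v ∈ powTors (maximalIdeal S) X := by
    intro v hv
    obtain ⟨k, hk⟩ := (mem_powTors (maximalIdeal R)).1 hv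
    refine (mem_powTors (maximalIdeal S)).2 ⟨k, fun c hc => ?_⟩
    rw [hRS.maximalIdeal_eq, ← Ideal.map_pow] at hc
    have hle : (maximalIdeal R ^ k).map (algebraMap R S) ≤
        LinearMap.ker (LinearMap.toSpanSingleton S X (ι v)) := by
      refine Ideal.map_le_iff_le_comap.2 fun r hr => ?_
      change algebraMap R S r • ι v = 0
      rw [algebraMap_smul, ← _root_.map_smul, hk r hr, _root_.map_zero]
    exact hle hc
  let f : powTors (maximalIdeal R) M →ₗ[R] powTors (maximalIdeal S) X :=
    (ι ∘ₗ (powTors (maximalIdeal R) M).subtype).codRestrict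
      ((powTors (maximalIdeal S) X).restrictScalars R) fun v => hmem v v.2
  refine Module.length_le_of_injective f fun v w hvw => Subtype.ext (h.injective ?_)
  exact congrArg Subtype.val hvw

/-- Finiteness of local cohomology descends along a dense strict map, with uniform bounds. -/
lemma exists_length_H_le_of_isDenseStrict (hRS : IsDenseLocal R S) (i : ℕ) (h : ℕ → ℕ) :
    ∃ L : ℕ, ∀ (M X : Type u) [AddCommGroup M] [Module R M] [AddCommGroup X] [Module R X]
      [Module S X] [IsScalarTower R S X] [Module.Finite R M] [Module.Finite S X]
      (ι : M →ₗ[R] X), IsDenseStrict S ι →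
      (∀ a ≤ i, Module.length S (H (maximalIdeal S) a X) ≤ h a) →
      Module.length R (H (maximalIdeal R) i M) ≤ L := by
  induction i generalizing h with
  | zero =>
    refine ⟨h 0, fun M X => ?_⟩
    intros
    exact (length_H_zero_le_of_isDenseStrict hRS ‹_›).trans (by simp_all)
  | succ i ih =>
    obtain ⟨L, hL⟩ := ih fun a => h a + h (a + 1)
    refine ⟨L, fun M X _ _ _ _ _ _ _ _ ι hι hX => ?_⟩
    obtain ⟨x, hx, hxp⟩ := exists_mem_forall_notMem (I := maximalIdeal R)
      ((nonmaxAss_finite (S := R) M).union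
        ((nonmaxAss_finite (S := S) X).image (Ideal.comap (algebraMap R S))))
      (by
        rintro _ (hp | ⟨p, hp, rfl⟩)
        · exact (isPrime_of_mem_nonmaxAss hp).1
        · have := (isPrime_of_mem_nonmaxAss hp).1
          exact Ideal.comap_isPrime _ _)
      (by
        rintro _ (hp | ⟨p, hp, rfl⟩) hle
        · exact not_maximalIdeal_le (isPrime_of_mem_nonmaxAss hp).1 hp.2 hle
        · refine not_maximalIdeal_le (isPrime_of_mem_nonmaxAss hp).1 hp.2 ?_
          rw [hRS.maximalIdeal_eq]
          exact Ideal.map_le_iff_le_comap.2 hle)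
    refine length_le_of_torsionBy_pow (I := maximalIdeal R) (fun v => H.torsion _ v) hx
      fun n => ?_
    have hM : IsPowTorsion (maximalIdeal R) (Submodule.torsionBy R M (x ^ (n + 1))) :=
      isPowTorsion_torsionBy fun p hp hpm hmem =>
        hxp p (Or.inl ⟨hp, hpm⟩) (hp.isPrime.mem_of_pow_mem _ hmem)
    have hXt : IsPowTorsion (maximalIdeal S)
        (Submodule.torsionBy S X (algebraMap R S (x ^ (n + 1)))) :=
      isPowTorsion_torsionBy fun p hp hpm hmem =>
        hxp _ (Or.inr ⟨p, ⟨hp, hpm⟩, rfl⟩) (hp.isPrime.mem_of_pow_mem (n + 1) (by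
          rwa [map_pow] at hmem))
    refine (length_torsionBy_H_le hM i).trans
      (hL _ _ (quotMap S ι (x ^ (n + 1))) (hι.quotMap _) fun a ha => ?_)
    have h1 := hX a (by omega)
    have h2 := hX (a + 1) (by omega)
    refine (length_H_quot_le (R := S) (maximalIdeal S) hXt a
      (ne_top_of_le_ne_top (ENat.natCast_ne_top _) h2)).trans ?_
    rw [Nat.cast_add]
    exact add_le_add ((cokerLength_le _ _ _).trans h1) ((cokerLength_le _ _ _).trans h2)

end Descent

section Completion

variable (R M : Type u) [CommRing R] [IsNoetherianRing R] [IsLocalRing R] [AddCommGroup M]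
  [Module R M]

lemma mem_maximalIdeal_pow_smul_top_iff (n : ℕ) (u : AdicCompletion (maximalIdeal R) M) :
    u ∈ (maximalIdeal (AdicCompletion (maximalIdeal R) R) ^ n • ⊤ :
      Submodule (AdicCompletion (maximalIdeal R) R) (AdicCompletion (maximalIdeal R) M)) ↔
    AdicCompletion.eval (maximalIdeal R) M n u = 0 := by
  rw [← LinearMap.mem_ker, ← AdicCompletion.pow_smul_top_eq_ker_eval
    (maximalIdeal R).fg_of_isNoetherianRing, AdicCompletion.maximalIdeal_eq_map, ← Ideal.map_pow,
    ← Submodule.restrictScalars_mem R, Ideal.smul_restrictScalars, Submodule.restrictScalars_top]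

lemma isDenseStrict_of : IsDenseStrict (AdicCompletion (maximalIdeal R) R)
    (AdicCompletion.of (maximalIdeal R) M) where
  mem_of_mem n v hv := by
    rw [mem_maximalIdeal_pow_smul_top_iff] at hv
    exact (Submodule.Quotient.mk_eq_zero _).1 hv
  dense n u := by
    obtain ⟨v, hv⟩ := Submodule.mkQ_surjective _ (AdicCompletion.eval (maximalIdeal R) M n u)
    refine ⟨v, ?_⟩
    rw [mem_maximalIdeal_pow_smul_top_iff, _root_.map_sub, ← hv]
    exact sub_self _

lemma isDenseLocal_completion : IsDenseLocal R (AdicCompletion (maximalIdeal R) R) where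
  maximalIdeal_eq := AdicCompletion.maximalIdeal_eq_map
  dense n c := by
    obtain ⟨r, hr⟩ := (isDenseStrict_of R R).dense n c
    refine ⟨r, ?_⟩
    exact (Ideal.mul_top (maximalIdeal (AdicCompletion (maximalIdeal R) R) ^ n)).le hr

instance finite_completion [Module.Finite R M] :
    Module.Finite (AdicCompletion (maximalIdeal R) R) (AdicCompletion (maximalIdeal R) M) :=
  Module.Finite.of_surjective _
    (AdicCompletion.ofTensorProduct_surjective_of_finite (maximalIdeal R) M)

end Completion

section Main

variable {R M : Type u} [CommRing R] [IsNoetherianRing R] [IsLocalRing R] [AddCommGroup M]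
  [Module R M] [Module.Finite R M]

lemma dimLE_of_associatedPrimes {S X : Type*} [CommRing S] [IsNoetherianRing S] [AddCommGroup X]
    [Module S X] [Module.Finite S X] {s : ℕ}
    (h : ∀ p ∈ associatedPrimes S X, ringKrullDim (S ⧸ p) ≤ s) : DimLE s S X := by
  intro p hp
  obtain ⟨q, hq, hqp⟩ := Ideal.exists_minimalPrimes_le (Module.mem_support_iff_of_finite.1 hp)
  refine le_trans ?_ (h q
    (Module.associatedPrimes.minimalPrimes_annihilator_subset_associatedPrimes _ _ hq))
  exact ringKrullDim_le_of_surjective _ (Ideal.Quotient.factor_surjective hqp)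

/-- If the first Hilbert coefficients are bounded below, then a filter regular sequence from the
base ring has bounded last jump on the completion. -/
lemma length_powTors_le_of_le_coeff {S X : Type u} [CommRing S] [IsLocalRing S]
    [IsNoetherianRing S] [Algebra R S] [AddCommGroup X] [Module R X] [Module S X]
    [IsScalarTower R S X] [Module.Finite S X] (hRS : IsDenseLocal R S) {ι : M →ₗ[R] X}
    (hι : IsDenseStrict S ι) {k l : ℕ} (hX : DimLE (k + 2) S X)
    (hl : ∀ Q : Ideal R, IsParameterIdealFor M (k + 2) Q → ∀ e : ℕ → ℤ,
      HasHilbertCoeffsMod M Q (k + 2) e → -(l : ℤ) ≤ e 1)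
    (x : ℕ → S) (hx : ∀ i, x i ∈ algebraMap R S '' (maximalIdeal R : Set R))
    (hxX : IsFilterSeq X x (k + 2)) :
    Module.length S (powTors (maximalIdeal S) (X ⧸ initSub X x (k + 1))) ≤
      l + Module.length S (powTors (maximalIdeal S) (X ⧸ initSub X x k)) := by
  choose y hy hyx using hx
  let Q : Ideal R := Ideal.span (Set.range fun i : Fin (k + 2) => y i)
  have hQ : Q.map (algebraMap R S) = initIdeal x (k + 2) := by
    rw [Ideal.map_span, initIdeal_eq_span, ← Set.range_comp]
    congr 2
    exact funext fun i => hyx i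
  have hfin0 : Module.length S (X ⧸ (initIdeal x (k + 2) • ⊤ : Submodule S X)) ≠ ⊤ :=
    dimLE_zero_iff.1 (hxX.dimLE (d := 0) hX)
  have hfin (n : ℕ) : Module.length S (X ⧸ (initIdeal x (k + 2) ^ n • ⊤ : Submodule S X)) ≠ ⊤ :=
    length_quotient_pow_ne_top hfin0 n
  have hlen (n : ℕ) : Module.length R (M ⧸ (Q ^ n • ⊤ : Submodule R M)) =
      Module.length S (X ⧸ (initIdeal x (k + 2) ^ n • ⊤ : Submodule S X)) := by
    have := hι.length_quotient_eq hRS (Q ^ n)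
    rw [Ideal.map_pow, hQ] at this
    exact this (hfin n)
  have hpar : IsParameterIdealFor M (k + 2) Q := by
    refine ⟨⟨_, fun i => hy i, rfl⟩,
      (Module.length S (X ⧸ (initIdeal x (k + 2) ^ 1 • ⊤ : Submodule S X))).toNat, ?_⟩
    have h1 := hlen 1
    rw [pow_one] at h1
    rw [moduleLength_eq_natCast, h1, ENat.natCast_toNat (hfin 1)]
  obtain ⟨a, ha, ha1⟩ := hxX.isDSeq.exists_coeffs fun n => hfin (n + 1)
  have hcoeff : HasHilbertCoeffsMod M Q (k + 2) fun i => (-1) ^ i * a i := by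
    refine (hasHilbertCoeffsMod_iff fun n => by rw [hlen]; exact hfin _).2 ⟨0, fun n _ => ?_⟩
    rw [hlen, ha]
    refine Finset.sum_congr rfl fun i _ => ?_
    rw [← mul_assoc, ← pow_add, Even.neg_one_pow ⟨i, rfl⟩, one_mul]
  have h1 := hl Q hpar _ hcoeff
  rw [hxX.colonLength_eq (by omega), hxX.colonLength_eq (by omega)] at ha1
  rw [← ENat.natCast_toNat (length_powTors_ne_top (S := S) (X ⧸ initSub X x (k + 1))),
    ← ENat.natCast_toNat (length_powTors_ne_top (S := S) (X ⧸ initSub X x k)), ← Nat.cast_add,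
    ENat.natCast_le_natCast]
  simp only [pow_one] at h1
  omega

theorem isGeneralizedCMModule_of_le_coeff {k l : ℕ} (hunmixed : IsUnmixedModule R M (k + 2))
    (hl : ∀ Q : Ideal R, IsParameterIdealFor M (k + 2) Q → ∀ e : ℕ → ℤ,
      HasHilbertCoeffsMod M Q (k + 2) e → -(l : ℤ) ≤ e 1) :
    IsGeneralizedCMModule R M (k + 2) := by
  let S := AdicCompletion (maximalIdeal R) R
  let X := AdicCompletion (maximalIdeal R) M
  have hRS : IsDenseLocal R S := isDenseLocal_completion R
  have hι : IsDenseStrict S (AdicCompletion.of (maximalIdeal R) M) := isDenseStrict_of R M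
  have hdim : DimLE (k + 2) S X := dimLE_of_associatedPrimes fun p hp => (hunmixed p hp).le
  obtain ⟨E, _, _, e, hE⟩ := exists_isResidueHull S
  have hdual : DualDimLT S E (k + 2) X := dualDimLT_of_nonmaxAss hE X fun p hp => hunmixed p hp.1
  have hX := length_H_le_of_jump_le hE (isGeneric_image hRS.maximalIdeal_eq) k X hdual
    fun x hx hxX => length_powTors_le_of_le_coeff hRS hι hdim hl x hx hxX
  intro i hi
  obtain ⟨L, hL⟩ := exists_length_H_le_of_isDenseStrict hRS i
    fun | 0 => (Module.length S (H (maximalIdeal S) 0 X)).toNat | _ + 1 => l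
  have hle := hL M X _ hι fun a ha => by
    cases a with
    | zero => exact (ENat.natCast_toNat (length_H_zero_ne_top (S := S) X)).ge
    | succ a => exact hX a (by omega)
  exact ⟨_, localCohomologyLength_eq_natCast.2
    (ENat.natCast_toNat (ne_top_of_le_ne_top (ENat.natCast_ne_top L) hle)).symm⟩

end Main

end LocCoh

/-- **Ghezzi–Goto–Hong–Ozeki–Phuong–Vasconcelos, Proposition 4.2 and Theorem 4.5**.
Let `(R,m)` be a Noetherian local ring and `M` a finitely generated unmixed `R`-module of
dimension `s ≥ 2`.  Then `M` is generalized Cohen-Macaulay iff the set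
`Λ(M) = {e₁(Q,M) : Q a parameter ideal for M}` is finite; in that case
`-∑_{i=1}^{s-1} C(s-2,i-1)·λ(Hⁱ_m(M)) ≤ e₁(Q,M) ≤ 0` for every parameter ideal `Q`. -/
theorem generalized_cm_iff_chern_finite
    {R M : Type u} [CommRing R] [IsNoetherianRing R] [IsLocalRing R]
    [AddCommGroup M] [Module R M] [Module.Finite R M]
    (s : ℕ) (hs : 2 ≤ s)
    (hdimM : ringKrullDim (R ⧸ Module.annihilator R M) = s)
    (hunmixed : IsUnmixedModule R M s) :
    (IsGeneralizedCMModule R M s ↔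
      Set.Finite {c : ℤ | ∃ Q : Ideal R, IsParameterIdealFor M s Q ∧
        ∃ e : ℕ → ℤ, HasHilbertCoeffsMod M Q s e ∧ e 1 = c}) ∧
    (IsGeneralizedCMModule R M s →
      ∀ Q : Ideal R, IsParameterIdealFor M s Q →
        ∀ e : ℕ → ℤ, HasHilbertCoeffsMod M Q s e →
          e 1 ≤ 0 ∧
          ∀ h : ℕ → ℕ, (∀ i, i < s → localCohomologyLength R M i = (h i : WithBot ℕ∞)) →
            -∑ i ∈ Finset.Icc 1 (s - 1), ((s - 2).choose (i - 1) : ℤ) * h i ≤ e 1) := by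
  obtain ⟨k, rfl⟩ := Nat.exists_eq_add_of_le' hs
  have hbound (h : ℕ → ℕ)
      (hh : ∀ i, i < k + 2 → localCohomologyLength R M i = (h i : WithBot ℕ∞)) (Q : Ideal R)
      (hQ : IsParameterIdealFor M (k + 2) Q) (e : ℕ → ℤ) (he : HasHilbertCoeffsMod M Q (k + 2) e) :
      e 1 ≤ 0 ∧
        -∑ i ∈ Finset.Icc 1 (k + 2 - 1), ((k + 2 - 2).choose (i - 1) : ℤ) * h i ≤ e 1 := by
    have hsum : ∑ i ∈ Finset.Icc 1 (k + 2 - 1), ((k + 2 - 2).choose (i - 1) : ℤ) * h i =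
        ∑ i ∈ Finset.range (k + 1), (k.choose i : ℤ) * h (i + 1) := by
      rw [← Finset.Ico_add_one_right_eq_Icc, Finset.sum_Ico_eq_sum_range]
      exact Finset.sum_congr rfl fun i _ => by simp [add_comm]
    rw [hsum]
    exact LocCoh.hilbertCoeff_one_bounds k hQ he h fun i hi =>
      LocCoh.localCohomologyLength_eq_natCast.1 (hh i hi)
  have hchoose (hM : IsGeneralizedCMModule R M (k + 2)) :
      ∃ h : ℕ → ℕ, ∀ i, i < k + 2 → localCohomologyLength R M i = (h i : WithBot ℕ∞) := by
    choose! h hh using hM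
    exact ⟨h, hh⟩
  refine ⟨⟨fun hM => ?_, fun hfin => ?_⟩, fun hM Q hQ e he => ?_⟩
  · obtain ⟨h, hh⟩ := hchoose hM
    refine (Set.finite_Icc (-∑ i ∈ Finset.Icc 1 (k + 2 - 1),
      ((k + 2 - 2).choose (i - 1) : ℤ) * h i) 0).subset ?_
    rintro _ ⟨Q, hQ, e, he, rfl⟩
    exact ⟨(hbound h hh Q hQ e he).2, (hbound h hh Q hQ e he).1⟩
  · obtain ⟨b, hb⟩ := hfin.bddBelow
    refine LocCoh.isGeneralizedCMModule_of_le_coeff (l := b.natAbs) hunmixed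
      fun Q hQ e he => ?_
    have := hb ⟨Q, hQ, e, he, rfl⟩
    omega
  · obtain ⟨h, hh⟩ := hchoose hM
    exact ⟨(hbound h hh Q hQ e he).1, fun h' hh' => (hbound h' hh' Q hQ e he).2⟩
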